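/- (Hadwiger's containment theorem, hyperbolic case.) Let K and L be compact geodesically convex subsets of the hyperbolic plane H² (of constant curvature −1) with nonempty interiors. If P_K·P_L ≤ 2π·(A_K + A_L) + A_K·A_L, then there exists an isometry g of H² such that either gK ⊆ L or gL ⊆ K. -/

import Mathlib

open MeasureTheory Metric Real UpperHalfPlane

open scoped UpperHalfPlane

noncomputable section

instance : MeasurableSpace ℍ := borel ℍ

instance : BorelSpace ℍ := ⟨rfl⟩

/-- The hyperbolic area measure on the upper half-plane: the measure with density
`y⁻²` with respect to the planar Lebesgue measure. -/
def hypAreaMeasure : Measure ℍ :=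
  (Measure.comap (fun z : ℍ => (z : ℂ)) volume).withDensity
    (fun z => ENNReal.ofReal ((z.im ^ 2)⁻¹))

/-- The hyperbolic area of a subset of the hyperbolic plane. -/
def hypArea (K : Set ℍ) : ℝ := (hypAreaMeasure K).toReal

/-- The hyperbolic perimeter: one-dimensional Hausdorff measure (with respect to the
hyperbolic metric) of the topological boundary. -/
def hypPerim (K : Set ℍ) : ℝ := (μH[1] (frontier K)).toReal

/-- Geodesic convexity in the hyperbolic plane. -/
def HypConvex (K : Set ℍ) : Prop :=
  ∀ x ∈ K, ∀ y ∈ K, ∀ z : ℍ, dist x z + dist z y = dist x y → z ∈ K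

/-- The hyperbolic circumradius of `K`. -/
def hypCircumradius (K : Set ℍ) : ℝ :=
  sInf {R : ℝ | ∃ c : ℍ, K ⊆ Metric.closedBall c R}

/-- The hyperbolic inradius of `K`. -/
def hypInradius (K : Set ℍ) : ℝ :=
  sSup {r : ℝ | ∃ c : ℍ, Metric.closedBall c r ⊆ K}

/-- `K` is a closed hyperbolic disc of positive radius. -/
def IsHypDisc (K : Set ℍ) : Prop :=
  ∃ (c : ℍ) (r : ℝ), 0 < r ∧ K = Metric.closedBall c r

end

section parta

open MeasureTheory Metric Real UpperHalfPlane
open scoped UpperHalfPlane MatrixGroups ENNReal NNReal Topology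

/-! ## The group -/

instance hadSLMeas : MeasurableSpace SL(2, ℝ) := borel _
instance hadSLBorel : BorelSpace SL(2, ℝ) := ⟨rfl⟩
instance hadSLLC : LocallyCompactSpace SL(2, ℝ) := by
  have : LocallyCompactSpace (Matrix (Fin 2) (Fin 2) ℝ) :=
    inferInstanceAs (LocallyCompactSpace (Fin 2 → Fin 2 → ℝ))
  exact (Matrix.SpecialLinearGroup.isClosedEmbedding_val (n := Fin 2) (R := ℝ)).locallyCompactSpace
instance hadSLSC : SecondCountableTopology SL(2, ℝ) := by
  have : SecondCountableTopology (Matrix (Fin 2) (Fin 2) ℝ) :=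
    inferInstanceAs (SecondCountableTopology (Fin 2 → Fin 2 → ℝ))
  exact (Matrix.SpecialLinearGroup.isClosedEmbedding_val
    (n := Fin 2) (R := ℝ)).isEmbedding.secondCountableTopology
instance hadSLT2 : T2Space SL(2, ℝ) :=
  (Matrix.SpecialLinearGroup.isClosedEmbedding_val (n := Fin 2) (R := ℝ)).isEmbedding.t2Space

/-- Haar measure on the group. -/
noncomputable def hm : Measure SL(2, ℝ) := Measure.haar

instance : hm.IsHaarMeasure := inferInstanceAs (Measure.haar.IsHaarMeasure)
instance : hm.Regular := inferInstanceAs (Measure.haar.Regular)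
instance : SigmaFinite hm := inferInstance
instance : hm.InnerRegular := inferInstance

lemma modular_trivial (g : SL(2, ℝ)) : Measure.modularCharacterFun g = 1 := by
  have h := Matrix.SL2.commutator_eq_top (F := ℝ) (a := 2) (by norm_num) (by norm_num)
  have h2 : commutator SL(2, ℝ) ≤ (Measure.modularCharacter (G := SL(2, ℝ))).ker := by
    rw [commutator_eq_closure, Subgroup.closure_le]
    rintro x ⟨a, b, rfl⟩
    rw [SetLike.mem_coe, MonoidHom.mem_ker, commutatorElement_def]
    simp only [map_mul]
    have e : ∀ a : SL(2, ℝ), Measure.modularCharacter a * Measure.modularCharacter a⁻¹ = 1 := by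
      intro a; rw [← map_mul, mul_inv_cancel, map_one]
    calc _ = (Measure.modularCharacter a * Measure.modularCharacter a⁻¹) *
        (Measure.modularCharacter b * Measure.modularCharacter b⁻¹) := by ring
      _ = 1 := by rw [e, e, one_mul]
  have h3 : g ∈ commutator SL(2, ℝ) := by rw [h]; trivial
  exact h2 h3

instance : hm.IsMulRightInvariant := ⟨fun g => by
  rw [Measure.map_right_mul_eq_modularCharacterFun_smul, modular_trivial, one_smul]⟩

instance : hm.IsInvInvariant := ⟨by
  have hH : hm.inv.IsMulLeftInvariant := inferInstance
  have e1 := Measure.isMulLeftInvariant_eq_smul (μ' := hm.inv) (μ := hm)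
  set k := Measure.haarScalarFactor hm.inv hm
  have e2 : hm = k • hm.inv := by
    have : hm.inv.inv = (k • hm).inv := by rw [← e1]
    rw [Measure.inv_inv] at this
    conv_lhs => rw [this]
    rw [Measure.inv, Measure.inv, Measure.map_smul]
  have e3 : hm = (k * k) • hm := by
    conv_lhs => rw [e2, e1]
    rw [smul_smul]
  obtain ⟨K⟩ : Nonempty (TopologicalSpace.PositiveCompacts SL(2, ℝ)) := inferInstance
  have hK0 : hm K ≠ 0 := (Measure.measure_pos_of_nonempty_interior hm K.interior_nonempty).ne'
  have hK1 : hm K ≠ ∞ := K.isCompact.measure_lt_top.ne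
  have e4 : hm K = ((k * k : ℝ≥0) : ℝ≥0∞) * hm K := by
    conv_lhs => rw [e3]
    rfl
  have e5 : ((k * k : ℝ≥0) : ℝ≥0∞) = 1 := by
    have : 1 * hm K = ((k * k : ℝ≥0) : ℝ≥0∞) * hm K := by rw [one_mul]; exact e4
    exact ((ENNReal.mul_left_inj hK0 hK1).1 this).symm
  have e6 : k = 1 := by
    have : k * k = 1 := by exact_mod_cast e5
    nlinarith [mul_self_eq_one_iff.1 (show (k : ℝ) * k = 1 by exact_mod_cast this), k.2]
  rw [e1, e6, one_smul]⟩

end parta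

section partb

open MeasureTheory Metric Real UpperHalfPlane
open scoped UpperHalfPlane MatrixGroups ENNReal NNReal Topology

/-! ## The projective chart -/

/-- squared modulus -/
noncomputable def nq (z : ℍ) : ℝ := z.re ^ 2 + z.im ^ 2

lemma nq_pos (z : ℍ) : 0 < nq z := by
  have := z.im_pos; unfold nq; positivity

lemma nq_gt (z : ℍ) : z.re ^ 2 < nq z := by
  have := z.im_pos; unfold nq; nlinarith

lemma im_sq (z : ℍ) : z.im ^ 2 = nq z - z.re ^ 2 := by unfold nq; ring

lemma ch_ext {z w : ℍ} (h1 : z.re = w.re) (h2 : nq z = nq w) : z = w := by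
  refine UpperHalfPlane.ext_re_im h1 ?_
  have : z.im ^ 2 = w.im ^ 2 := by rw [im_sq, im_sq, h1, h2]
  have a := z.im_pos
  have b := w.im_pos
  nlinarith [sq_nonneg (z.im - w.im)]

lemma continuous_nq : Continuous nq := by
  unfold nq
  exact (UpperHalfPlane.continuous_re.pow 2).add (UpperHalfPlane.continuous_im.pow 2)

/-- affine functions in the chart -/
noncomputable def ev (l : ℝ × ℝ × ℝ) (z : ℍ) : ℝ := l.1 * nq z + l.2.1 * z.re + l.2.2

lemma continuous_ev (l : ℝ × ℝ × ℝ) : Continuous (ev l) := by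
  unfold ev
  exact ((continuous_const.mul continuous_nq).add
    (continuous_const.mul UpperHalfPlane.continuous_re)).add continuous_const

noncomputable def mkz (u v : ℝ) (h : u ^ 2 < v) : ℍ :=
  ⟨⟨u, √(v - u ^ 2)⟩, Real.sqrt_pos.2 (by linarith)⟩

lemma mkz_re (u v : ℝ) (h : u ^ 2 < v) : (mkz u v h).re = u := rfl
lemma mkz_im (u v : ℝ) (h : u ^ 2 < v) : (mkz u v h).im = √(v - u ^ 2) := rfl
lemma mkz_nq (u v : ℝ) (h : u ^ 2 < v) : nq (mkz u v h) = v := by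
  unfold nq; rw [mkz_re, mkz_im, Real.sq_sqrt (by linarith)]; ring

lemma comb_lt (p q : ℍ) {t : ℝ} (h0 : 0 ≤ t) (h1 : t ≤ 1) :
    ((1 - t) * p.re + t * q.re) ^ 2 < (1 - t) * nq p + t * nq q := by
  have a := nq_gt p
  have b := nq_gt q
  rcases eq_or_lt_of_le h0 with rfl | h0
  · simpa using a
  · nlinarith [mul_pos h0 (sub_pos.2 b), mul_nonneg (sub_nonneg.2 h1) (sub_pos.2 a).le,
      mul_nonneg (mul_nonneg h0.le (sub_nonneg.2 h1)) (sq_nonneg (p.re - q.re))]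

/-- chart convex combination -/
noncomputable def cmb (p q : ℍ) (t : ℝ) : ℍ :=
  if h : 0 ≤ t ∧ t ≤ 1 then mkz _ _ (comb_lt p q h.1 h.2) else p

lemma cmb_re (p q : ℍ) {t : ℝ} (h0 : 0 ≤ t) (h1 : t ≤ 1) :
    (cmb p q t).re = (1 - t) * p.re + t * q.re := by
  unfold cmb; rw [dif_pos ⟨h0, h1⟩, mkz_re]

lemma cmb_nq (p q : ℍ) {t : ℝ} (h0 : 0 ≤ t) (h1 : t ≤ 1) :
    nq (cmb p q t) = (1 - t) * nq p + t * nq q := by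
  unfold cmb; rw [dif_pos ⟨h0, h1⟩, mkz_nq]

lemma cmb_ev (l : ℝ × ℝ × ℝ) (p q : ℍ) {t : ℝ} (h0 : 0 ≤ t) (h1 : t ≤ 1) :
    ev l (cmb p q t) = (1 - t) * ev l p + t * ev l q := by
  unfold ev; rw [cmb_re p q h0 h1, cmb_nq p q h0 h1]; ring

lemma cmb_zero (p q : ℍ) : cmb p q 0 = p := by
  refine ch_ext ?_ ?_
  · rw [cmb_re p q le_rfl zero_le_one]; ring
  · rw [cmb_nq p q le_rfl zero_le_one]; ring

lemma cmb_one (p q : ℍ) : cmb p q 1 = q := by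
  refine ch_ext ?_ ?_
  · rw [cmb_re p q zero_le_one le_rfl]; ring
  · rw [cmb_nq p q zero_le_one le_rfl]; ring

lemma cmb_self (p : ℍ) (t : ℝ) : cmb p p t = p := by
  by_cases h : 0 ≤ t ∧ t ≤ 1
  · refine ch_ext ?_ ?_
    · rw [cmb_re p p h.1 h.2]; ring
    · rw [cmb_nq p p h.1 h.2]; ring
  · unfold cmb; rw [dif_neg h]

/-- chart convexity -/
def CConv (K : Set ℍ) : Prop :=
  ∀ p ∈ K, ∀ q ∈ K, ∀ t : ℝ, 0 ≤ t → t ≤ 1 → cmb p q t ∈ K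

/-- chart segment -/
def seg (p q : ℍ) : Set ℍ := cmb p q '' Set.Icc 0 1

/-! ### The distance -/

lemma cosh_le_nonneg {a b : ℝ} (ha : 0 ≤ a) (hb : 0 ≤ b) :
    Real.cosh a ≤ Real.cosh b ↔ a ≤ b := by
  rw [Real.cosh_le_cosh, abs_of_nonneg ha, abs_of_nonneg hb]

lemma cosh_inj_nonneg {a b : ℝ} (ha : 0 ≤ a) (hb : 0 ≤ b)
    (h : Real.cosh a = Real.cosh b) : a = b :=
  le_antisymm ((cosh_le_nonneg ha hb).1 h.le) ((cosh_le_nonneg hb ha).1 h.ge)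

lemma cosh_dist_nq (z w : ℍ) :
    Real.cosh (dist z w) = (nq z + nq w - 2 * z.re * w.re) / (2 * z.im * w.im) := by
  rw [UpperHalfPlane.cosh_dist']
  unfold nq
  have a := z.im_pos
  have b := w.im_pos
  congr 1
  ring

lemma cosh_dist_mul (z w : ℍ) :
    Real.cosh (dist z w) * (2 * z.im * w.im) = nq z + nq w - 2 * z.re * w.re := by
  have a := z.im_pos
  have b := w.im_pos
  rw [cosh_dist_nq, div_mul_cancel₀]
  positivity

lemma dist_cmb (p q : ℍ) {t : ℝ} (h0 : 0 ≤ t) (h1 : t ≤ 1) :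
    dist p (cmb p q t) + dist (cmb p q t) q = dist p q := by
  set z := cmb p q t with hz
  have hre := cmb_re p q h0 h1
  have hnq := cmb_nq p q h0 h1
  rw [← hz] at hre hnq
  have yp := p.im_pos
  have yq := q.im_pos
  have yz := z.im_pos
  set a := (1 - t) * p.im / z.im with ha
  set b := t * q.im / z.im with hb
  set c := Real.cosh (dist p q) with hc
  have a0 : 0 ≤ a := by
    have : 0 ≤ 1 - t := by linarith
    positivity
  have b0 : 0 ≤ b := by positivity
  have hcm := cosh_dist_mul p q
  rw [← hc] at hcm
  have e1 : Real.cosh (dist p z) = a + b * c := by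
    rw [cosh_dist_nq, ha, hb, div_eq_iff (by positivity)]
    field_simp
    rw [hre, hnq]
    have := im_sq p
    linear_combination (-t) * hcm - 2 * (1 - t) * this
  have e2 : Real.cosh (dist z q) = a * c + b := by
    rw [cosh_dist_nq, ha, hb, div_eq_iff (by positivity)]
    field_simp
    rw [hre, hnq]
    have := im_sq q
    linear_combination (-(1 - t)) * hcm - 2 * t * this
  have e3 : a ^ 2 + b ^ 2 + 2 * a * b * c = 1 := by
    have h3 := im_sq z
    rw [hre, hnq] at h3
    rw [ha, hb]
    field_simp
    linear_combination (1 - t) ^ 2 * im_sq p + t ^ 2 * im_sq q + t * (1 - t) * hcm - h3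
  have hs : Real.sinh (dist p q) ^ 2 = c ^ 2 - 1 := by
    have := Real.cosh_sq (dist p q); rw [← hc] at this; linarith
  have s0 : 0 ≤ Real.sinh (dist p q) := Real.sinh_nonneg_iff.2 dist_nonneg
  have e4 : Real.sinh (dist p z) = b * Real.sinh (dist p q) := by
    have h4 := Real.cosh_sq (dist p z)
    rw [e1] at h4
    have n1 : 0 ≤ Real.sinh (dist p z) := Real.sinh_nonneg_iff.2 dist_nonneg
    have n2 : 0 ≤ b * Real.sinh (dist p q) := by positivity
    refine (sq_eq_sq₀ n1 n2).1 ?_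
    rw [mul_pow, hs]
    linear_combination (-1) * h4 + e3
  have e5 : Real.sinh (dist z q) = a * Real.sinh (dist p q) := by
    have h4 := Real.cosh_sq (dist z q)
    rw [e2] at h4
    have n1 : 0 ≤ Real.sinh (dist z q) := Real.sinh_nonneg_iff.2 dist_nonneg
    have n2 : 0 ≤ a * Real.sinh (dist p q) := by positivity
    refine (sq_eq_sq₀ n1 n2).1 ?_
    rw [mul_pow, hs]
    linear_combination (-1) * h4 + e3
  have e6 : Real.cosh (dist p z + dist z q) = Real.cosh (dist p q) := by
    rw [Real.cosh_add, e1, e2, e4, e5, ← hc]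
    linear_combination c * e3 + a * b * hs
  exact cosh_inj_nonneg (by positivity) dist_nonneg e6

lemma HypConvex.cconv {K : Set ℍ} (h : HypConvex K) : CConv K := by
  intro p hp q hq t h0 h1
  exact h p hp q hq _ (dist_cmb p q h0 h1)

/-! ### The action in the chart -/

lemma det2 (g : SL(2, ℝ)) : g 0 0 * g 1 1 - g 0 1 * g 1 0 = 1 := by
  have := g.2
  rw [Matrix.det_fin_two] at this
  exact this

noncomputable def den (g : SL(2, ℝ)) (z : ℍ) : ℝ :=
  g 1 0 ^ 2 * nq z + 2 * (g 1 0) * (g 1 1) * z.re + g 1 1 ^ 2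

lemma den_eq (g : SL(2, ℝ)) (z : ℍ) :
    den g z = (g 1 0 * z.re + g 1 1) ^ 2 + (g 1 0 * z.im) ^ 2 := by
  unfold den nq; ring

lemma den_pos (g : SL(2, ℝ)) (z : ℍ) : 0 < den g z := by
  rw [den_eq]
  have y := z.im_pos
  by_cases h : g 1 0 = 0
  · have := det2 g
    have h2 : g 1 1 ≠ 0 := by rintro h2; rw [h, h2] at this; simp at this
    rw [h]; simp only [zero_mul, zero_add]; positivity
  · positivity

lemma smul_re_im (g : SL(2, ℝ)) (z : ℍ) :
    (g • z).re * den g z = g 0 0 * g 1 0 * nq z + (g 0 0 * g 1 1 + g 0 1 * g 1 0) * z.re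
      + g 0 1 * g 1 1 ∧ (g • z).im * den g z = z.im := by
  have h := UpperHalfPlane.coe_specialLinearGroup_apply g z
  have hd : ((g 1 0 : ℂ) * z + g 1 1) ≠ 0 := by
    intro h0
    have h1 := congrArg Complex.re h0
    have h2 := congrArg Complex.im h0
    simp at h1 h2
    have := den_pos g z
    rw [den_eq, h1] at this
    rcases h2 with h2 | h2
    · rw [h2] at this; simp at this
    · exact z.im_pos.ne' h2
  rw [eq_div_iff (by simpa using hd)] at h
  have h1 := congrArg Complex.re h
  have h2 := congrArg Complex.im h
  simp at h1 h2
  have hdet := det2 g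
  rw [den_eq]
  unfold nq
  set X := (g • z).re
  set Y := (g • z).im
  set c := g 1 0
  set d := g 1 1
  set a := g 0 0
  set b := g 0 1
  constructor
  · linear_combination (c * z.re + d) * h1 + (c * z.im) * h2
  · linear_combination (c * z.re + d) * h2 - (c * z.im) * h1 + z.im * hdet

lemma smul_re (g : SL(2, ℝ)) (z : ℍ) :
    (g • z).re * den g z = g 0 0 * g 1 0 * nq z + (g 0 0 * g 1 1 + g 0 1 * g 1 0) * z.re
      + g 0 1 * g 1 1 := (smul_re_im g z).1

lemma smul_im_den (g : SL(2, ℝ)) (z : ℍ) : (g • z).im * den g z = z.im := (smul_re_im g z).2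

lemma smul_nq (g : SL(2, ℝ)) (z : ℍ) :
    nq (g • z) * den g z = g 0 0 ^ 2 * nq z + 2 * g 0 0 * g 0 1 * z.re + g 0 1 ^ 2 := by
  have h0 := (den_pos g z)
  have h1 := smul_re g z
  have h2 := smul_im_den g z
  have hdet := det2 g
  have : (nq (g • z) * den g z - (g 0 0 ^ 2 * nq z + 2 * g 0 0 * g 0 1 * z.re + g 0 1 ^ 2))
      * den g z = 0 := by
    have e : nq (g • z) * den g z * den g z =
      ((g • z).re * den g z) ^ 2 + ((g • z).im * den g z) ^ 2 := by unfold nq; ring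
    rw [sub_mul, e, h1, h2]
    unfold den
    have := im_sq z
    set x := z.re
    set y := z.im
    set n := nq z
    set c := g 1 0
    set d := g 1 1
    set a := g 0 0
    set b := g 0 1
    rw [this]
    linear_combination (-(n - x ^ 2)) * (a * d - b * c + 1) * hdet
  have h3 := (mul_eq_zero.1 this).resolve_right h0.ne'
  linarith

/-- pulling back an affine function -/
noncomputable def pull (g : SL(2, ℝ)) (l : ℝ × ℝ × ℝ) : ℝ × ℝ × ℝ :=
  (l.1 * g 0 0 ^ 2 + l.2.1 * (g 0 0 * g 1 0) + l.2.2 * g 1 0 ^ 2,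
   2 * l.1 * (g 0 0 * g 0 1) + l.2.1 * (g 0 0 * g 1 1 + g 0 1 * g 1 0)
      + 2 * l.2.2 * (g 1 0 * g 1 1),
   l.1 * g 0 1 ^ 2 + l.2.1 * (g 0 1 * g 1 1) + l.2.2 * g 1 1 ^ 2)

lemma ev_pull (g : SL(2, ℝ)) (l : ℝ × ℝ × ℝ) (z : ℍ) :
    ev (pull g l) z = den g z * ev l (g • z) := by
  have h1 := smul_re g z
  have h2 := smul_nq g z
  unfold ev
  have : den g z * (l.1 * nq (g • z) + l.2.1 * (g • z).re + l.2.2) =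
    l.1 * (nq (g • z) * den g z) + l.2.1 * ((g • z).re * den g z) + l.2.2 * den g z := by ring
  rw [this, h1, h2]
  unfold den pull
  ring

lemma ev_pull_nonneg (g : SL(2, ℝ)) (l : ℝ × ℝ × ℝ) (z : ℍ) :
    0 ≤ ev (pull g l) z ↔ 0 ≤ ev l (g • z) := by
  rw [ev_pull]; exact mul_nonneg_iff_of_pos_left (den_pos g z)

lemma ev_pull_zero (g : SL(2, ℝ)) (l : ℝ × ℝ × ℝ) (z : ℍ) :
    ev (pull g l) z = 0 ↔ ev l (g • z) = 0 := by
  rw [ev_pull, mul_eq_zero]; simp [(den_pos g z).ne']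

lemma smul_cmb (g : SL(2, ℝ)) (p q : ℍ) {t : ℝ} (h0 : 0 ≤ t) (h1 : t ≤ 1) :
    ∃ s : ℝ, 0 ≤ s ∧ s ≤ 1 ∧ g • cmb p q t = cmb (g • p) (g • q) s := by
  have dp := den_pos g p
  have dq := den_pos g q
  have dz := den_pos g (cmb p q t)
  have hd : den g (cmb p q t) = (1 - t) * den g p + t * den g q := by
    unfold den; rw [cmb_re p q h0 h1, cmb_nq p q h0 h1]; ring
  have t1 : 0 ≤ 1 - t := by linarith
  have s0 : 0 ≤ t * den g q / den g (cmb p q t) := by positivity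
  have s1 : t * den g q / den g (cmb p q t) ≤ 1 := by
    rw [div_le_one dz, hd]; nlinarith [mul_nonneg t1 dp.le]
  have e1 : (1 - t * den g q / den g (cmb p q t)) * den g (cmb p q t) = (1 - t) * den g p := by
    rw [sub_mul, div_mul_cancel₀ _ dz.ne', hd]; ring
  have e2 : (t * den g q / den g (cmb p q t)) * den g (cmb p q t) = t * den g q := by
    rw [div_mul_cancel₀ _ dz.ne']
  refine ⟨_, s0, s1, ch_ext ?_ ?_⟩
  · rw [cmb_re _ _ s0 s1]
    have := smul_re g (cmb p q t)
    rw [cmb_re p q h0 h1, cmb_nq p q h0 h1] at this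
    refine mul_right_cancel₀ dz.ne' ?_
    rw [this]
    linear_combination (-(g • p).re) * e1 - (g • q).re * e2 - (1 - t) * smul_re g p
      - t * smul_re g q
  · rw [cmb_nq _ _ s0 s1]
    have := smul_nq g (cmb p q t)
    rw [cmb_re p q h0 h1, cmb_nq p q h0 h1] at this
    refine mul_right_cancel₀ dz.ne' ?_
    rw [this]
    linear_combination (-nq (g • p)) * e1 - nq (g • q) * e2 - (1 - t) * smul_nq g p
      - t * smul_nq g q

end partb

section partc

open MeasureTheory Metric Real UpperHalfPlane
open scoped UpperHalfPlane MatrixGroups ENNReal NNReal Topology Pointwise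

/-! ### images -/

lemma CConv.smul {K : Set ℍ} (hK : CConv K) (g : SL(2, ℝ)) : CConv (g • K) := by
  intro p hp q hq t h0 h1
  rw [Set.mem_smul_set_iff_inv_smul_mem] at *
  obtain ⟨s, s0, s1, e⟩ := smul_cmb g⁻¹ p q h0 h1
  rw [e]
  exact hK _ hp _ hq s s0 s1

lemma smul_seg_subset (g : SL(2, ℝ)) (p q : ℍ) : g • seg p q ⊆ seg (g • p) (g • q) := by
  rintro _ ⟨_, ⟨t, ⟨h0, h1⟩, rfl⟩, rfl⟩
  obtain ⟨s, s0, s1, e⟩ := smul_cmb g p q h0 h1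
  exact ⟨s, ⟨s0, s1⟩, e.symm⟩

lemma smul_seg (g : SL(2, ℝ)) (p q : ℍ) : g • seg p q = seg (g • p) (g • q) := by
  refine (smul_seg_subset g p q).antisymm ?_
  have := smul_seg_subset g⁻¹ (g • p) (g • q)
  rw [inv_smul_smul, inv_smul_smul] at this
  rw [← Set.subset_smul_set_iff] at this
  simpa using this

lemma left_mem_seg (p q : ℍ) : p ∈ seg p q := ⟨0, by simp, cmb_zero p q⟩
lemma right_mem_seg (p q : ℍ) : q ∈ seg p q := ⟨1, by simp, cmb_one p q⟩

/-- homogeneous point on the imaginary axis -/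
noncomputable def yi (t : ℝ) : ℍ := ⟨⟨0, Real.exp t⟩, Real.exp_pos t⟩

lemma yi_re (t : ℝ) : (yi t).re = 0 := rfl
lemma yi_im (t : ℝ) : (yi t).im = Real.exp t := rfl
lemma yi_nq (t : ℝ) : nq (yi t) = Real.exp (2 * t) := by
  unfold nq; rw [yi_re, yi_im, ← Real.exp_nat_mul]; push_cast; ring

lemma yi_zero : yi 0 = UpperHalfPlane.I := by
  refine UpperHalfPlane.ext_re_im ?_ ?_ <;> simp [yi_re, yi_im]

lemma dist_yi (s t : ℝ) : dist (yi s) (yi t) = |s - t| := by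
  rw [UpperHalfPlane.dist_of_re_eq (by rfl), yi_im, yi_im, Real.log_exp, Real.log_exp,
    Real.dist_eq]

lemma continuous_yi : Continuous yi :=
  (Isometry.of_dist_eq (fun s t => by rw [dist_yi, Real.dist_eq])).continuous

lemma seg_yi {s t : ℝ} (h : s ≤ t) : seg (yi s) (yi t) = yi '' Set.Icc s t := by
  ext z
  constructor
  · rintro ⟨r, ⟨h0, h1⟩, rfl⟩
    have e1 := cmb_re (yi s) (yi t) h0 h1
    have e2 := cmb_nq (yi s) (yi t) h0 h1
    rw [yi_re, yi_re] at e1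
    rw [yi_nq, yi_nq] at e2
    have hm : Real.exp (2 * s) ≤ Real.exp (2 * t) := Real.exp_le_exp.2 (by linarith)
    have b1 : Real.exp (2 * s) ≤ nq (cmb (yi s) (yi t) r) := by rw [e2]; nlinarith
    have b2 : nq (cmb (yi s) (yi t) r) ≤ Real.exp (2 * t) := by rw [e2]; nlinarith
    have hp := nq_pos (cmb (yi s) (yi t) r)
    refine ⟨Real.log (nq (cmb (yi s) (yi t) r)) / 2, ⟨?_, ?_⟩, ch_ext ?_ ?_⟩
    · have := (Real.le_log_iff_exp_le hp).2 b1; linarith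
    · have := (Real.log_le_iff_le_exp hp).2 b2; linarith
    · rw [yi_re, e1]; ring
    · rw [yi_nq]; rw [mul_div_cancel₀ _ (by norm_num : (2 : ℝ) ≠ 0), Real.exp_log hp]
  · rintro ⟨r, ⟨h0, h1⟩, rfl⟩
    have m1 : Real.exp (2 * s) ≤ Real.exp (2 * r) := Real.exp_le_exp.2 (by linarith)
    have m2 : Real.exp (2 * r) ≤ Real.exp (2 * t) := Real.exp_le_exp.2 (by linarith)
    rcases eq_or_lt_of_le h with rfl | hlt
    · have : r = s := le_antisymm h1 h0
      rw [this]; exact left_mem_seg _ _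
    have m3 : Real.exp (2 * s) < Real.exp (2 * t) := Real.exp_lt_exp.2 (by linarith)
    have a0 : 0 ≤ (Real.exp (2 * r) - Real.exp (2 * s)) / (Real.exp (2 * t) - Real.exp (2 * s)) :=
      div_nonneg (by linarith) (by linarith)
    have a1 : (Real.exp (2 * r) - Real.exp (2 * s)) / (Real.exp (2 * t) - Real.exp (2 * s)) ≤ 1 :=
      (div_le_one (by linarith)).2 (by linarith)
    refine ⟨_, ⟨a0, a1⟩, ch_ext ?_ ?_⟩
    · rw [cmb_re _ _ a0 a1]; simp [yi_re]
    · rw [cmb_nq _ _ a0 a1, yi_nq, yi_nq, yi_nq]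
      have : Real.exp (2 * t) - Real.exp (2 * s) ≠ 0 := by linarith
      field_simp; ring

/-- rotation about `I` -/
noncomputable def rot (θ : ℝ) : SL(2, ℝ) :=
  ⟨!![Real.cos θ, Real.sin θ; -Real.sin θ, Real.cos θ], by
    rw [Matrix.det_fin_two_of]; nlinarith [Real.sin_sq_add_cos_sq θ]⟩

lemma rot_00 (θ : ℝ) : rot θ 0 0 = Real.cos θ := rfl
lemma rot_01 (θ : ℝ) : rot θ 0 1 = Real.sin θ := rfl
lemma rot_10 (θ : ℝ) : rot θ 1 0 = -Real.sin θ := rfl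
lemma rot_11 (θ : ℝ) : rot θ 1 1 = Real.cos θ := rfl

lemma den_rot_I (θ : ℝ) : den (rot θ) I = 1 := by
  rw [den_eq, rot_10, rot_11]; simp

lemma rot_I (θ : ℝ) : rot θ • I = I := by
  have h := smul_re (rot θ) I
  have h2 := smul_im_den (rot θ) I
  rw [den_rot_I] at h h2
  refine UpperHalfPlane.ext_re_im ?_ ?_
  · rw [rot_00, rot_01, rot_10, rot_11] at h
    simp [nq] at h ⊢
    linarith
  · simpa using h2

/-- moving a pair of points to the imaginary axis -/
lemma exists_std0 (q : ℍ) : ∃ h : SL(2, ℝ), h • I = I ∧ h • q = yi (dist I q) := by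
  -- choose the angle
  obtain ⟨θ, hθ⟩ : ∃ θ : ℝ, (rot θ • q).re = 0 := by
    let F : ℝ → ℝ := fun θ => (- Real.cos θ * Real.sin θ) * nq q +
      (Real.cos θ ^ 2 - Real.sin θ ^ 2) * q.re + Real.sin θ * Real.cos θ
    have hc : Continuous F := by fun_prop
    have hF0 : F 0 = q.re := by simp [F]
    have hF1 : F (π / 2) = - q.re := by simp [F]
    have : (0 : ℝ) ∈ Set.uIcc (F 0) (F (π / 2)) := by
      rw [hF0, hF1, Set.mem_uIcc]
      rcases le_total 0 q.re with h | h
      · right; constructor <;> linarith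
      · left; constructor <;> linarith
    obtain ⟨θ, -, hθ⟩ := intermediate_value_uIcc hc.continuousOn this
    refine ⟨θ, ?_⟩
    have h := smul_re (rot θ) q
    have : (rot θ • q).re * den (rot θ) q = F θ := by
      rw [h, rot_00, rot_01, rot_10, rot_11]; simp only [F]; ring
    rw [hθ] at this
    exact (mul_eq_zero.1 this).resolve_right (den_pos _ _).ne'
  have key : ∀ w : ℍ, w.re = 0 → ∃ k : SL(2, ℝ), k • I = I ∧ (k • w).re = 0 ∧ 1 ≤ (k • w).im := by
    intro w hw
    rcases le_total 1 w.im with h | h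
    · exact ⟨1, by simp, by simpa using hw, by simpa using h⟩
    · refine ⟨rot (π / 2), rot_I _, ?_, ?_⟩
      · have := smul_re (rot (π / 2)) w
        rw [rot_00, rot_01, rot_10, rot_11, hw] at this
        simp at this
        exact this.resolve_right (den_pos _ _).ne'
      · have := smul_im_den (rot (π / 2)) w
        rw [den_eq, rot_10, rot_11, hw] at this
        simp at this
        have y := w.im_pos
        have : (rot (π / 2) • w).im * w.im = 1 := by
          refine mul_right_cancel₀ y.ne' ?_
          linarith
        nlinarith [(rot (π / 2) • w).im_pos]
  obtain ⟨k, k1, k2, k3⟩ := key _ hθ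
  refine ⟨k * rot θ, by rw [mul_smul, rot_I, k1], ?_⟩
  rw [mul_smul]
  set w := k • rot θ • q with hw
  have hd : dist I q = dist I w := by
    rw [hw]
    conv_rhs => rw [← k1, ← rot_I θ]
    rw [dist_smul, dist_smul]
  have hwl : w = yi (Real.log w.im) := by
    refine UpperHalfPlane.ext_re_im ?_ ?_
    · rw [k2, yi_re]
    · rw [yi_im, Real.exp_log w.im_pos]
  rw [hd]
  conv_rhs => rw [hwl, ← yi_zero, dist_yi]
  conv_lhs => rw [hwl]
  congr 1
  rw [zero_sub, abs_neg, abs_of_nonneg (Real.log_nonneg k3)]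

lemma exists_std (p q : ℍ) : ∃ h : SL(2, ℝ), h • yi 0 = p ∧ h • yi (dist p q) = q := by
  obtain ⟨a, ha⟩ := MulAction.exists_smul_eq SL(2, ℝ) I p
  obtain ⟨k, k1, k2⟩ := exists_std0 (a⁻¹ • q)
  have hd : dist I (a⁻¹ • q) = dist p q := by
    conv_rhs => rw [← ha, ← smul_inv_smul a q, dist_smul]
  rw [hd] at k2
  refine ⟨a * k⁻¹, ?_, ?_⟩
  · rw [yi_zero, mul_smul, ← ha]
    congr 1
    rw [inv_smul_eq_iff]; exact k1.symm
  · rw [mul_smul, ← k2, inv_smul_smul, smul_inv_smul]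

/-- interpolation -/
lemma exists_btw (p q : ℍ) {s t : ℝ} (hs : 0 ≤ s) (ht : 0 ≤ t) (h : dist p q ≤ s + t) :
    ∃ z, dist p z ≤ s ∧ dist z q ≤ t := by
  obtain ⟨g, g1, g2⟩ := exists_std p q
  have hd : 0 ≤ dist p q := dist_nonneg
  refine ⟨g • yi (min s (dist p q)), ?_, ?_⟩
  · have : dist p (g • yi (min s (dist p q))) = dist (g • yi 0) (g • yi (min s (dist p q))) := by
      rw [g1]
    rw [this, dist_smul, dist_yi, zero_sub, abs_neg, abs_of_nonneg (le_min hs hd)]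
    exact min_le_left _ _
  · have : dist (g • yi (min s (dist p q))) q = dist (g • yi (min s (dist p q))) (g • yi (dist p q)) := by
      rw [g2]
    rw [this, dist_smul, dist_yi, abs_sub_comm, abs_of_nonneg (by linarith [min_le_right s (dist p q)])]
    rcases min_choice s (dist p q) with h1 | h1 <;> rw [h1] <;> linarith

lemma seg_std (p q : ℍ) : ∃ h : SL(2, ℝ), h • seg (yi 0) (yi (dist p q)) = seg p q := by
  obtain ⟨h, h1, h2⟩ := exists_std p q
  exact ⟨h, by rw [smul_seg, h1, h2]⟩

lemma isCompact_seg (p q : ℍ) : IsCompact (seg p q) := by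
  obtain ⟨h, hh⟩ := seg_std p q
  rw [← hh, seg_yi dist_nonneg]
  have hc : Continuous yi := continuous_yi
  exact (isCompact_Icc.image hc).smul h

lemma cconv_seg (p q : ℍ) : CConv (seg p q) := by
  rintro _ ⟨a, ⟨a0, a1⟩, rfl⟩ _ ⟨b, ⟨b0, b1⟩, rfl⟩ t t0 t1
  have s0 : 0 ≤ (1 - t) * a + t * b := by nlinarith
  have s1 : (1 - t) * a + t * b ≤ 1 := by nlinarith
  refine ⟨(1 - t) * a + t * b, ⟨s0, s1⟩, ch_ext ?_ ?_⟩
  · rw [cmb_re _ _ s0 s1, cmb_re _ _ t0 t1, cmb_re _ _ a0 a1, cmb_re _ _ b0 b1]; ring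
  · rw [cmb_nq _ _ s0 s1, cmb_nq _ _ t0 t1, cmb_nq _ _ a0 a1, cmb_nq _ _ b0 b1]; ring

end partc

section partd

open MeasureTheory Metric Real UpperHalfPlane
open scoped UpperHalfPlane MatrixGroups ENNReal NNReal Topology Pointwise

/-! ### The area measure -/

lemma meas_emb_coe : MeasurableEmbedding (fun z : ℍ => (z : ℂ)) :=
  UpperHalfPlane.isOpenEmbedding_coe.measurableEmbedding

lemma area_complex {S : Set ℍ} (hS : MeasurableSet S) :
    hypAreaMeasure S = ∫⁻ w in (fun z : ℍ => (z : ℂ)) '' S, ENNReal.ofReal ((w.im ^ 2)⁻¹) := by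
  unfold hypAreaMeasure
  rw [withDensity_apply _ hS]
  have h1 : (volume : Measure ℂ).restrict ((fun z : ℍ => (z : ℂ)) '' S) =
      ((Measure.comap (fun z : ℍ => (z : ℂ)) volume).restrict S).map (fun z : ℍ => (z : ℂ)) := by
    rw [← meas_emb_coe.injective.preimage_image S, ← meas_emb_coe.restrict_map, meas_emb_coe.map_comap,
      meas_emb_coe.injective.preimage_image S, Measure.restrict_restrict
      (meas_emb_coe.measurableSet_image.2 hS)]
    congr 1
    exact (Set.inter_eq_left.2 (Set.image_subset_range _ _)).symm
  rw [h1, meas_emb_coe.lintegral_map]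
  rfl

lemma area_formula {S : Set (ℝ × ℝ)} (hS : MeasurableSet S) :
    hypAreaMeasure {z : ℍ | (z.re, z.im) ∈ S} =
      ∫⁻ y in Set.Ioi (0 : ℝ), ENNReal.ofReal ((y ^ 2)⁻¹) * volume {x : ℝ | (x, y) ∈ S} := by
  have hm : Measurable (fun z : ℍ => (z.re, z.im)) :=
    (UpperHalfPlane.continuous_re.prodMk UpperHalfPlane.continuous_im).measurable
  have hm' : MeasurableSet {z : ℍ | (z.re, z.im) ∈ S} := hm hS
  rw [area_complex hm']
  have himg : (fun z : ℍ => (z : ℂ)) '' {z : ℍ | (z.re, z.im) ∈ S} =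
      Complex.measurableEquivRealProd ⁻¹' (S ∩ {p : ℝ × ℝ | 0 < p.2}) := by
    ext w
    simp only [Set.mem_image, Set.mem_ofPred_eq, Set.mem_preimage, Set.mem_inter_iff,
      Complex.measurableEquivRealProd_apply]
    constructor
    · rintro ⟨z, hz, rfl⟩
      exact ⟨hz, z.im_pos⟩
    · rintro ⟨h1, h2⟩
      exact ⟨⟨w, h2⟩, h1, rfl⟩
  have hS' : MeasurableSet (S ∩ {p : ℝ × ℝ | 0 < p.2}) :=
    hS.inter (measurableSet_lt measurable_const measurable_snd)
  rw [himg]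
  have h2 := Complex.volume_preserving_equiv_real_prod.setLIntegral_comp_preimage hS'
    (f := fun p : ℝ × ℝ => ENNReal.ofReal ((p.2 ^ 2)⁻¹)) (by fun_prop)
  have h3 : ∫⁻ w in Complex.measurableEquivRealProd ⁻¹' (S ∩ {p : ℝ × ℝ | 0 < p.2}),
      ENNReal.ofReal ((w.im ^ 2)⁻¹) = ∫⁻ p in (S ∩ {p : ℝ × ℝ | 0 < p.2}),
        ENNReal.ofReal ((p.2 ^ 2)⁻¹) := h2
  rw [h3, ← lintegral_indicator hS', Measure.volume_eq_prod, lintegral_prod_symm]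
  · rw [← lintegral_indicator measurableSet_Ioi]
    congr 1
    ext y
    by_cases hy : 0 < y
    · rw [Set.indicator_of_mem (by exact hy)]
      have hms : MeasurableSet {x : ℝ | (x, y) ∈ S} := measurable_prodMk_right hS
      rw [← lintegral_indicator_const hms]
      congr 1
      ext x
      by_cases hx : (x, y) ∈ S
      · rw [Set.indicator_of_mem (show (x, y) ∈ S ∩ {p : ℝ × ℝ | 0 < p.2} from ⟨hx, hy⟩), Set.indicator_of_mem (by exact hx)]
      · rw [Set.indicator_of_notMem (show (x, y) ∉ S ∩ {p : ℝ × ℝ | 0 < p.2} from fun h => hx h.1), Set.indicator_of_notMem (by exact hx)]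
    · rw [Set.indicator_of_notMem (by exact hy)]
      have : ∀ x, (S ∩ {p : ℝ × ℝ | 0 < p.2}).indicator
          (fun p : ℝ × ℝ => ENNReal.ofReal ((p.2 ^ 2)⁻¹)) (x, y) = 0 :=
        fun x => Set.indicator_of_notMem (fun h => hy h.2) _
      simp [this]
  · refine Measurable.aemeasurable ?_
    exact Measurable.indicator (by fun_prop) hS'

/-- rectangles -/
def rect (x₁ x₂ s t : ℝ) : Set ℍ :=
  {z | z.re ∈ Set.Ico x₁ x₂ ∧ z.im ∈ Set.Ico (Real.exp s) (Real.exp t)}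

lemma lint_inv_sq {a b : ℝ} (ha : 0 < a) (hab : a ≤ b) :
    ∫⁻ y in Set.Ico a b, ENNReal.ofReal ((y ^ 2)⁻¹) = ENNReal.ofReal (a⁻¹ - b⁻¹) := by
  rw [← ofReal_integral_eq_lintegral_ofReal]
  · rw [integral_Ico_eq_integral_Ioc, ← intervalIntegral.integral_of_le hab]
    congr 1
    have : ∀ x ∈ Set.uIcc a b, HasDerivAt (fun y : ℝ => - y⁻¹) ((x ^ 2)⁻¹) x := by
      intro x hx
      rw [Set.uIcc_of_le hab] at hx
      have := (hasDerivAt_inv (show x ≠ 0 by linarith [hx.1])).fun_neg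
      simpa using this
    rw [intervalIntegral.integral_eq_sub_of_hasDerivAt this]
    · ring
    · apply ContinuousOn.intervalIntegrable
      intro x hx
      rw [Set.uIcc_of_le hab] at hx
      have : x ^ 2 ≠ 0 := by have : 0 < x := by linarith [hx.1]
                             positivity
      exact ((continuousAt_id.pow 2).inv₀ this).continuousWithinAt
  · refine IntegrableOn.mono_set (t := Set.Icc a b) ?_ Set.Ico_subset_Icc_self
    apply ContinuousOn.integrableOn_Icc
    intro x hx
    have : x ^ 2 ≠ 0 := by have : 0 < x := by linarith [hx.1]
                           positivity
    exact ((continuousAt_id.pow 2).inv₀ this).continuousWithinAt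
  · exact Filter.Eventually.of_forall fun y => by positivity

lemma area_rect (x₁ x₂ : ℝ) {s t : ℝ} (h : s ≤ t) : hypAreaMeasure (rect x₁ x₂ s t) =
    ENNReal.ofReal (x₂ - x₁) * ENNReal.ofReal (Real.exp (-s) - Real.exp (-t)) := by
  have hS : MeasurableSet (Set.Ico x₁ x₂ ×ˢ Set.Ico (Real.exp s) (Real.exp t)) :=
    measurableSet_Ico.prod measurableSet_Ico
  have := area_formula hS
  have e : rect x₁ x₂ s t = {z : ℍ | (z.re, z.im) ∈
    Set.Ico x₁ x₂ ×ˢ Set.Ico (Real.exp s) (Real.exp t)} := rfl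
  rw [e, this, Real.exp_neg, Real.exp_neg, ← lint_inv_sq (Real.exp_pos s) (Real.exp_le_exp.2 h),
    ← lintegral_const_mul _ (by fun_prop), ← lintegral_indicator measurableSet_Ioi,
    ← lintegral_indicator measurableSet_Ico]
  congr 1
  ext y
  by_cases hy : y ∈ Set.Ico (Real.exp s) (Real.exp t)
  · have hy0 : 0 < y := (Real.exp_pos s).trans_le hy.1
    rw [Set.indicator_of_mem (by exact hy0), Set.indicator_of_mem hy, mul_comm]
    congr 1
    have : {x : ℝ | (x, y) ∈ Set.Ico x₁ x₂ ×ˢ Set.Ico (Real.exp s) (Real.exp t)} =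
      Set.Ico x₁ x₂ := by ext x; simp only [Set.mem_ofPred_eq, Set.mem_prod]; tauto
    rw [this, Real.volume_Ico]
  · rw [Set.indicator_of_notMem hy]
    have : {x : ℝ | (x, y) ∈ Set.Ico x₁ x₂ ×ˢ Set.Ico (Real.exp s) (Real.exp t)} = ∅ := by
      ext x; simp only [Set.mem_ofPred_eq, Set.mem_prod, Set.mem_empty_iff_false]; tauto
    by_cases hy0 : y ∈ Set.Ioi (0:ℝ)
    · rw [Set.indicator_of_mem hy0, this]; simp
    · rw [Set.indicator_of_notMem hy0]

lemma measurableSet_rect (x₁ x₂ s t : ℝ) : MeasurableSet (rect x₁ x₂ s t) :=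
  (UpperHalfPlane.continuous_re.measurable measurableSet_Ico).inter
    (UpperHalfPlane.continuous_im.measurable measurableSet_Ico)

lemma rect_subset_compact (x₁ x₂ s t : ℝ) : ∃ C : Set ℍ, IsCompact C ∧ rect x₁ x₂ s t ⊆ C := by
  let f : ℝ × ℝ → ℍ := fun p => ⟨⟨p.1, Real.exp p.2⟩, Real.exp_pos _⟩
  have hf : Continuous f := by
    rw [UpperHalfPlane.isEmbedding_coe.continuous_iff]
    have : (UpperHalfPlane.coe ∘ f) =
        fun p : ℝ × ℝ => (p.1 : ℂ) + (Real.exp p.2 : ℝ) * Complex.I := by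
      funext p; apply Complex.ext
      · simp [f, -Complex.ofReal_exp]
      · simp [f, -Complex.ofReal_exp]
    rw [this]; fun_prop
  refine ⟨f '' (Set.Icc x₁ x₂ ×ˢ Set.Icc s t), (isCompact_Icc.prod isCompact_Icc).image hf, ?_⟩
  rintro z ⟨⟨a, b⟩, ⟨c, d⟩⟩
  refine ⟨(z.re, Real.log z.im), ⟨⟨a, b.le⟩, ?_, ?_⟩, ?_⟩
  · exact (Real.le_log_iff_exp_le z.im_pos).2 c
  · exact (Real.log_le_iff_le_exp z.im_pos).2 d.le
  · refine UpperHalfPlane.ext_re_im rfl ?_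
    change Real.exp (Real.log z.im) = z.im
    rw [Real.exp_log z.im_pos]

/-! ### additive functions -/

lemma additive_linear {f : ℝ → ℝ} (h0 : ∀ x, 0 ≤ x → 0 ≤ f x)
    (ha : ∀ x y, 0 ≤ x → 0 ≤ y → f (x + y) = f x + f y) {x : ℝ} (hx : 0 ≤ x) :
    f x = x * f 1 := by
  have hz : f 0 = 0 := by have := ha 0 0 le_rfl le_rfl; simp at this; exact this
  have hmono : ∀ x y, 0 ≤ x → x ≤ y → f x ≤ f y := by
    intro x y hx hxy
    have := ha x (y - x) hx (by linarith)
    rw [add_sub_cancel] at this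
    have := h0 (y - x) (by linarith)
    linarith
  have hn : ∀ (n : ℕ) x, 0 ≤ x → f (n * x) = n * f x := by
    intro n x hx
    induction n with
    | zero => simp [hz]
    | succ k ih =>
      push_cast
      rw [add_mul, one_mul, ha _ _ (by positivity) hx, ih]; ring
  have f1 := h0 1 zero_le_one
  -- sandwich
  have key : ∀ n : ℕ, 0 < n → |f x - x * f 1| ≤ f 1 / n := by
    intro n hn0
    have hnpos : (0 : ℝ) < n := by exact_mod_cast hn0
    set m := ⌊(n : ℝ) * x⌋₊ with hm
    have l1 : (m : ℝ) ≤ n * x := Nat.floor_le (by positivity)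
    have l2 : (n : ℝ) * x < m + 1 := Nat.lt_floor_add_one _
    have u1 := hmono m (n * x) (by positivity) l1
    have u2 := hmono (n * x) (m + 1) (by positivity) l2.le
    rw [hn n x hx] at u1 u2
    have v1 := hn m 1 zero_le_one
    have v2 := hn (m + 1) 1 zero_le_one
    push_cast at v2
    rw [mul_one] at v1 v2
    rw [v1] at u1
    rw [v2] at u2
    rw [abs_le, le_div_iff₀ hnpos, neg_le_iff_add_nonneg, ← sub_nonneg]
    constructor
    · have : 0 ≤ n * (f x - x * f 1) + f 1 := by nlinarith
      have h3 : f x - x * f 1 + f 1 / n = (n * (f x - x * f 1) + f 1) / n := by field_simp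
      rw [sub_zero, h3]; positivity
    · nlinarith
  by_contra hne
  have hpos : 0 < |f x - x * f 1| := abs_pos.2 (sub_ne_zero.2 hne)
  obtain ⟨n, hn'⟩ := exists_nat_gt (f 1 / |f x - x * f 1|)
  have hn0 : 0 < n := by
    have : (0 : ℝ) < n := lt_of_le_of_lt (by positivity) hn'
    exact_mod_cast this
  have := key n hn0
  rw [div_lt_iff₀ hpos] at hn'
  rw [le_div_iff₀ (by exact_mod_cast hn0)] at this
  nlinarith

end partd

section parte

open MeasureTheory Metric Real UpperHalfPlane
open scoped UpperHalfPlane MatrixGroups ENNReal NNReal Topology Pointwise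

/-! ### Uniqueness of the area measure -/

noncomputable def nn (x : ℝ) : SL(2, ℝ) := ⟨!![1, x; 0, 1], by rw [Matrix.det_fin_two_of]; ring⟩
noncomputable def aa (s : ℝ) : SL(2, ℝ) :=
  ⟨!![Real.exp (s / 2), 0; 0, Real.exp (-(s / 2))], by
    rw [Matrix.det_fin_two_of, ← Real.exp_add]; simp⟩

lemma nn_smul (x : ℝ) (z : ℍ) : (nn x • z).re = z.re + x ∧ (nn x • z).im = z.im := by
  have h := smul_re (nn x) z
  have h2 := smul_im_den (nn x) z
  have e1 : nn x 0 0 = 1 := rfl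
  have e2 : nn x 0 1 = x := rfl
  have e3 : nn x 1 0 = 0 := rfl
  have e4 : nn x 1 1 = 1 := rfl
  have : den (nn x) z = 1 := by rw [den_eq, e3, e4]; ring
  rw [this, e1, e2, e3, e4] at h
  rw [this] at h2
  constructor <;> linarith

lemma aa_smul (s : ℝ) (z : ℍ) : (aa s • z).re = Real.exp s * z.re ∧
    (aa s • z).im = Real.exp s * z.im := by
  have h := smul_re (aa s) z
  have h2 := smul_im_den (aa s) z
  have e1 : aa s 0 0 = Real.exp (s / 2) := rfl
  have e2 : aa s 0 1 = 0 := rfl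
  have e3 : aa s 1 0 = 0 := rfl
  have e4 : aa s 1 1 = Real.exp (-(s / 2)) := rfl
  have hd : den (aa s) z = Real.exp (- s) := by
    rw [den_eq, e3, e4]; ring_nf; rw [← Real.exp_nat_mul]; push_cast; ring_nf
  have hh : Real.exp s * Real.exp (-s) = 1 := by rw [← Real.exp_add]; simp
  have h3 : Real.exp (s/2) * Real.exp (-(s/2)) = 1 := by rw [← Real.exp_add]; simp
  rw [hd, e1, e2, e3, e4] at h
  rw [hd] at h2
  constructor
  · have : (aa s • z).re * Real.exp (-s) * Real.exp s = z.re * Real.exp s := by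
      rw [h]; linear_combination (z.re * Real.exp s) * h3
    linear_combination this - (aa s • z).re * hh
  · linear_combination Real.exp s * h2 - (aa s • z).im * hh

lemma rect_split_x {x₁ x₂ x₃ : ℝ} (s t : ℝ) (h1 : x₁ ≤ x₂) (h2 : x₂ ≤ x₃) (ν : Measure ℍ) :
    ν (rect x₁ x₃ s t) = ν (rect x₁ x₂ s t) + ν (rect x₂ x₃ s t) := by
  rw [← measure_union _ (measurableSet_rect _ _ _ _)]
  · congr 1
    ext z
    simp only [rect, Set.mem_ofPred_eq, Set.mem_union, Set.mem_Ico]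
    constructor
    · rintro ⟨⟨a, b⟩, c⟩
      by_cases h : z.re < x₂
      · exact Or.inl ⟨⟨a, h⟩, c⟩
      · exact Or.inr ⟨⟨not_lt.1 h, b⟩, c⟩
    · rintro (⟨⟨a, b⟩, c⟩ | ⟨⟨a, b⟩, c⟩)
      · exact ⟨⟨a, b.trans_le h2⟩, c⟩
      · exact ⟨⟨h1.trans a, b⟩, c⟩
  · rw [Set.disjoint_left]
    rintro z ⟨⟨_, b⟩, _⟩ ⟨⟨a, _⟩, _⟩
    linarith

lemma rect_split_y (x₁ x₂ : ℝ) {s t u : ℝ} (h1 : s ≤ t) (h2 : t ≤ u) (ν : Measure ℍ) :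
    ν (rect x₁ x₂ s u) = ν (rect x₁ x₂ s t) + ν (rect x₁ x₂ t u) := by
  have h1 := Real.exp_le_exp.2 h1
  have h2 := Real.exp_le_exp.2 h2
  rw [← measure_union _ (measurableSet_rect _ _ _ _)]
  · congr 1
    ext z
    simp only [rect, Set.mem_ofPred_eq, Set.mem_union, Set.mem_Ico]
    constructor
    · rintro ⟨c, ⟨a, b⟩⟩
      by_cases h : z.im < Real.exp t
      · exact Or.inl ⟨c, ⟨a, h⟩⟩
      · exact Or.inr ⟨c, ⟨not_lt.1 h, b⟩⟩
    · rintro (⟨c, ⟨a, b⟩⟩ | ⟨c, ⟨a, b⟩⟩)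
      · exact ⟨c, ⟨a, b.trans_le h2⟩⟩
      · exact ⟨c, ⟨h1.trans a, b⟩⟩
  · rw [Set.disjoint_left]
    rintro z ⟨_, ⟨_, b⟩⟩ ⟨_, ⟨a, _⟩⟩
    linarith

/-- log chart -/
noncomputable def lch (z : ℍ) : ℝ × ℝ := (z.re, Real.log z.im)

lemma measurable_lch : Measurable lch := by
  apply Measurable.prodMk
  · exact UpperHalfPlane.continuous_re.measurable
  · exact Real.measurable_log.comp UpperHalfPlane.continuous_im.measurable

lemma lch_rect (x₁ x₂ s t : ℝ) : lch ⁻¹' (Set.Ico x₁ x₂ ×ˢ Set.Ico s t) = rect x₁ x₂ s t := by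
  ext z
  simp only [lch, Set.mem_preimage, Set.mem_prod, Set.mem_Ico, rect, Set.mem_ofPred_eq,
    Real.le_log_iff_exp_le z.im_pos, Real.log_lt_iff_lt_exp z.im_pos]

lemma lch_emb : MeasurableEmbedding lch := by
  let f : ℝ × ℝ → ℍ := fun p => ⟨⟨p.1, Real.exp p.2⟩, Real.exp_pos _⟩
  have hf : Continuous f := by
    rw [UpperHalfPlane.isEmbedding_coe.continuous_iff]
    have : (UpperHalfPlane.coe ∘ f) =
        fun p : ℝ × ℝ => (p.1 : ℂ) + (Real.exp p.2 : ℝ) * Complex.I := by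
      funext p; apply Complex.ext
      · simp [f, -Complex.ofReal_exp]
      · simp [f, -Complex.ofReal_exp]
    rw [this]; fun_prop
  exact MeasurableEquiv.measurableEmbedding
    { toFun := lch, invFun := f
      left_inv := fun z => by
        refine UpperHalfPlane.ext_re_im rfl ?_
        change Real.exp (Real.log z.im) = z.im
        rw [Real.exp_log z.im_pos]
      right_inv := fun p => by
        refine Prod.ext rfl ?_
        change Real.log (Real.exp p.2) = p.2
        rw [Real.log_exp]
      measurable_toFun := measurable_lch
      measurable_invFun := hf.measurable }

lemma countSpan_Ico : IsCountablySpanning {S : Set ℝ | ∃ l u, l < u ∧ Set.Ico l u = S} := by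
  refine ⟨fun n : ℕ => Set.Ico (-(n : ℝ) - 1) (n + 1), fun n => ⟨_, _, ?_, rfl⟩, ?_⟩
  · have : (0 : ℝ) ≤ n := n.cast_nonneg
    linarith
  · rw [Set.iUnion_eq_univ_iff]
    intro x
    obtain ⟨n, hn⟩ := exists_nat_gt |x|
    exact ⟨n, by linarith [neg_abs_le x], by linarith [le_abs_self x]⟩

lemma measure_ext_rect {μ ν : Measure ℍ} (hfin : ∀ C, IsCompact C → ν C < ∞)
    (h : ∀ x₁ x₂ s t, x₁ < x₂ → s < t → μ (rect x₁ x₂ s t) = ν (rect x₁ x₂ s t)) : μ = ν := by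
  have key : μ.map lch = ν.map lch := by
    refine (Measure.ext_of_generateFrom_of_iUnion
      (Set.image2 (· ×ˢ ·) {S : Set ℝ | ∃ l u, l < u ∧ Set.Ico l u = S}
        {S : Set ℝ | ∃ l u, l < u ∧ Set.Ico l u = S})
      (fun n : ℕ => Set.Ico (-(n : ℝ) - 1) (n + 1) ×ˢ Set.Ico (-(n : ℝ) - 1) (n + 1))
      ?_ ?_ ?_ ?_ ?_ ?_).symm
    · exact (generateFrom_eq_prod (borel_eq_generateFrom_Ico ℝ).symm
        (borel_eq_generateFrom_Ico ℝ).symm countSpan_Ico countSpan_Ico).symm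
    · exact (isPiSystem_Ico (f := id) (g := id)).prod (isPiSystem_Ico (f := id) (g := id))
    · rw [Set.iUnion_eq_univ_iff]
      rintro ⟨x, y⟩
      obtain ⟨n, hn⟩ := exists_nat_gt (max |x| |y|)
      have h1 := (le_max_left |x| |y|).trans_lt hn
      have h2 := (le_max_right |x| |y|).trans_lt hn
      refine ⟨n, ⟨?_, ?_⟩, ?_, ?_⟩ <;> simp only
      · linarith [neg_abs_le x]
      · linarith [le_abs_self x]
      · linarith [neg_abs_le y]
      · linarith [le_abs_self y]
    · intro n
      have : (0 : ℝ) ≤ n := n.cast_nonneg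
      exact ⟨_, ⟨_, _, by linarith, rfl⟩, _, ⟨_, _, by linarith, rfl⟩, rfl⟩
    · intro n
      rw [Measure.map_apply measurable_lch (measurableSet_Ico.prod measurableSet_Ico), lch_rect]
      obtain ⟨C, hC, hs⟩ := rect_subset_compact (-(n : ℝ) - 1) (n + 1) (-(n : ℝ) - 1) (n + 1)
      exact ((measure_mono hs).trans_lt (hfin C hC)).ne
    · rintro _ ⟨_, ⟨a, b, hab, rfl⟩, _, ⟨c, d, hcd, rfl⟩, rfl⟩
      simp only
      rw [Measure.map_apply measurable_lch (measurableSet_Ico.prod measurableSet_Ico), lch_rect,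
        Measure.map_apply measurable_lch (measurableSet_Ico.prod measurableSet_Ico), lch_rect,
        h a b c d hab hcd]
  have := congrArg (Measure.comap lch) key
  rwa [lch_emb.comap_map, lch_emb.comap_map] at this

lemma area_unique (ν : Measure ℍ) (hfin : ∀ C, IsCompact C → ν C < ∞)
    (hinv : ∀ g : SL(2, ℝ), g 1 0 = 0 → ∀ S, MeasurableSet S → ν ((fun z => g • z) ⁻¹' S) = ν S) :
    ∃ k : ℝ, 0 ≤ k ∧ ν = ENNReal.ofReal k • hypAreaMeasure := by
  have fin : ∀ x₁ x₂ s t, ν (rect x₁ x₂ s t) ≠ ∞ := fun x₁ x₂ s t => by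
    obtain ⟨C, hC, hs⟩ := rect_subset_compact x₁ x₂ s t
    exact ((measure_mono hs).trans_lt (hfin C hC)).ne
  have tr : ∀ a x₁ x₂ s t, ν (rect x₁ x₂ s t) = ν (rect (x₁ + a) (x₂ + a) s t) := by
    intro a x₁ x₂ s t
    rw [← hinv (nn a) rfl _ (measurableSet_rect (x₁ + a) (x₂ + a) s t)]
    congr 1; ext z
    simp only [rect, Set.mem_preimage, Set.mem_ofPred_eq, (nn_smul a z).1, (nn_smul a z).2,
      Set.mem_Ico, add_le_add_iff_right, add_lt_add_iff_right]
  have dil : ∀ a x₁ x₂ s t, ν (rect x₁ x₂ s t) =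
      ν (rect (Real.exp a * x₁) (Real.exp a * x₂) (a + s) (a + t)) := by
    intro a x₁ x₂ s t
    conv_rhs => rw [← hinv (aa a) rfl _ (measurableSet_rect _ _ _ _)]
    congr 1; ext z
    have := Real.exp_pos a
    simp only [rect, Set.mem_preimage, Set.mem_ofPred_eq, (aa_smul a z).1, (aa_smul a z).2,
      Set.mem_Ico, Real.exp_add, mul_le_mul_iff_right₀ this, mul_lt_mul_iff_right₀ this]
  let f : ℝ → ℝ → ℝ → ℝ := fun w s t => (ν (rect 0 w s t)).toReal
  have flin : ∀ w s t, 0 ≤ w → f w s t = w * f 1 s t := by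
    intro w s t hw
    refine additive_linear (f := fun w => f w s t) (fun x _ => ENNReal.toReal_nonneg) ?_ hw
    intro x y hx hy
    change (ν (rect 0 (x + y) s t)).toReal = (ν (rect 0 x s t)).toReal + (ν (rect 0 y s t)).toReal
    rw [rect_split_x s t hx (by linarith : x ≤ x + y), ENNReal.toReal_add (fin _ _ _ _) (fin _ _ _ _),
      tr x 0 y, zero_add, add_comm y x]
  have fdil : ∀ u v, f 1 u (u + v) = Real.exp (-u) * f 1 0 v := by
    intro u v
    rw [← flin _ _ _ (Real.exp_pos _).le]
    change (ν _).toReal = (ν _).toReal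
    rw [dil u 0 (Real.exp (-u)) 0 v, mul_zero, ← Real.exp_add, add_neg_cancel, Real.exp_zero, add_zero]
  have fadd : ∀ u v, 0 ≤ u → 0 ≤ v → f 1 0 (u + v) = f 1 0 u + Real.exp (-u) * f 1 0 v := by
    intro u v hu hv
    rw [← fdil]
    change (ν _).toReal = (ν _).toReal + (ν _).toReal
    rw [rect_split_y 0 1 hu (by linarith : u ≤ u + v), ENNReal.toReal_add (fin _ _ _ _) (fin _ _ _ _)]
  set k := f 1 0 1 / (1 - Real.exp (-1)) with hk
  have he : 0 < 1 - Real.exp (-1) := by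
    have : Real.exp (-1) < 1 := by
      simp
    linarith
  have fk : ∀ u, 0 ≤ u → f 1 0 u = k * (1 - Real.exp (-u)) := by
    intro u hu
    have h1 := fadd u 1 hu zero_le_one
    have h2 := fadd 1 u zero_le_one hu
    rw [add_comm 1 u] at h2
    have : f 1 0 u * (1 - Real.exp (-1)) = f 1 0 1 * (1 - Real.exp (-u)) := by linarith
    rw [hk]; field_simp; linarith
  have k0 : 0 ≤ k := div_nonneg ENNReal.toReal_nonneg he.le
  have rk : ∀ x₁ x₂ s t, x₁ < x₂ → s < t → ν (rect x₁ x₂ s t) =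
      ENNReal.ofReal k * hypAreaMeasure (rect x₁ x₂ s t) := by
    intro x₁ x₂ s t hx hs
    rw [area_rect _ _ hs.le, ← ENNReal.ofReal_mul (by linarith), ← ENNReal.ofReal_mul k0,
      ← ENNReal.ofReal_toReal (fin x₁ x₂ s t)]
    congr 1
    rw [tr (-x₁), add_neg_cancel, ← sub_eq_add_neg]
    change f (x₂ - x₁) s t = _
    rw [flin _ _ _ (by linarith)]
    have := fdil s (t - s)
    rw [add_sub_cancel] at this
    rw [this, fk _ (by linarith)]
    have e : Real.exp (-s) * Real.exp (-(t - s)) = Real.exp (-t) := by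
      rw [← Real.exp_add]; ring_nf
    linear_combination -(x₂ - x₁) * k * e
  refine ⟨k, k0, (measure_ext_rect hfin ?_).symm⟩
  intro x₁ x₂ s t hx hs
  rw [rk x₁ x₂ s t hx hs]; rfl

end parte

section partf

open MeasureTheory Metric Real UpperHalfPlane
open scoped UpperHalfPlane MatrixGroups ENNReal NNReal Topology Pointwise

/-! ### The constant kappa -/

lemma measurable_smul_pt (p : ℍ) : Measurable (fun g : SL(2, ℝ) => g • p) :=
  (continuous_id.smul continuous_const).measurable

lemma continuous_smul_const (g : SL(2, ℝ)) : Continuous (fun z : ℍ => g • z) :=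
  continuous_const_smul g

lemma isCompact_hit {K L : Set ℍ} (hK : IsCompact K) (hL : IsCompact L) :
    IsCompact {g : SL(2, ℝ) | (K ∩ g • L).Nonempty} := by
  have := ProperSMul.isCompact_setOfPred_inter_nonempty (G := SL(2, ℝ)) hL hK
  convert! this using 4
  rw [Set.inter_comm]

lemma hit_pt (K : Set ℍ) (p : ℍ) :
    {g : SL(2, ℝ) | (K ∩ g • ({p} : Set ℍ)).Nonempty} = (fun g : SL(2, ℝ) => g • p) ⁻¹' K := by
  ext g
  simp [Set.smul_set_singleton]

lemma exists_kap : ∃ k : ℝ, 0 < k ∧ hm.map (fun g : SL(2, ℝ) => g • UpperHalfPlane.I) =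
    ENNReal.ofReal k • hypAreaMeasure := by
  obtain ⟨k, k0, hk⟩ := area_unique (hm.map (fun g : SL(2, ℝ) => g • UpperHalfPlane.I)) (by
    intro C hC
    rw [Measure.map_apply (measurable_smul_pt _) hC.measurableSet, ← hit_pt]
    exact (isCompact_hit hC isCompact_singleton).measure_lt_top) (by
    intro g _ S hS
    have hS' : MeasurableSet ((fun z : ℍ => g • z) ⁻¹' S) := (continuous_smul_const g).measurable hS
    rw [Measure.map_apply (measurable_smul_pt _) hS, Measure.map_apply (measurable_smul_pt _) hS']
    conv_rhs => rw [← measure_preimage_mul hm g]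
    congr 1; ext x
    simp [mul_smul])
  refine ⟨k, lt_of_le_of_ne k0 ?_, hk⟩
  rintro rfl
  have h1 : hm.map (fun g : SL(2, ℝ) => g • UpperHalfPlane.I) Set.univ = 0 := by rw [hk]; simp
  rw [Measure.map_apply (measurable_smul_pt _) MeasurableSet.univ, Set.preimage_univ] at h1
  exact (Measure.measure_univ_ne_zero.2 (NeZero.ne hm)) h1

noncomputable def kap : ℝ := exists_kap.choose
lemma kap_pos : 0 < kap := exists_kap.choose_spec.1
lemma kap_spec : hm.map (fun g : SL(2, ℝ) => g • UpperHalfPlane.I) =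
    ENNReal.ofReal kap • hypAreaMeasure := exists_kap.choose_spec.2

lemma hm_smul_mem (p : ℍ) {S : Set ℍ} (hS : MeasurableSet S) :
    hm {g | g • p ∈ S} = ENNReal.ofReal kap * hypAreaMeasure S := by
  obtain ⟨a, ha⟩ := MulAction.exists_smul_eq SL(2, ℝ) I p
  have h := congrArg (fun m : Measure ℍ => m S) kap_spec
  simp only [Measure.smul_apply, smul_eq_mul] at h
  rw [Measure.map_apply (measurable_smul_pt _) hS] at h
  rw [← h]
  conv_rhs => rw [← measure_preimage_mul_right hm a]
  congr 1; ext x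
  simp [← ha, mul_smul]

lemma hm_inv_set (S : Set SL(2, ℝ)) : hm {g | g⁻¹ ∈ S} = hm S :=
  Measure.measure_preimage_inv hm S

lemma hm_mem_smul (p : ℍ) {S : Set ℍ} (hS : MeasurableSet S) :
    hm {g | p ∈ g • S} = ENNReal.ofReal kap * hypAreaMeasure S := by
  rw [← hm_smul_mem p hS, ← hm_inv_set]
  congr 1; ext g
  simp [Set.mem_smul_set_iff_inv_smul_mem]

lemma area_lt_top {C : Set ℍ} (hC : IsCompact C) : hypAreaMeasure C < ∞ := by
  have h : hm {g | g • I ∈ C} < ∞ := by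
    have := (isCompact_hit hC (isCompact_singleton (x := I))).measure_lt_top (μ := hm)
    rw [hit_pt] at this; exact this
  rw [hm_smul_mem I hC.measurableSet] at h
  by_contra hh
  rw [not_lt, top_le_iff] at hh
  rw [hh, ENNReal.mul_top (by simpa using kap_pos)] at h
  exact lt_irrefl _ h

lemma kap_ne : ENNReal.ofReal kap ≠ 0 := by simpa using kap_pos

lemma area_smul (g : SL(2, ℝ)) {S : Set ℍ} (hS : MeasurableSet S) :
    hypAreaMeasure (g • S) = hypAreaMeasure S := by
  have hS' : MeasurableSet (g • S) := hS.const_smul g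
  have h1 := hm_smul_mem I hS
  have h2 := hm_smul_mem I hS'
  have : hm {a | a • I ∈ g • S} = hm {a | a • I ∈ S} := by
    rw [← measure_preimage_mul hm g]
    congr 1; ext x
    simp [Set.mem_smul_set_iff_inv_smul_mem, mul_smul]
  rw [h1, h2] at this
  exact (ENNReal.mul_right_inj kap_ne ENNReal.ofReal_ne_top).1 this

/-! ### The hitting measure -/

noncomputable def TT (K L : Set ℍ) : ℝ≥0∞ := hm {g : SL(2, ℝ) | (K ∩ g • L).Nonempty}

lemma TT_lt_top {K L : Set ℍ} (hK : IsCompact K) (hL : IsCompact L) : TT K L < ∞ :=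
  (isCompact_hit hK hL).measure_lt_top

lemma TT_mono {K K' L L' : Set ℍ} (h : K ⊆ K') (h' : L ⊆ L') : TT K L ≤ TT K' L' :=
  measure_mono fun _ hg => hg.mono (Set.inter_subset_inter h (Set.smul_set_mono h'))

lemma TT_comm (K L : Set ℍ) : TT K L = TT L K := by
  unfold TT
  rw [← hm_inv_set]
  congr 1; ext g
  change (K ∩ g⁻¹ • L).Nonempty ↔ (L ∩ g • K).Nonempty
  constructor
  · rintro ⟨z, h1, h2⟩
    rw [Set.mem_smul_set_iff_inv_smul_mem, inv_inv] at h2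
    exact ⟨g • z, h2, Set.smul_mem_smul_set h1⟩
  · rintro ⟨z, h1, h2⟩
    rw [Set.mem_smul_set_iff_inv_smul_mem] at h2
    exact ⟨g⁻¹ • z, h2, Set.smul_mem_smul_set h1⟩

lemma TT_smul_left (h : SL(2, ℝ)) (K L : Set ℍ) : TT (h • K) L = TT K L := by
  unfold TT
  rw [← measure_preimage_mul hm h]
  congr 1; ext g
  change (h • K ∩ (h * g) • L).Nonempty ↔ (K ∩ g • L).Nonempty
  rw [mul_smul, ← Set.smul_set_inter, Set.smul_set_nonempty]

lemma TT_smul_right (h : SL(2, ℝ)) (K L : Set ℍ) : TT K (h • L) = TT K L := by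
  rw [TT_comm, TT_smul_left, TT_comm]

lemma TT_pt (p : ℍ) {L : Set ℍ} (hL : MeasurableSet L) :
    TT {p} L = ENNReal.ofReal kap * hypAreaMeasure L := by
  rw [TT_comm]; unfold TT
  rw [hit_pt, ← hm_smul_mem p hL]; rfl

/-! ### Null sets -/

lemma quad_finite {a b c : ℝ} (h : ¬(a = 0 ∧ b = 0 ∧ c = 0)) :
    {x : ℝ | a * x ^ 2 + b * x + c = 0}.Finite := by
  have hp : (Polynomial.C a * Polynomial.X ^ 2 + Polynomial.C b * Polynomial.X + Polynomial.C c : Polynomial ℝ) ≠ 0 := by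
    intro h0
    apply h
    refine ⟨?_, ?_, ?_⟩
    · have := congrArg (fun p => Polynomial.coeff p 2) h0
      simpa [Polynomial.coeff_X, Polynomial.coeff_C] using this
    · have := congrArg (fun p => Polynomial.coeff p 1) h0
      simpa [Polynomial.coeff_X, Polynomial.coeff_C, Polynomial.coeff_X_pow] using this
    · have := congrArg (fun p => Polynomial.coeff p 0) h0
      simpa [Polynomial.coeff_X, Polynomial.coeff_C, Polynomial.coeff_X_pow] using this
  refine (Polynomial.finite_setOfPred_isRoot hp).subset ?_
  intro x hx
  simpa [Polynomial.IsRoot] using hx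

lemma isClosed_line (l : ℝ × ℝ × ℝ) : IsClosed {z : ℍ | ev l z = 0} :=
  isClosed_eq (continuous_ev l) continuous_const

lemma isClosed_half (l : ℝ × ℝ × ℝ) : IsClosed {z : ℍ | 0 ≤ ev l z} :=
  isClosed_le continuous_const (continuous_ev l)

lemma area_line {l : ℝ × ℝ × ℝ} (hl : l ≠ 0) : hypAreaMeasure {z : ℍ | ev l z = 0} = 0 := by
  have hS : MeasurableSet {p : ℝ × ℝ | l.1 * (p.1 ^ 2 + p.2 ^ 2) + l.2.1 * p.1 + l.2.2 = 0} :=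
    (isClosed_eq (by fun_prop) continuous_const).measurableSet
  have := area_formula hS
  have e : {z : ℍ | ev l z = 0} = {z : ℍ | (z.re, z.im) ∈
      {p : ℝ × ℝ | l.1 * (p.1 ^ 2 + p.2 ^ 2) + l.2.1 * p.1 + l.2.2 = 0}} := rfl
  rw [e, this]
  have h0 : ∀ y : ℝ, volume {x : ℝ | (x, y) ∈
      {p : ℝ × ℝ | l.1 * (p.1 ^ 2 + p.2 ^ 2) + l.2.1 * p.1 + l.2.2 = 0}} = 0 := by
    intro y
    apply Set.Finite.measure_zero
    refine (quad_finite (a := l.1) (b := l.2.1) (c := l.1 * y ^ 2 + l.2.2) ?_).subset ?_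
    · rintro ⟨h1, h2, h3⟩
      apply hl
      rw [h1, zero_mul, zero_add] at h3
      exact Prod.ext h1 (Prod.ext h2 h3)
    · intro x hx
      change l.1 * (x ^ 2 + y ^ 2) + l.2.1 * x + l.2.2 = 0 at hx
      change l.1 * x ^ 2 + l.2.1 * x + (l.1 * y ^ 2 + l.2.2) = 0
      linarith
  simp only [h0, mul_zero, lintegral_zero]

lemma null_smul_line (p : ℍ) {l : ℝ × ℝ × ℝ} (hl : l ≠ 0) : hm {g | ev l (g • p) = 0} = 0 := by
  have := hm_smul_mem p (isClosed_line l).measurableSet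
  rw [area_line hl, mul_zero] at this
  exact this

lemma null_inv_smul_line (p : ℍ) {l : ℝ × ℝ × ℝ} (hl : l ≠ 0) :
    hm {g | ev l (g⁻¹ • p) = 0} = 0 := by
  rw [← null_smul_line p hl, ← hm_inv_set]; simp

lemma null_of_rot {Z : Set SL(2, ℝ)} (hZ : MeasurableSet Z)
    (h : ∀ g, volume {θ : ℝ | θ ∈ Set.Icc (0 : ℝ) 1 ∧ rot θ * g ∈ Z} = 0) : hm Z = 0 := by
  have hrot : Continuous rot := by
    have := (Matrix.SpecialLinearGroup.isClosedEmbedding_val (n := Fin 2) (R := ℝ)).isEmbedding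
    refine (this.continuous_iff (f := rot)).2 ?_
    refine continuous_pi fun i => continuous_pi fun j => ?_
    fin_cases i <;> fin_cases j
    · exact Real.continuous_cos
    · exact Real.continuous_sin
    · exact Real.continuous_sin.neg
    · exact Real.continuous_cos
  have hW : MeasurableSet {p : ℝ × SL(2, ℝ) | rot p.1 * p.2 ∈ Z} := by
    have : Continuous fun p : ℝ × SL(2, ℝ) => rot p.1 * p.2 :=
      (hrot.comp continuous_fst).mul continuous_snd
    exact this.measurable hZ
  have e1 := Measure.prod_apply (μ := volume.restrict (Set.Icc (0 : ℝ) 1)) (ν := hm) hW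
  have e2 := Measure.prod_apply_symm (μ := volume.restrict (Set.Icc (0 : ℝ) 1)) (ν := hm) hW
  rw [e1] at e2
  have e3 : ∀ θ : ℝ, hm (Prod.mk θ ⁻¹' {p : ℝ × SL(2, ℝ) | rot p.1 * p.2 ∈ Z}) = hm Z :=
    fun θ => measure_preimage_mul hm (rot θ) Z
  have e4 : ∀ g, (volume.restrict (Set.Icc (0 : ℝ) 1))
      ((fun θ => (θ, g)) ⁻¹' {p : ℝ × SL(2, ℝ) | rot p.1 * p.2 ∈ Z}) = 0 := by
    intro g
    rw [Measure.restrict_apply (measurable_prodMk_right hW), ← h g]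
    congr 1; ext θ
    exact and_comm
  simp only [e3, e4, lintegral_zero] at e2
  simpa using e2

lemma continuous_entry (i j : Fin 2) : Continuous fun g : SL(2, ℝ) => g i j :=
  (continuous_apply j).comp ((continuous_apply i).comp continuous_subtype_val)

lemma continuous_pull (l : ℝ × ℝ × ℝ) : Continuous fun g : SL(2, ℝ) => pull g l := by
  unfold pull
  have := continuous_entry
  fun_prop

lemma null_pull {l : ℝ × ℝ × ℝ} (hl : l ≠ 0) : hm {g | (pull g l).1 = 0} = 0 := by
  apply null_of_rot
  · exact (isClosed_eq (continuous_fst.comp (continuous_pull l)) continuous_const).measurableSet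
  intro g
  apply Set.Finite.measure_zero
  set a := g 0 0
  set c := g 1 0
  have hv : 0 < a ^ 2 + c ^ 2 := by
    have := det2 g
    by_contra h
    have h1 : a = 0 := by nlinarith [sq_nonneg a, sq_nonneg c]
    have h2 : c = 0 := by nlinarith [sq_nonneg a, sq_nonneg c]
    rw [show g 0 0 = a from rfl, show g 1 0 = c from rfl, h1, h2] at this
    linarith
  have hq := quad_finite (a := l.1 * c ^ 2 - l.2.1 * a * c + l.2.2 * a ^ 2)
    (b := 2 * l.1 * a * c + l.2.1 * (c ^ 2 - a ^ 2) - 2 * l.2.2 * a * c)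
    (c := l.1 * a ^ 2 + l.2.1 * a * c + l.2.2 * c ^ 2) (by
      rintro ⟨h1, h2, h3⟩
      apply hl
      have s1 : l.1 + l.2.2 = 0 := by
        have : (l.1 + l.2.2) * (a ^ 2 + c ^ 2) = 0 := by linarith
        rcases mul_eq_zero.1 this with h | h
        · exact h
        · linarith
      have s2 : l.2.2 = - l.1 := by linarith
      rw [s2] at h2 h3
      have t1 : l.1 * (a ^ 2 + c ^ 2) ^ 2 = 0 := by
        linear_combination (a ^ 2 - c ^ 2) * h3 + (a * c) * h2
      have t2 : l.2.1 * (a ^ 2 + c ^ 2) ^ 2 = 0 := by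
        linear_combination 4 * a * c * h3 - (a ^ 2 - c ^ 2) * h2
      have hv2 : (a ^ 2 + c ^ 2) ^ 2 ≠ 0 := by positivity
      have u1 := (mul_eq_zero.1 t1).resolve_right hv2
      have u2 := (mul_eq_zero.1 t2).resolve_right hv2
      exact Prod.ext u1 (Prod.ext u2 (by rw [s2, u1]; simp)))
  have hinj : Set.InjOn Real.tan {θ : ℝ | θ ∈ Set.Icc (0 : ℝ) 1 ∧ rot θ * g ∈ {g | (pull g l).1 = 0}} := by
    apply Real.injOn_tan.mono
    rintro θ ⟨⟨h0, h1⟩, _⟩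
    have := Real.pi_gt_three
    constructor <;> linarith
  refine Set.Finite.of_finite_image (hq.subset ?_) hinj
  rintro _ ⟨θ, ⟨⟨h0, h1⟩, hz⟩, rfl⟩
  have hc : 0 < Real.cos θ := Real.cos_pos_of_mem_Ioo ⟨by linarith [Real.pi_gt_three], by linarith [Real.pi_gt_three]⟩
  have m1 : (rot θ * g) 0 0 = Real.cos θ * a + Real.sin θ * c := by
    rw [Matrix.SpecialLinearGroup.coe_mul, Matrix.mul_apply, Fin.sum_univ_two, rot_00, rot_01]
  have m2 : (rot θ * g) 1 0 = - Real.sin θ * a + Real.cos θ * c := by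
    rw [Matrix.SpecialLinearGroup.coe_mul, Matrix.mul_apply, Fin.sum_univ_two, rot_10, rot_11]
  change (pull (rot θ * g) l).1 = 0 at hz
  unfold pull at hz
  simp only [m1, m2] at hz
  have hs : Real.sin θ = Real.tan θ * Real.cos θ := (Real.tan_mul_cos hc.ne').symm
  rw [hs] at hz
  change (l.1 * c ^ 2 - l.2.1 * a * c + l.2.2 * a ^ 2) * Real.tan θ ^ 2 + _ * Real.tan θ + _ = 0
  have : Real.cos θ ^ 2 * ((l.1 * c ^ 2 - l.2.1 * a * c + l.2.2 * a ^ 2) * Real.tan θ ^ 2 +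
    (2 * l.1 * a * c + l.2.1 * (c ^ 2 - a ^ 2) - 2 * l.2.2 * a * c) * Real.tan θ +
    (l.1 * a ^ 2 + l.2.1 * a * c + l.2.2 * c ^ 2)) = 0 := by linear_combination hz
  exact (mul_eq_zero.1 this).resolve_left (by positivity)

lemma null_pull_inv {l : ℝ × ℝ × ℝ} (hl : l ≠ 0) : hm {g | (pull g⁻¹ l).1 = 0} = 0 := by
  rw [← null_pull hl, ← hm_inv_set]; simp

end partf

section partg

open MeasureTheory Metric Real UpperHalfPlane
open scoped UpperHalfPlane MatrixGroups ENNReal NNReal Topology Pointwise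

/-! ### Segments -/

noncomputable def cc : ℝ := (TT (seg (yi 0) (yi 1)) (seg (yi 0) (yi 1))).toReal

lemma cc_nonneg : 0 ≤ cc := ENNReal.toReal_nonneg

lemma ev_axis (z : ℍ) : ev (0, 1, 0) z = z.re := by simp [ev]

lemma aa_yi (s t : ℝ) : aa s • yi t = yi (s + t) := by
  refine UpperHalfPlane.ext_re_im ?_ ?_
  · rw [(aa_smul s _).1, yi_re, yi_re, mul_zero]
  · rw [(aa_smul s _).2, yi_im, yi_im, Real.exp_add]

lemma seg_axis {s t : ℝ} (h : s ≤ t) {z : ℍ} (hz : z ∈ seg (yi s) (yi t)) : ev (0, 1, 0) z = 0 := by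
  rw [seg_yi h] at hz
  obtain ⟨r, _, rfl⟩ := hz
  rw [ev_axis, yi_re]

lemma axis_ne : ((0, 1, 0) : ℝ × ℝ × ℝ) ≠ 0 := by simp [Prod.ext_iff]

lemma area_seg (p q : ℍ) : hypAreaMeasure (seg p q) = 0 := by
  obtain ⟨h, hh⟩ := seg_std p q
  rw [← hh, area_smul h (isCompact_seg _ _).measurableSet]
  exact measure_mono_null (fun z hz => seg_axis dist_nonneg hz) (area_line axis_ne)

lemma null_pt_seg (z p q : ℍ) : hm {g : SL(2, ℝ) | z ∈ g • seg p q} = 0 := by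
  rw [hm_mem_smul z (isCompact_seg p q).measurableSet, area_seg, mul_zero]

lemma measurableSet_hit {K L : Set ℍ} (hK : IsCompact K) (hL : IsCompact L) :
    MeasurableSet {g : SL(2, ℝ) | (K ∩ g • L).Nonempty} := (isCompact_hit hK hL).measurableSet

lemma TT_seg_add {s s' t : ℝ} (hs : 0 ≤ s) (hs' : 0 ≤ s') (ht : 0 ≤ t) :
    TT (seg (yi 0) (yi (s + s'))) (seg (yi 0) (yi t)) =
    TT (seg (yi 0) (yi s)) (seg (yi 0) (yi t)) + TT (seg (yi 0) (yi s')) (seg (yi 0) (yi t)) := by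
  set L := seg (yi 0) (yi t) with hL
  rw [← TT_smul_left (aa s) (seg (yi 0) (yi s'))]
  rw [smul_seg, aa_yi, aa_yi, add_zero]
  have hun : seg (yi 0) (yi (s + s')) = seg (yi 0) (yi s) ∪ seg (yi s) (yi (s + s')) := by
    rw [seg_yi (by linarith), seg_yi hs, seg_yi (by linarith), ← Set.image_union,
      Set.Icc_union_Icc_eq_Icc hs (by linarith)]
  unfold TT
  have h1 : {g : SL(2, ℝ) | (seg (yi 0) (yi (s + s')) ∩ g • L).Nonempty} =
      {g | (seg (yi 0) (yi s) ∩ g • L).Nonempty} ∪ {g | (seg (yi s) (yi (s + s')) ∩ g • L).Nonempty} := by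
    ext g
    rw [hun]
    change Set.Nonempty ((_ ∪ _) ∩ _) ↔ _ ∨ _
    rw [Set.union_inter_distrib_right, Set.union_nonempty]; rfl
  rw [h1, measure_union₀ (measurableSet_hit (isCompact_seg _ _) (isCompact_seg _ _)).nullMeasurableSet]
  refine measure_mono_null ?_ (measure_union_null (null_pt_seg (yi s) (yi 0) (yi t))
    (null_smul_line (yi 0) axis_ne))
  rintro g ⟨⟨a, ha, ha'⟩, ⟨b, hb, hb'⟩⟩
  by_cases hab : a = b
  · left
    rw [seg_yi hs] at ha
    rw [seg_yi (by linarith)] at hb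
    obtain ⟨u, hu, rfl⟩ := ha
    obtain ⟨v, hv, e⟩ := hb
    have : u = v := by
      have := congrArg UpperHalfPlane.im (hab.trans e.symm)
      rw [yi_im, yi_im] at this
      exact Real.exp_injective this
    have : u = s := le_antisymm hu.2 (this ▸ hv.1)
    rw [this] at ha'
    exact ha'
  · right
    have ha := seg_axis hs ha
    have hb := seg_axis (by linarith) hb
    rw [hL] at ha'
    rw [seg_yi ht] at ha' hb'
    obtain ⟨_, ⟨u, _, rfl⟩, rfl⟩ := ha'
    obtain ⟨_, ⟨v, _, rfl⟩, rfl⟩ := hb'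
    simp only at ha hb hab
    have huv : u ≠ v := by rintro rfl; exact hab rfl
    rw [← ev_pull_zero] at ha hb
    change ev _ (g • yi 0) = 0
    rw [← ev_pull_zero]
    unfold ev at *
    rw [yi_re, yi_nq] at *
    have hne : Real.exp (2 * u) ≠ Real.exp (2 * v) := by
      intro h
      have := Real.exp_injective h
      exact huv (by linarith)
    have hA : (pull g (0, 1, 0)).1 = 0 := by
      have : (pull g (0, 1, 0)).1 * (Real.exp (2 * u) - Real.exp (2 * v)) = 0 := by linarith
      exact (mul_eq_zero.1 this).resolve_right (sub_ne_zero.2 hne)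
    rw [hA] at ha ⊢
    linarith

lemma TT_seg_std {s t : ℝ} (hs : 0 ≤ s) (ht : 0 ≤ t) :
    (TT (seg (yi 0) (yi s)) (seg (yi 0) (yi t))).toReal = cc * s * t := by
  have fin : ∀ a b : ℝ, TT (seg (yi 0) (yi a)) (seg (yi 0) (yi b)) ≠ ∞ :=
    fun a b => (TT_lt_top (isCompact_seg _ _) (isCompact_seg _ _)).ne
  have lin : ∀ s t : ℝ, 0 ≤ s → 0 ≤ t → (TT (seg (yi 0) (yi s)) (seg (yi 0) (yi t))).toReal =
      s * (TT (seg (yi 0) (yi 1)) (seg (yi 0) (yi t))).toReal := by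
    intro s t hs ht
    refine additive_linear (f := fun s => (TT (seg (yi 0) (yi s)) (seg (yi 0) (yi t))).toReal)
      (fun _ _ => ENNReal.toReal_nonneg) ?_ hs
    intro x y hx hy
    rw [TT_seg_add hx hy ht, ENNReal.toReal_add (fin _ _) (fin _ _)]
  rw [lin s t hs ht, TT_comm, lin t 1 ht zero_le_one]
  unfold cc; ring

lemma TT_seg (p q p' q' : ℍ) : (TT (seg p q) (seg p' q')).toReal = cc * dist p q * dist p' q' := by
  obtain ⟨h, hh⟩ := seg_std p q
  obtain ⟨h', hh'⟩ := seg_std p' q'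
  rw [← hh, ← hh', TT_smul_left, TT_smul_right, TT_seg_std dist_nonneg dist_nonneg]

end partg

section parth

open MeasureTheory Metric Real UpperHalfPlane
open scoped UpperHalfPlane MatrixGroups ENNReal NNReal Topology Pointwise

/-! ### Polygons -/

abbrev Lin := ℝ × ℝ × ℝ

def poly {ι : Type} (l : ι → Lin) : Set ℍ := {z | ∀ i, 0 ≤ ev (l i) z}

def indep (a b : Lin) : Prop :=
  ¬ (a.1 * b.2.1 = a.2.1 * b.1 ∧ a.1 * b.2.2 = a.2.2 * b.1 ∧ a.2.1 * b.2.2 = a.2.2 * b.2.1)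

def edge {ι : Type} (l : ι → Lin) (i : ι) : Set ℍ := poly l ∩ {z | ev (l i) z = 0}

def verts {ι : Type} (l : ι → Lin) : Set ℍ :=
  {z | z ∈ poly l ∧ ∃ i j, i ≠ j ∧ ev (l i) z = 0 ∧ ev (l j) z = 0}

noncomputable def per {ι : Type} [Fintype ι] (l : ι → Lin) : ℝ := ∑ i, Metric.diam (edge l i)

structure GoodPoly {ι : Type} (l : ι → Lin) : Prop where
  ne0 : ∀ i, l i ≠ 0
  ind : ∀ i j, i ≠ j → indep (l i) (l j)
  cpt : IsCompact (poly l)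
  ne : (poly l).Nonempty

lemma cconv_poly {ι : Type} (l : ι → Lin) : CConv (poly l) := by
  intro p hp q hq t h0 h1 i
  rw [cmb_ev _ _ _ h0 h1]
  have := hp i
  have := hq i
  have : 0 ≤ 1 - t := by linarith
  positivity

lemma isClosed_poly {ι : Type} (l : ι → Lin) : IsClosed (poly l) := by
  have : poly l = ⋂ i, {z | 0 ≤ ev (l i) z} := by ext z; simp [poly]
  rw [this]
  exact isClosed_iInter fun i => isClosed_half _

lemma CConv.inter {K L : Set ℍ} (hK : CConv K) (hL : CConv L) : CConv (K ∩ L) :=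
  fun p hp q hq t h0 h1 => ⟨hK p hp.1 q hq.1 t h0 h1, hL p hp.2 q hq.2 t h0 h1⟩

lemma cconv_line (l : Lin) : CConv {z | ev l z = 0} := by
  intro p hp q hq t h0 h1
  change ev l _ = 0
  rw [cmb_ev _ _ _ h0 h1, show ev l p = 0 from hp, show ev l q = 0 from hq]; ring

lemma cconv_half (l : Lin) : CConv {z | 0 ≤ ev l z} := by
  intro p hp q hq t h0 h1
  change 0 ≤ ev l _
  rw [cmb_ev _ _ _ h0 h1]
  have : 0 ≤ 1 - t := by linarith
  have : 0 ≤ ev l p := hp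
  have : 0 ≤ ev l q := hq
  positivity

lemma cconv_edge {ι : Type} (l : ι → Lin) (i : ι) : CConv (edge l i) :=
  (cconv_poly l).inter (cconv_line _)

lemma isCompact_edge {ι : Type} {l : ι → Lin} (h : IsCompact (poly l)) (i : ι) :
    IsCompact (edge l i) := h.inter_right (isClosed_line _)

lemma pull_mul (g h : SL(2, ℝ)) (l : Lin) : pull (g * h) l = pull h (pull g l) := by
  unfold pull
  simp only [Matrix.SpecialLinearGroup.coe_mul, Matrix.mul_apply, Fin.sum_univ_two]
  refine Prod.ext ?_ (Prod.ext ?_ ?_) <;> simp only <;> ring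

lemma pull_one (l : Lin) : pull 1 l = l := by
  unfold pull
  refine Prod.ext ?_ (Prod.ext ?_ ?_) <;> simp

lemma pull_neg (g : SL(2, ℝ)) (l : Lin) : pull g (-l) = - pull g l := by
  unfold pull
  refine Prod.ext ?_ (Prod.ext ?_ ?_) <;> simp <;> ring

lemma pull_smul (g : SL(2, ℝ)) (r : ℝ) (l : Lin) : pull g (r • l) = r • pull g l := by
  unfold pull
  refine Prod.ext ?_ (Prod.ext ?_ ?_) <;> simp <;> ring

lemma pull_inj (g : SL(2, ℝ)) {a b : Lin} (h : pull g a = pull g b) : a = b := by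
  have := congrArg (pull g⁻¹) h
  rwa [← pull_mul, ← pull_mul, mul_inv_cancel, pull_one, pull_one] at this

lemma pull_ne0 (g : SL(2, ℝ)) {a : Lin} (h : a ≠ 0) : pull g a ≠ 0 := by
  intro h0
  apply h
  apply pull_inj g
  rw [h0]; unfold pull; simp; rfl

/-- dependence as proportionality -/
lemma not_indep_iff {a b : Lin} (ha : a ≠ 0) : ¬ indep a b ↔ ∃ r : ℝ, b = r • a := by
  unfold indep
  rw [not_not]
  constructor
  · rintro ⟨h1, h2, h3⟩
    by_cases c1 : a.1 = 0
    · by_cases c2 : a.2.1 = 0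
      · by_cases c3 : a.2.2 = 0
        · exact absurd (Prod.ext c1 (Prod.ext c2 c3)) ha
        · refine ⟨b.2.2 / a.2.2, Prod.ext ?_ (Prod.ext ?_ ?_)⟩ <;> simp <;> field_simp <;> linarith
      · refine ⟨b.2.1 / a.2.1, Prod.ext ?_ (Prod.ext ?_ ?_)⟩ <;> simp <;> field_simp <;> linarith
    · refine ⟨b.1 / a.1, Prod.ext ?_ (Prod.ext ?_ ?_)⟩ <;> simp <;> field_simp <;> linarith
  · rintro ⟨r, rfl⟩
    refine ⟨?_, ?_, ?_⟩ <;> simp <;> ring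

lemma indep_pull (g : SL(2, ℝ)) {a b : Lin} (ha : a ≠ 0) (h : indep a b) :
    indep (pull g a) (pull g b) := by
  by_contra hn
  rw [not_indep_iff (pull_ne0 g ha)] at hn
  obtain ⟨r, hr⟩ := hn
  rw [← pull_smul] at hr
  exact (not_indep_iff ha).2 ⟨r, pull_inj g hr⟩ h

/-- two independent lines meet at most once -/
lemma line_inter_unique {a b : Lin} (h : indep a b) {z w : ℍ} (h1 : ev a z = 0) (h2 : ev b z = 0)
    (h3 : ev a w = 0) (h4 : ev b w = 0) : z = w := by
  by_contra hne
  apply h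
  unfold ev at *
  have d1 : a.1 * (nq z - nq w) + a.2.1 * (z.re - w.re) = 0 := by linarith
  have d2 : b.1 * (nq z - nq w) + b.2.1 * (z.re - w.re) = 0 := by linarith
  have hD : a.1 * b.2.1 = a.2.1 * b.1 := by
    by_cases hx : z.re - w.re = 0
    · have hn : nq z - nq w ≠ 0 := by
        intro h0
        exact hne (ch_ext (by linarith) (by linarith))
      rw [hx] at d1 d2
      simp [hn] at d1 d2
      rw [d1, d2]; ring
    · have : (a.1 * b.2.1 - a.2.1 * b.1) * (z.re - w.re) = 0 := by
        linear_combination a.1 * d2 - b.1 * d1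
      linarith [(mul_eq_zero.1 this).resolve_right hx]
  have e1 : a.2.2 = - (a.1 * nq z + a.2.1 * z.re) := by linarith
  have e2 : b.2.2 = - (b.1 * nq z + b.2.1 * z.re) := by linarith
  refine ⟨hD, ?_, ?_⟩
  · rw [e1, e2]; linear_combination (-z.re) * hD
  · rw [e1, e2]; linear_combination (nq z) * hD

lemma verts_finite {ι : Type} [Finite ι] {l : ι → Lin} (h : GoodPoly l) : (verts l).Finite := by
  have : verts l ⊆ ⋃ p : {p : ι × ι // p.1 ≠ p.2}, {z | ev (l p.1.1) z = 0 ∧ ev (l p.1.2) z = 0} := by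
    rintro z ⟨_, i, j, hij, h1, h2⟩
    exact Set.mem_iUnion.2 ⟨⟨(i, j), hij⟩, h1, h2⟩
  refine (Set.finite_iUnion fun p => ?_).subset this
  apply Set.Subsingleton.finite
  rintro z ⟨h1, h2⟩ w ⟨h3, h4⟩
  exact line_inter_unique (h.ind _ _ p.2) h1 h2 h3 h4

/-! ### moving polygons -/

lemma smul_poly {ι : Type} (g : SL(2, ℝ)) (l : ι → Lin) :
    g • poly l = poly (fun i => pull g⁻¹ (l i)) := by
  ext z
  rw [Set.mem_smul_set_iff_inv_smul_mem]
  change (∀ i, 0 ≤ ev (l i) (g⁻¹ • z)) ↔ (∀ i, 0 ≤ ev (pull g⁻¹ (l i)) z)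
  simp only [ev_pull_nonneg]

lemma smul_edge {ι : Type} (g : SL(2, ℝ)) (l : ι → Lin) (i : ι) :
    g • edge l i = edge (fun i => pull g⁻¹ (l i)) i := by
  unfold edge
  rw [← smul_poly, Set.smul_set_inter]
  congr 1
  ext z
  rw [Set.mem_smul_set_iff_inv_smul_mem]
  change ev (l i) (g⁻¹ • z) = 0 ↔ ev (pull g⁻¹ (l i)) z = 0
  rw [ev_pull_zero]

lemma GoodPoly.smul {ι : Type} {l : ι → Lin} (h : GoodPoly l) (g : SL(2, ℝ)) :
    GoodPoly (fun i => pull g⁻¹ (l i)) where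
  ne0 i := pull_ne0 _ (h.ne0 i)
  ind i j hij := indep_pull _ (h.ne0 i) (h.ind i j hij)
  cpt := by rw [← smul_poly]; exact h.cpt.smul g
  ne := by rw [← smul_poly]; exact h.ne.smul_set

lemma per_smul {ι : Type} [Fintype ι] (g : SL(2, ℝ)) (l : ι → Lin) :
    per (fun i => pull g⁻¹ (l i)) = per l := by
  unfold per
  refine Finset.sum_congr rfl fun i _ => ?_
  rw [← smul_edge, diam_smul]

/-! ### edges are segments -/

lemma seg_self (p : ℍ) : seg p p = {p} := by
  ext z
  constructor
  · rintro ⟨t, _, rfl⟩; rw [cmb_self]; rfl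
  · rintro rfl; exact left_mem_seg _ _

lemma diam_seg (p q : ℍ) : Metric.diam (seg p q) = dist p q := by
  obtain ⟨h, hh⟩ := seg_std p q
  have hi : Isometry yi := Isometry.of_dist_eq (fun s t => by rw [dist_yi, Real.dist_eq])
  rw [← hh, diam_smul, seg_yi dist_nonneg, hi.diam_image, Real.diam_Icc dist_nonneg, sub_zero]

lemma seg_subset {K : Set ℍ} (hK : CConv K) {p q : ℍ} (hp : p ∈ K) (hq : q ∈ K) : seg p q ⊆ K := by
  rintro _ ⟨t, ⟨h0, h1⟩, rfl⟩
  exact hK p hp q hq t h0 h1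

/-- a line through two standard points -/
lemma pull_axis {l : Lin} {h : SL(2, ℝ)} {u v : ℝ} (huv : u ≠ v) (h1 : ev l (h • yi u) = 0)
    (h2 : ev l (h • yi v) = 0) : (pull h l).1 = 0 ∧ (pull h l).2.2 = 0 := by
  rw [← ev_pull_zero] at h1 h2
  unfold ev at *
  rw [yi_re, yi_nq] at *
  have hne : Real.exp (2 * u) ≠ Real.exp (2 * v) := by
    intro h
    have := Real.exp_injective h
    exact huv (by linarith)
  have hA : (pull h l).1 = 0 := by
    have : (pull h l).1 * (Real.exp (2 * u) - Real.exp (2 * v)) = 0 := by linarith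
    exact (mul_eq_zero.1 this).resolve_right (sub_ne_zero.2 hne)
  rw [hA] at h1
  exact ⟨hA, by linarith⟩

lemma eq_seg_of_line {E : Set ℍ} (hc : IsCompact E) (hE : CConv E) (hne : E.Nonempty) {l : Lin}
    (hl : l ≠ 0) (hsub : ∀ z ∈ E, ev l z = 0) : ∃ p q, E = seg p q := by
  by_cases hs : E.Subsingleton
  · obtain ⟨p, hp⟩ := hne
    refine ⟨p, p, ?_⟩
    rw [seg_self]
    exact hs.eq_singleton_of_mem hp
  · rw [Set.not_subsingleton_iff] at hs
    obtain ⟨p, hp, q, hq, hpq⟩ := hs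
    obtain ⟨h, h1, h2⟩ := exists_std p q
    have hd : dist p q ≠ 0 := dist_ne_zero.2 hpq
    obtain ⟨eA, eC⟩ := pull_axis (l := l) (h := h) hd.symm (by rw [h1]; exact hsub p hp)
      (by rw [h2]; exact hsub q hq)
    have eB : (pull h l).2.1 ≠ 0 := by
      intro h0
      exact pull_ne0 h hl (Prod.ext eA (Prod.ext h0 eC))
    have hax : ∀ z ∈ h⁻¹ • E, z = yi (Real.log z.im) := by
      intro z hz
      rw [Set.mem_smul_set_iff_inv_smul_mem, inv_inv] at hz
      have := hsub _ hz
      rw [← ev_pull_zero] at this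
      unfold ev at this
      rw [eA, eC] at this
      have hre : z.re = 0 := by
        simpa [eB] using this
      refine UpperHalfPlane.ext_re_im hre ?_
      rw [yi_im, Real.exp_log z.im_pos]
    have hc' : IsCompact (h⁻¹ • E) := hc.smul _
    have hne' : (h⁻¹ • E).Nonempty := hne.smul_set
    obtain ⟨a, ha, hamin⟩ := hc'.exists_isMinOn hne' UpperHalfPlane.continuous_im.continuousOn
    obtain ⟨b, hb, hbmax⟩ := hc'.exists_isMaxOn hne' UpperHalfPlane.continuous_im.continuousOn
    have key : h⁻¹ • E = seg a b := by
      refine Set.Subset.antisymm ?_ (seg_subset (hE.smul _) ha hb)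
      intro z hz
      have h3 : a.im ≤ z.im := hamin hz
      have h4 : z.im ≤ b.im := hbmax hz
      rw [hax a ha, hax b hb, hax z hz, seg_yi]
      · exact ⟨_, ⟨Real.log_le_log a.im_pos h3, Real.log_le_log z.im_pos h4⟩, rfl⟩
      · exact Real.log_le_log a.im_pos (h3.trans h4)
    refine ⟨h • a, h • b, ?_⟩
    rw [← smul_seg, ← key, smul_inv_smul]

lemma TT_edge {ι ι' : Type} {l : ι → Lin} {l' : ι' → Lin} (h : GoodPoly l) (h' : GoodPoly l')
    (i : ι) (j : ι') : (TT (edge l i) (edge l' j)).toReal =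
      cc * Metric.diam (edge l i) * Metric.diam (edge l' j) := by
  rcases (edge l i).eq_empty_or_nonempty with he | he
  · rw [he]; simp [TT]
  rcases (edge l' j).eq_empty_or_nonempty with he' | he'
  · rw [he']; simp [TT]
  obtain ⟨p, q, e⟩ := eq_seg_of_line (isCompact_edge h.cpt i) (cconv_edge l i) he (h.ne0 i)
    (fun z hz => hz.2)
  obtain ⟨p', q', e'⟩ := eq_seg_of_line (isCompact_edge h'.cpt j) (cconv_edge l' j) he' (h'.ne0 j)
    (fun z hz => hz.2)
  rw [e, e', TT_seg, diam_seg, diam_seg]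

end parth

section parti

open MeasureTheory Metric Real UpperHalfPlane
open scoped UpperHalfPlane MatrixGroups ENNReal NNReal Topology Pointwise

/-! ### Linear programming in the chart -/

def IsMinP (σ : ℝ) (S : Set ℍ) (p : ℍ) : Prop := p ∈ S ∧ ∀ w ∈ S, σ * p.re ≤ σ * w.re

lemma perturb (p : ℍ) (du dv : ℝ) (P : ℝ → Prop) (hP : ∀ᶠ t in 𝓝[>] (0:ℝ), P t) :
    ∃ ε : ℝ, 0 < ε ∧ P ε ∧ ∃ w : ℍ, w.re = p.re + ε * du ∧ nq w = nq p + ε * dv := by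
  have h1 : ∀ᶠ t in 𝓝[>] (0:ℝ), (p.re + t * du) ^ 2 < nq p + t * dv := by
    have hc : Continuous fun t : ℝ => nq p + t * dv - (p.re + t * du) ^ 2 := by fun_prop
    have h0 : 0 < nq p + 0 * dv - (p.re + 0 * du) ^ 2 := by
      have := nq_gt p; simp; exact this
    have := (hc.tendsto 0).eventually (lt_mem_nhds h0)
    filter_upwards [this.filter_mono nhdsWithin_le_nhds] with t ht
    linarith
  obtain ⟨ε, hε, h2, h3⟩ := ((eventually_mem_nhdsWithin (a := (0:ℝ)) (s := Set.Ioi 0)).and (h1.and hP)).exists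
  exact ⟨ε, hε, h3, mkz _ _ h2, mkz_re _ _ _, mkz_nq _ _ _⟩

lemma min_active {ι : Type} [Finite ι] {m : ι → Lin} {σ : ℝ} {p : ℍ} (hp : IsMinP σ (poly m) p)
    {w : ℍ} (hw : ∀ k, ev (m k) p = 0 → 0 ≤ ev (m k) w) : σ * p.re ≤ σ * w.re := by
  have h1 : ∀ᶠ t in 𝓝[>] (0:ℝ), ∀ k, 0 ≤ (1 - t) * ev (m k) p + t * ev (m k) w := by
    rw [Filter.eventually_all]
    intro k
    rcases (hp.1 k).eq_or_lt with h | h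
    · filter_upwards [eventually_mem_nhdsWithin] with t ht
      rw [← h]
      have := hw k h.symm
      have : (0:ℝ) < t := ht
      rw [mul_zero, zero_add]
      positivity
    · have hc : Continuous fun t : ℝ => (1 - t) * ev (m k) p + t * ev (m k) w := by fun_prop
      have h0 : 0 < (1 - 0) * ev (m k) p + 0 * ev (m k) w := by simpa using h
      have := (hc.tendsto 0).eventually (lt_mem_nhds h0)
      filter_upwards [this.filter_mono nhdsWithin_le_nhds] with t ht
      exact ht.le
  have h2 : ∀ᶠ t in 𝓝[>] (0:ℝ), t < 1 :=
    Filter.Eventually.filter_mono nhdsWithin_le_nhds (gt_mem_nhds zero_lt_one)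
  obtain ⟨t, ht, h3, h4⟩ := ((eventually_mem_nhdsWithin (a := (0:ℝ)) (s := Set.Ioi 0)).and (h1.and h2)).exists
  have ht : 0 < t := ht
  have hmem : cmb p w t ∈ poly m := fun k => by
    rw [cmb_ev _ _ _ ht.le h4.le]; exact h3 k
  have := hp.2 _ hmem
  rw [cmb_re _ _ ht.le h4.le] at this
  have : 0 ≤ t * (σ * w.re - σ * p.re) := by linarith
  have := nonneg_of_mul_nonneg_right this ht
  linarith

lemma min_exists_active {ι : Type} [Finite ι] {m : ι → Lin} (hm1 : ∀ k, (m k).1 ≠ 0) {σ : ℝ} (hσ : σ ≠ 0)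
    {p : ℍ} (hp : IsMinP σ (poly m) p) : ∃ k k', k ≠ k' ∧ ev (m k) p = 0 ∧ ev (m k') p = 0 := by
  by_contra hcon
  push Not at hcon
  have key : ∃ dv : ℝ, ∀ k, ev (m k) p = 0 → (m k).1 * dv + (m k).2.1 * (-σ) = 0 := by
    by_cases hk : ∃ k, ev (m k) p = 0
    · obtain ⟨k, hk⟩ := hk
      refine ⟨σ * (m k).2.1 / (m k).1, fun k' hk' => ?_⟩
      have : k' = k := by
        by_contra hne
        exact hcon k' k hne hk' hk
      subst this
      have := hm1 k'
      field_simp; ring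
    · push Not at hk
      exact ⟨0, fun k h => absurd h (hk k)⟩
  obtain ⟨dv, hdv⟩ := key
  obtain ⟨ε, hε, -, w, w1, w2⟩ := perturb p (-σ) dv (fun _ => True) (by simp)
  have := min_active hp (w := w) (fun k hk => by
    have h1 := hdv k hk
    unfold ev at *
    rw [w1, w2]
    have : (m k).1 * (nq p + ε * dv) + (m k).2.1 * (p.re + ε * -σ) + (m k).2.2 =
      ((m k).1 * nq p + (m k).2.1 * p.re + (m k).2.2) + ε * ((m k).1 * dv + (m k).2.1 * (-σ)) := by ring
    rw [this, hk, h1]; simp)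
  rw [w1] at this
  have h2 : 0 < σ ^ 2 := by positivity
  nlinarith

lemma min_unique {ι : Type} [Finite ι] {m : ι → Lin} (hm1 : ∀ k, (m k).1 ≠ 0) {σ : ℝ} (hσ : σ ≠ 0)
    {p q : ℍ} (hp : IsMinP σ (poly m) p) (hq : IsMinP σ (poly m) q) : p = q := by
  by_contra hne
  have hre : p.re = q.re := by
    have h1 := hp.2 _ hq.1
    have h2 := hq.2 _ hp.1
    exact mul_left_cancel₀ hσ (le_antisymm h1 h2)
  have hnq : nq p ≠ nq q := fun h => hne (ch_ext hre h)
  have h0 : (0:ℝ) ≤ 1/2 := by norm_num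
  have h1 : (1/2:ℝ) ≤ 1 := by norm_num
  have hz : IsMinP σ (poly m) (cmb p q (1/2)) := by
    refine ⟨cconv_poly m p hp.1 q hq.1 _ h0 h1, fun w hw => ?_⟩
    rw [cmb_re _ _ h0 h1, ← hre]
    have := hp.2 w hw
    linarith
  obtain ⟨k, -, -, hk, -⟩ := min_exists_active hm1 hσ hz
  rw [cmb_ev _ _ _ h0 h1] at hk
  have a := hp.1 k
  have b := hq.1 k
  have ha : ev (m k) p = 0 := by linarith
  have hb : ev (m k) q = 0 := by linarith
  unfold ev at ha hb
  rw [hre] at ha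
  have : (m k).1 * (nq p - nq q) = 0 := by linarith
  exact (mul_ne_zero (hm1 k) (sub_ne_zero.2 hnq)) this

noncomputable def dd (a b : Lin) : ℝ := a.1 * b.2.1 - b.1 * a.2.1

lemma dd_ne {a b : Lin} (h : indep a b) {p : ℍ} (h1 : ev a p = 0) (h2 : ev b p = 0) : dd a b ≠ 0 := by
  intro hD
  apply h
  unfold dd at hD
  unfold ev at *
  have e1 : a.2.2 = - (a.1 * nq p + a.2.1 * p.re) := by linarith
  have e2 : b.2.2 = - (b.1 * nq p + b.2.1 * p.re) := by linarith
  refine ⟨by linarith, ?_, ?_⟩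
  · rw [e1, e2]; linear_combination (-p.re) * hD
  · rw [e1, e2]; linear_combination (nq p) * hD

def WC (σ : ℝ) (a b : Lin) : Prop := a.1 * b.1 < 0 ∧ 0 < σ * a.1 * dd a b

lemma wedge_min {σ : ℝ} (hσ : σ ≠ 0) {a b : Lin} (ha : a.1 ≠ 0) (hb : b.1 ≠ 0) {p : ℍ} (h1 : ev a p = 0) (h2 : ev b p = 0)
    (hD : dd a b ≠ 0) :
    (∀ w, 0 ≤ ev a w → 0 ≤ ev b w → σ * p.re ≤ σ * w.re) ↔ WC σ a b := by
  have hd2 : 0 < dd a b ^ 2 := by positivity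
  constructor
  · intro h
    have key : ∀ du dv : ℝ, 0 ≤ a.1 * dv + a.2.1 * du → 0 ≤ b.1 * dv + b.2.1 * du → 0 ≤ σ * du := by
      intro du dv h3 h4
      obtain ⟨ε, hε, -, w, w1, w2⟩ := perturb p du dv (fun _ => True) (by simp)
      have := h w (by
        have : ev a w = ev a p + ε * (a.1 * dv + a.2.1 * du) := by
          unfold ev; rw [w1, w2]; ring
        rw [this, h1]; positivity) (by
        have : ev b w = ev b p + ε * (b.1 * dv + b.2.1 * du) := by
          unfold ev; rw [w1, w2]; ring
        rw [this, h2]; positivity)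
      rw [w1] at this
      have : 0 ≤ ε * (σ * du) := by linarith
      exact nonneg_of_mul_nonneg_right this hε
    have k1 := key (-b.1 * dd a b) (b.2.1 * dd a b) (by
      have : a.1 * (b.2.1 * dd a b) + a.2.1 * (-b.1 * dd a b) = dd a b ^ 2 := by unfold dd; ring
      rw [this]; positivity) (by
      have : b.1 * (b.2.1 * dd a b) + b.2.1 * (-b.1 * dd a b) = 0 := by ring
      rw [this])
    have k2 := key (a.1 * dd a b) (-a.2.1 * dd a b) (by
      have : a.1 * (-a.2.1 * dd a b) + a.2.1 * (a.1 * dd a b) = 0 := by ring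
      rw [this]) (by
      have : b.1 * (-a.2.1 * dd a b) + b.2.1 * (a.1 * dd a b) = dd a b ^ 2 := by unfold dd; ring
      rw [this]; positivity)
    have k2' : 0 < σ * a.1 * dd a b := by
      rcases k2.eq_or_lt with h | h
      · exact absurd h.symm (by positivity)
      · linarith
    have k1' : 0 < σ * (-b.1) * dd a b := by
      rcases k1.eq_or_lt with h | h
      · exact absurd h.symm (by simp [hσ, hb, hD])
      · linarith
    refine ⟨?_, k2'⟩
    have := mul_pos k1' k2'
    have h5 : 0 < (σ * dd a b) ^ 2 := by positivity
    have : 0 < (σ * dd a b) ^ 2 * (-(a.1 * b.1)) := by linarith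
    have := pos_of_mul_pos_right this h5.le
    linarith
  · rintro ⟨h3, h4⟩ w h5 h6
    have e : (w.re - p.re) * dd a b = a.1 * ev b w - b.1 * ev a w := by
      have : a.1 * ev b w - b.1 * ev a w = a.1 * (ev b w - ev b p) - b.1 * (ev a w - ev a p) := by
        rw [h1, h2]; ring
      rw [this]; unfold ev dd; ring
    have h7 : 0 < - (σ * b.1 * dd a b) := by
      have : 0 < (σ * a.1 * dd a b) * (-(a.1 * b.1)) := mul_pos h4 (by linarith)
      have h8 : 0 < a.1 ^ 2 := by positivity
      have : 0 < a.1 ^ 2 * (- (σ * b.1 * dd a b)) := by linarith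
      exact pos_of_mul_pos_right this h8.le
    have h9 : 0 ≤ dd a b ^ 2 * (σ * w.re - σ * p.re) := by
      have : dd a b ^ 2 * (σ * w.re - σ * p.re) =
        (σ * a.1 * dd a b) * ev b w + (-(σ * b.1 * dd a b)) * ev a w := by
        linear_combination (σ * dd a b) * e
      rw [this]; positivity
    have := nonneg_of_mul_nonneg_right h9 hd2
    linarith

end parti

section partj

open MeasureTheory Metric Real UpperHalfPlane
open scoped UpperHalfPlane MatrixGroups ENNReal NNReal Topology Pointwise

/-! ### generic positions -/

structure Gen {ι ι' : Type} (l : ι → Lin) (l' : ι' → Lin) (g : SL(2, ℝ)) : Prop where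
  g1 : ∀ v ∈ verts l, ∀ j, ev (pull g⁻¹ (l' j)) v ≠ 0
  g2 : ∀ v ∈ verts l', ∀ i, ev (l i) (g • v) ≠ 0
  g3 : ∀ i j, (edge l' j).Nonempty → indep (l i) (pull g⁻¹ (l' j))
  g4 : ∀ j, (pull g⁻¹ (l' j)).1 ≠ 0

lemma gen_ae {ι ι' : Type} [Finite ι] [Finite ι'] {l : ι → Lin} {l' : ι' → Lin} (h : GoodPoly l)
    (h' : GoodPoly l') : ∀ᵐ g ∂hm, Gen l l' g := by
  have a1 : ∀ᵐ g ∂hm, ∀ v ∈ verts l, ∀ j, ev (pull g⁻¹ (l' j)) v ≠ 0 := by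
    rw [MeasureTheory.ae_ball_iff (verts_finite h).countable]
    intro v hv
    rw [MeasureTheory.ae_all_iff]
    intro j
    rw [ae_iff]
    simp only [not_not, ev_pull_zero, ne_eq]
    exact null_inv_smul_line v (h'.ne0 j)
  have a2 : ∀ᵐ g ∂hm, ∀ v ∈ verts l', ∀ i, ev (l i) (g • v) ≠ 0 := by
    rw [MeasureTheory.ae_ball_iff (verts_finite h').countable]
    intro v hv
    rw [MeasureTheory.ae_all_iff]
    intro j
    rw [ae_iff]
    simp only [not_not, ne_eq]
    exact null_smul_line v (h.ne0 j)
  have a3 : ∀ᵐ g ∂hm, ∀ i j, (edge l' j).Nonempty → indep (l i) (pull g⁻¹ (l' j)) := by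
    rw [MeasureTheory.ae_all_iff]
    intro i
    rw [MeasureTheory.ae_all_iff]
    intro j
    by_cases he : (edge l' j).Nonempty
    · obtain ⟨q, hq⟩ := he
      have : ∀ᵐ g ∂hm, ev (l i) (g • q) ≠ 0 := by
        rw [ae_iff]
        simp only [not_not, ne_eq]
        exact null_smul_line q (h.ne0 i)
      filter_upwards [this] with g hg _
      by_contra hn
      rw [not_indep_iff (h.ne0 i)] at hn
      obtain ⟨r, hr⟩ := hn
      have e1 : ev (pull g⁻¹ (l' j)) (g • q) = 0 := by
        rw [ev_pull_zero, inv_smul_smul]; exact hq.2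
      have hr0 : r ≠ 0 := by
        rintro rfl
        rw [zero_smul] at hr
        exact pull_ne0 _ (h'.ne0 j) hr
      rw [hr] at e1
      have e2 : ev (r • l i) (g • q) = r * ev (l i) (g • q) := by
        unfold ev; simp; ring
      rw [e2] at e1
      exact (mul_ne_zero hr0 hg) e1
    · exact Filter.Eventually.of_forall fun g hh => absurd hh he
  have a4 : ∀ᵐ g ∂hm, ∀ j, (pull g⁻¹ (l' j)).1 ≠ 0 := by
    rw [MeasureTheory.ae_all_iff]
    intro j
    rw [ae_iff]
    simp only [not_not, ne_eq]
    exact null_pull_inv (h'.ne0 j)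
  filter_upwards [a1, a2, a3, a4] with g b1 b2 b3 b4
  exact ⟨b1, b2, b3, b4⟩

/-! ### extreme vertices of the moving body -/

def EV (σ : ℝ) (L : Set ℍ) (v : ℍ) : Set SL(2, ℝ) := {g | ∀ w ∈ L, σ * (g • v).re ≤ σ * (g • w).re}

lemma isClosed_EV (σ : ℝ) (L : Set ℍ) (v : ℍ) : IsClosed (EV σ L v) := by
  have : EV σ L v = ⋂ w ∈ L, {g | σ * (g • v).re ≤ σ * (g • w).re} := by
    ext g; simp [EV]
  rw [this]
  refine isClosed_biInter fun w _ => isClosed_le ?_ ?_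
  · exact continuous_const.mul (UpperHalfPlane.continuous_re.comp (continuous_id.smul continuous_const))
  · exact continuous_const.mul (UpperHalfPlane.continuous_re.comp (continuous_id.smul continuous_const))

lemma borel_re (b : SL(2, ℝ)) (hb : b 1 0 = 0) : ∃ s t : ℝ, 0 < s ∧ ∀ z : ℍ, (b • z).re = s * z.re + t := by
  have hd := det2 b
  rw [hb] at hd
  have h11 : b 1 1 ≠ 0 := by rintro h; rw [h] at hd; simp at hd
  have e : b 0 0 = (b 1 1)⁻¹ := by field_simp; linarith
  refine ⟨((b 1 1) ^ 2)⁻¹, b 0 1 / b 1 1, by positivity, fun z => ?_⟩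
  have h := smul_re b z
  have hden : den b z = b 1 1 ^ 2 := by unfold den; rw [hb]; ring
  rw [hden, hb, e] at h
  field_simp at h ⊢
  exact mul_left_cancel₀ h11 (by linear_combination h)

lemma EV_borel {σ : ℝ} {L : Set ℍ} {v : ℍ} (b : SL(2, ℝ)) (hb : b 1 0 = 0) (g : SL(2, ℝ)) :
    b * g ∈ EV σ L v ↔ g ∈ EV σ L v := by
  obtain ⟨s, t, hs, h⟩ := borel_re b hb
  unfold EV
  simp only [Set.mem_ofPred_eq, mul_smul, h]
  refine forall₂_congr fun w _ => ?_
  rw [← sub_nonneg, ← sub_nonneg (a := σ * (g • w).re)]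
  rw [show σ * (s * (g • w).re + t) - σ * (s * (g • v).re + t) =
    s * (σ * (g • w).re - σ * (g • v).re) by ring]
  exact mul_nonneg_iff_of_pos_left hs

lemma EV_area (σ : ℝ) (L : Set ℍ) (v : ℍ) : ∃ k : ℝ, 0 ≤ k ∧ ∀ S : Set ℍ, MeasurableSet S →
    hm {g | g ∈ EV σ L v ∧ g • v ∈ S} = ENNReal.ofReal k * hypAreaMeasure S := by
  have hE := (isClosed_EV σ L v).measurableSet
  have hν : ∀ S : Set ℍ, MeasurableSet S → ((hm.restrict (EV σ L v)).map (fun g : SL(2, ℝ) => g • v)) S =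
      hm {g | g ∈ EV σ L v ∧ g • v ∈ S} := by
    intro S hS
    rw [Measure.map_apply (measurable_smul_pt v) hS,
      Measure.restrict_apply (measurable_smul_pt v hS)]
    congr 1; ext g
    simp only [Set.mem_inter_iff, Set.mem_preimage, Set.mem_ofPred_eq]
    tauto
  obtain ⟨k, hk0, hk⟩ := area_unique ((hm.restrict (EV σ L v)).map (fun g : SL(2, ℝ) => g • v)) (by
    intro C hC
    rw [hν C hC.measurableSet]
    refine lt_of_le_of_lt (measure_mono (t := {g | g • v ∈ C}) fun g hg => hg.2) ?_
    rw [hm_smul_mem v hC.measurableSet]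
    exact ENNReal.mul_lt_top ENNReal.ofReal_lt_top (area_lt_top hC)) (by
    intro b hb S hS
    rw [hν S hS, hν _ ((continuous_smul_const b).measurable hS)]
    conv_rhs => rw [← measure_preimage_mul hm b]
    congr 1; ext g
    simp only [Set.mem_preimage, Set.mem_ofPred_eq, EV_borel b hb, mul_smul])
  refine ⟨k, hk0, fun S hS => ?_⟩
  rw [← hν S hS, hk]; rfl

/-! ### The decomposition -/

def CC {ι ι' : Type} (σ : ℝ) (l : ι → Lin) (l' : ι' → Lin) (i : ι) (j : ι') : Set SL(2, ℝ) :=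
  {g | (edge l i ∩ g • edge l' j).Nonempty ∧ WC σ (l i) (pull g⁻¹ (l' j))}

/-- the type of a minimizer -/
def FP {ι ι' : Type} (σ : ℝ) (l : ι → Lin) (l' : ι' → Lin) (pK : ℍ) (g : SL(2, ℝ)) (p : ℍ) :
    Unit ⊕ (verts l') ⊕ (ι × ι') → Prop
  | Sum.inl _ => p = pK ∧ p ∈ g • poly l'
  | Sum.inr (Sum.inl v) => p = g • v.1 ∧ g ∈ EV σ (poly l') v.1 ∧ p ∈ poly l
  | Sum.inr (Sum.inr x) => p ∈ edge l x.1 ∩ g • edge l' x.2 ∧ WC σ (l x.1) (pull g⁻¹ (l' x.2))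

lemma mem_smul_edge {ι : Type} {l : ι → Lin} {g : SL(2, ℝ)} {j : ι} {p : ℍ} :
    p ∈ g • edge l j ↔ p ∈ g • poly l ∧ ev (pull g⁻¹ (l j)) p = 0 := by
  rw [smul_edge, smul_poly]; rfl

lemma poly_elim {ι ι' : Type} (l : ι → Lin) (l' : ι' → Lin) (g : SL(2, ℝ)) :
    poly l ∩ g • poly l' = poly (Sum.elim l (fun j => pull g⁻¹ (l' j))) := by
  rw [smul_poly]
  ext z
  simp [poly]

lemma mem_verts_smul {ι : Type} {l : ι → Lin} {g : SL(2, ℝ)} {p : ℍ} (hp : p ∈ g • poly l) {j j' : ι}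
    (hj : j ≠ j') (h1 : ev (pull g⁻¹ (l j)) p = 0) (h2 : ev (pull g⁻¹ (l j')) p = 0) :
    g⁻¹ • p ∈ verts l := by
  rw [ev_pull_zero] at h1 h2
  exact ⟨Set.mem_smul_set_iff_inv_smul_mem.1 hp, j, j', hj, h1, h2⟩


lemma FP_of_min {ι ι' : Type} [Finite ι] [Finite ι'] {l : ι → Lin} {l' : ι' → Lin} (h : GoodPoly l)
  (h' : GoodPoly l') (hv : ∀ i, (l i).1 ≠ 0) {σ : ℝ} (hσ : σ ≠ 0) {pK : ℍ}
  (hpK : IsMinP σ (poly l) pK) {g : SL(2, ℝ)} (hg : Gen l l' g)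
    {p : ℍ} (hp : IsMinP σ (poly l ∩ g • poly l') p) : ∃ x, FP σ l l' pK g p x := by
  have hp' := hp
  rw [poly_elim] at hp'
  have hm1 : ∀ k, (Sum.elim l (fun j => pull g⁻¹ (l' j)) k).1 ≠ 0 := by
    rintro (i | j)
    · exact hv i
    · exact hg.g4 j
  have caseK : p ∈ verts l → ∃ x, FP σ l l' pK g p x := by
    intro hpv
    have hmin : IsMinP σ (poly l) p := ⟨hp.1.1, fun w hw => min_active hp' (by
      rintro (i | j) hk
      · exact hw i
      · exact absurd hk (hg.g1 p hpv j))⟩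
    exact ⟨Sum.inl (), min_unique hv hσ hmin hpK, hp.1.2⟩
  have caseL : g⁻¹ • p ∈ verts l' → ∃ x, FP σ l l' pK g p x := by
    intro hpv
    have e : g • (g⁻¹ • p) = p := smul_inv_smul g p
    refine ⟨Sum.inr (Sum.inl ⟨g⁻¹ • p, hpv⟩), e.symm, ?_, hp.1.1⟩
    intro w hw
    change σ * (g • (g⁻¹ • p)).re ≤ _
    rw [e]
    refine min_active hp' ?_
    rintro (i | j) hk
    · exact absurd hk (by have := hg.g2 _ hpv i; rwa [e] at this)
    · change 0 ≤ ev (pull g⁻¹ (l' j)) (g • w)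
      rw [ev_pull_nonneg, inv_smul_smul]; exact hw j
  obtain ⟨k, k', hkk, hk, hk'⟩ := min_exists_active hm1 hσ hp'
  have caseM : ∀ i j, ev (l i) p = 0 → ev (pull g⁻¹ (l' j)) p = 0 → ∃ x, FP σ l l' pK g p x := by
    intro i j hi hj
    have hei : p ∈ edge l i := ⟨hp.1.1, hi⟩
    have hej : p ∈ g • edge l' j := mem_smul_edge.2 ⟨hp.1.2, hj⟩
    have hne : (edge l' j).Nonempty := ⟨_, Set.mem_smul_set_iff_inv_smul_mem.1 hej⟩
    refine ⟨Sum.inr (Sum.inr (i, j)), ⟨hei, hej⟩, ?_⟩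
    rw [← wedge_min hσ (hv i) (hg.g4 j) hi hj (dd_ne (hg.g3 i j hne) hi hj)]
    intro w h1 h2
    refine min_active hp' ?_
    rintro (i' | j') hk
    · by_cases e : i' = i
      · subst e; exact h1
      · exact absurd hj (hg.g1 p ⟨hp.1.1, i', i, e, hk, hi⟩ j)
    · by_cases e : j' = j
      · subst e; exact h2
      · have := hg.g2 _ (mem_verts_smul hp.1.2 e hk hj) i
        rw [smul_inv_smul] at this
        exact absurd hi this
  rcases k with i | j <;> rcases k' with i' | j'
  · exact caseK ⟨hp.1.1, i, i', fun e => hkk (by rw [e]), hk, hk'⟩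
  · exact caseM i j' hk hk'
  · exact caseM i' j hk' hk
  · exact caseL (mem_verts_smul hp.1.2 (fun e => hkk (by rw [e])) hk hk')

lemma pK_verts {ι ι' : Type} [Finite ι] [Finite ι'] {l : ι → Lin} {l' : ι' → Lin} (h : GoodPoly l)
  (h' : GoodPoly l') (hv : ∀ i, (l i).1 ≠ 0) {σ : ℝ} (hσ : σ ≠ 0) {pK : ℍ}
  (hpK : IsMinP σ (poly l) pK) {g : SL(2, ℝ)} (hg : Gen l l' g)
    : pK ∈ verts l := by
  obtain ⟨i, i', hii, h1, h2⟩ := min_exists_active hv hσ hpK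
  exact ⟨hpK.1, i, i', hii, h1, h2⟩

lemma min_of_FP {ι ι' : Type} [Finite ι] [Finite ι'] {l : ι → Lin} {l' : ι' → Lin} (h : GoodPoly l)
  (h' : GoodPoly l') (hv : ∀ i, (l i).1 ≠ 0) {σ : ℝ} (hσ : σ ≠ 0) {pK : ℍ}
  (hpK : IsMinP σ (poly l) pK) {g : SL(2, ℝ)} (hg : Gen l l' g)
    {p : ℍ} {x} (hx : FP σ l l' pK g p x) : IsMinP σ (poly l ∩ g • poly l') p := by
  rcases x with u | v | ⟨i, j⟩
  · obtain ⟨rfl, h2⟩ := hx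
    exact ⟨⟨hpK.1, h2⟩, fun w hw => hpK.2 w hw.1⟩
  · obtain ⟨rfl, h2, h3⟩ := hx
    refine ⟨⟨h3, Set.smul_mem_smul_set v.2.1⟩, ?_⟩
    rintro w ⟨-, w', hw', rfl⟩
    exact h2 w' hw'
  · obtain ⟨⟨h1, h2⟩, h3⟩ := hx
    have hj := mem_smul_edge.1 h2
    have hne : (edge l' j).Nonempty := ⟨_, Set.mem_smul_set_iff_inv_smul_mem.1 h2⟩
    refine ⟨⟨h1.1, hj.1⟩, fun w hw => ?_⟩
    refine (wedge_min hσ (hv i) (hg.g4 j) h1.2 hj.2 (dd_ne (hg.g3 i j hne) h1.2 hj.2)).2 h3 w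
      (hw.1 i) ?_
    have := hw.2
    rw [smul_poly] at this
    exact this j

lemma FP_unique {ι ι' : Type} [Finite ι] [Finite ι'] {l : ι → Lin} {l' : ι' → Lin} (h : GoodPoly l)
  (h' : GoodPoly l') (hv : ∀ i, (l i).1 ≠ 0) {σ : ℝ} (hσ : σ ≠ 0) {pK : ℍ}
  (hpK : IsMinP σ (poly l) pK) {g : SL(2, ℝ)} (hg : Gen l l' g)
    {p : ℍ} {x y} (hx : FP σ l l' pK g p x) (hy : FP σ l l' pK g p y) : x = y := by
  have hK := pK_verts h h' hv hσ hpK hg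
  have uv : ∀ v : verts l', ∀ u, FP σ l l' pK g p (Sum.inl u) → FP σ l l' pK g p (Sum.inr (Sum.inl v)) → False := by
    rintro v u ⟨rfl, -⟩ ⟨h2, -⟩
    obtain ⟨-, i, -, -, hi, -⟩ := hK
    exact hg.g2 v v.2 i (by rw [← h2]; exact hi)
  have ue : ∀ u, ∀ e, FP σ l l' pK g p (Sum.inl u) → FP σ l l' pK g p (Sum.inr (Sum.inr e)) → False := by
    rintro u ⟨i, j⟩ ⟨rfl, -⟩ ⟨⟨-, h2⟩, -⟩
    exact hg.g1 _ hK j (mem_smul_edge.1 h2).2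
  have ve : ∀ v : verts l', ∀ e, FP σ l l' pK g p (Sum.inr (Sum.inl v)) → FP σ l l' pK g p (Sum.inr (Sum.inr e)) → False := by
    rintro v ⟨i, j⟩ ⟨rfl, -⟩ ⟨⟨h1, -⟩, -⟩
    exact hg.g2 v v.2 i h1.2
  rcases x with u | v | ⟨i, j⟩ <;> rcases y with u' | v' | ⟨i', j'⟩
  · rfl
  · exact (uv _ _ hx hy).elim
  · exact (ue _ _ hx hy).elim
  · exact (uv _ _ hy hx).elim
  · have : g • v.1 = g • v'.1 := hx.1.symm.trans hy.1
    have := smul_left_cancel g this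
    rw [Subtype.ext this]
  · exact (ve _ _ hx hy).elim
  · exact (ue _ _ hy hx).elim
  · exact (ve _ _ hy hx).elim
  · obtain ⟨⟨h1, h2⟩, -⟩ := hx
    obtain ⟨⟨h3, h4⟩, -⟩ := hy
    rw [mem_smul_edge] at h2 h4
    have ei : i = i' := by
      by_contra e
      exact hg.g1 p ⟨h1.1, i, i', e, h1.2, h3.2⟩ j h2.2
    have ej : j = j' := by
      by_contra e
      have := hg.g2 _ (mem_verts_smul h2.1 e h2.2 h4.2) i
      rw [smul_inv_smul] at this
      exact this h1.2
    rw [ei, ej]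

end partj

section partk

open MeasureTheory Metric Real UpperHalfPlane
open scoped UpperHalfPlane MatrixGroups ENNReal NNReal Topology Pointwise

/-- the set of positions of a given type -/
def FF {ι ι' : Type} (σ : ℝ) (l : ι → Lin) (l' : ι' → Lin) (pK : ℍ)
    (x : Unit ⊕ (verts l') ⊕ (ι × ι')) : Set SL(2, ℝ) := {g | ∃ p, FP σ l l' pK g p x}

lemma FF_inl {ι ι' : Type} (σ : ℝ) (l : ι → Lin) (l' : ι' → Lin) (pK : ℍ) :
    FF σ l l' pK (Sum.inl ()) = {g | pK ∈ g • poly l'} := by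
  ext g
  constructor
  · rintro ⟨p, rfl, h⟩; exact h
  · intro h; exact ⟨pK, rfl, h⟩

lemma FF_v {ι ι' : Type} (σ : ℝ) (l : ι → Lin) (l' : ι' → Lin) (pK : ℍ) (v : verts l') :
    FF σ l l' pK (Sum.inr (Sum.inl v)) = {g | g ∈ EV σ (poly l') v.1 ∧ g • v.1 ∈ poly l} := by
  ext g
  constructor
  · rintro ⟨p, rfl, h⟩; exact h
  · intro h; exact ⟨_, rfl, h⟩

lemma FF_e {ι ι' : Type} (σ : ℝ) (l : ι → Lin) (l' : ι' → Lin) (pK : ℍ) (i : ι) (j : ι') :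
    FF σ l l' pK (Sum.inr (Sum.inr (i, j))) = CC σ l l' i j := by
  ext g
  constructor
  · rintro ⟨p, h1, h⟩; exact ⟨⟨p, h1⟩, h⟩
  · rintro ⟨⟨p, h1⟩, h⟩; exact ⟨p, h1, h⟩

lemma measurableSet_WC (σ : ℝ) (a b : Lin) : MeasurableSet {g : SL(2, ℝ) | WC σ a (pull g⁻¹ b)} := by
  have hc : Continuous fun g : SL(2, ℝ) => pull g⁻¹ b := (continuous_pull b).comp continuous_inv
  unfold WC dd
  refine MeasurableSet.inter (s₁ := {g : SL(2, ℝ) | a.1 * (pull g⁻¹ b).1 < 0})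
    (s₂ := {g : SL(2, ℝ) | 0 < σ * a.1 * (a.1 * (pull g⁻¹ b).2.1 - (pull g⁻¹ b).1 * a.2.1)}) ?_ ?_
  · exact (isOpen_lt (by fun_prop) continuous_const).measurableSet
  · exact (isOpen_lt continuous_const (by fun_prop)).measurableSet

lemma measurableSet_CC {ι ι' : Type} (σ : ℝ) {l : ι → Lin} {l' : ι' → Lin} (h : GoodPoly l)
    (h' : GoodPoly l') (i : ι) (j : ι') : MeasurableSet (CC σ l l' i j) :=
  (measurableSet_hit (isCompact_edge h.cpt i) (isCompact_edge h'.cpt j)).inter (measurableSet_WC _ _ _)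

lemma measurableSet_poly {ι : Type} (l : ι → Lin) : MeasurableSet (poly l) := (isClosed_poly l).measurableSet

lemma kin_half {ι ι' : Type} [Fintype ι] [Fintype ι'] {l : ι → Lin} {l' : ι' → Lin} (h : GoodPoly l)
    (h' : GoodPoly l') (hv : ∀ i, (l i).1 ≠ 0) {σ : ℝ} (hσ : σ ≠ 0) (b : ℍ → ℝ)
    (hb0 : ∀ v, 0 ≤ b v)
    (hb : ∀ v, ∀ S : Set ℍ, MeasurableSet S → hm {g | g ∈ EV σ (poly l') v ∧ g • v ∈ S} =
      ENNReal.ofReal (b v) * hypAreaMeasure S) :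
    (TT (poly l) (poly l')).toReal = kap * hypArea (poly l') +
      (∑ v ∈ (verts_finite h').toFinset, b v) * hypArea (poly l) +
      ∑ i, ∑ j, (hm (CC σ l l' i j)).toReal := by
  obtain ⟨pK, hpK1, hpK2⟩ := h.cpt.exists_isMinOn h.ne
    (f := fun z : ℍ => σ * z.re) (continuous_const.mul UpperHalfPlane.continuous_re).continuousOn
  have hpK : IsMinP σ (poly l) pK := ⟨hpK1, fun w hw => hpK2 hw⟩
  have hgen := gen_ae h h'
  have := (verts_finite h').to_subtype
  have := Fintype.ofFinite (verts l')
  have hmeas : ∀ x, MeasurableSet (FF σ l l' pK x) := by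
    rintro (⟨⟩ | v | ⟨i, j⟩)
    · rw [FF_inl]
      have := (measurable_smul_pt pK).comp measurable_inv (measurableSet_poly l')
      convert! this using 1
      ext g
      simp [Set.mem_smul_set_iff_inv_smul_mem]
    · rw [FF_v]
      exact (isClosed_EV _ _ _).measurableSet.inter (measurable_smul_pt v.1 (measurableSet_poly l))
    · rw [FF_e]; exact measurableSet_CC σ h h' i j
  have h1 : TT (poly l) (poly l') = hm (⋃ x, FF σ l l' pK x) := by
    unfold TT
    refine measure_congr ?_
    filter_upwards [hgen] with g hg
    refine propext ?_
    change Set.Nonempty (poly l ∩ g • poly l') ↔ g ∈ ⋃ x, FF σ l l' pK x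
    rw [Set.mem_iUnion]
    constructor
    · intro hne
      obtain ⟨p, hp1, hp2⟩ := (h.cpt.inter (h'.cpt.smul g)).exists_isMinOn hne
        (f := fun z : ℍ => σ * z.re) (continuous_const.mul UpperHalfPlane.continuous_re).continuousOn
      obtain ⟨x, hx⟩ := FP_of_min h h' hv hσ hpK hg ⟨hp1, fun w hw => hp2 hw⟩
      exact ⟨x, p, hx⟩
    · rintro ⟨x, p, hx⟩
      exact ⟨p, (min_of_FP h h' hv hσ hpK hg hx).1⟩
  have h2 : hm (⋃ x, FF σ l l' pK x) = ∑ x, hm (FF σ l l' pK x) := by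
    rw [measure_iUnion₀, tsum_fintype]
    · intro x y hxy
      have : ∀ᵐ g ∂hm, ¬ g ∈ FF σ l l' pK x ∩ FF σ l l' pK y := by
        filter_upwards [hgen] with g hg
        rintro ⟨⟨p, hp⟩, ⟨q, hq⟩⟩
        have e := min_unique (m := Sum.elim l (fun j => pull g⁻¹ (l' j))) (by
          rintro (i | j)
          · exact hv i
          · exact hg.g4 j) hσ (by rw [← poly_elim]; exact min_of_FP h h' hv hσ hpK hg hp)
          (by rw [← poly_elim]; exact min_of_FP h h' hv hσ hpK hg hq)
        subst e
        exact hxy (FP_unique h h' hv hσ hpK hg hp hq)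
      rw [ae_iff] at this
      have h3 : hm (FF σ l l' pK x ∩ FF σ l l' pK y) = 0 := by simpa using this
      exact h3
    · exact fun x => (hmeas x).nullMeasurableSet
  have hfin : ∀ x, hm (FF σ l l' pK x) ≠ ∞ := by
    intro x
    refine (lt_of_le_of_lt ?_ (TT_lt_top h.cpt h'.cpt)).ne
    rw [h1]
    exact measure_mono (Set.subset_iUnion _ x)
  rw [h1, h2, ENNReal.toReal_sum (fun x _ => hfin x), Fintype.sum_sum_type, Fintype.sum_sum_type,
    Fintype.sum_prod_type, ← add_assoc]
  congr 1
  · congr 1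
    · simp only [Finset.univ_unique, Finset.sum_singleton]
      change (hm (FF σ l l' pK (Sum.inl ()))).toReal = _
      rw [FF_inl, hm_mem_smul _ (measurableSet_poly l'), ENNReal.toReal_mul, ENNReal.toReal_ofReal kap_pos.le]
      rfl
    · rw [Finset.sum_mul]
      rw [Finset.sum_subtype (p := fun v => v ∈ verts l') _ (by simp) (fun v => b v * hypArea (poly l))]
      refine Finset.sum_congr rfl fun v _ => ?_
      · rw [FF_v, hb _ _ (measurableSet_poly l), ENNReal.toReal_mul, ENNReal.toReal_ofReal (hb0 _)]
        rfl
  · simp only [FF_e]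

end partk

section partl

open MeasureTheory Metric Real UpperHalfPlane
open scoped UpperHalfPlane MatrixGroups ENNReal NNReal Topology Pointwise

/-! ### Half-turns -/

noncomputable def jj (d : ℝ) : SL(2, ℝ) :=
  ⟨!![0, Real.exp (d/2); -Real.exp (-(d/2)), 0], by
    rw [Matrix.det_fin_two_of, Real.exp_neg]
    have := Real.exp_pos (d/2)
    field_simp; norm_num⟩

lemma jj_00 (d : ℝ) : jj d 0 0 = 0 := rfl
lemma jj_01 (d : ℝ) : jj d 0 1 = Real.exp (d/2) := rfl
lemma jj_10 (d : ℝ) : jj d 1 0 = -Real.exp (-(d/2)) := rfl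
lemma jj_11 (d : ℝ) : jj d 1 1 = 0 := rfl

lemma jj_yi (d t : ℝ) : jj d • yi t = yi (d - t) := by
  have h1 := smul_re (jj d) (yi t)
  have h2 := smul_im_den (jj d) (yi t)
  have hd := den_pos (jj d) (yi t)
  have hden : den (jj d) (yi t) = Real.exp (2 * t - d) := by
    unfold den
    rw [jj_10, jj_11, yi_nq, yi_re, neg_sq, ← Real.exp_nat_mul, mul_zero, zero_pow two_ne_zero, add_zero, add_zero, ← Real.exp_add]
    congr 1; push_cast; ring
  refine UpperHalfPlane.ext_re_im ?_ ?_
  · rw [jj_00, jj_11, yi_re] at h1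
    simp only [zero_mul, mul_zero, add_zero] at h1
    rw [yi_re]
    exact (mul_eq_zero.1 h1).resolve_right hd.ne'
  · rw [hden, yi_im] at h2
    rw [yi_im]
    have : Real.exp (d - t) * Real.exp (2 * t - d) = Real.exp t := by
      rw [← Real.exp_add]; congr 1; ring
    exact mul_right_cancel₀ (Real.exp_pos _).ne' (h2.trans this.symm)

lemma pull_jj (d : ℝ) {m : Lin} (h1 : m.1 = 0) (h2 : m.2.2 = 0) : pull (jj d) m = -m := by
  have := det2 (jj d)
  rw [jj_00, jj_01, jj_10, jj_11] at this
  unfold pull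
  rw [jj_00, jj_01, jj_10, jj_11, h1, h2]
  refine Prod.ext ?_ (Prod.ext ?_ ?_)
  · simp [h1]
  · simp only [Prod.snd_neg, Prod.fst_neg]
    linear_combination (-m.2.1) * this
  · simp [h2]

lemma exists_half_turn {ι : Type} {l : ι → Lin} (h : GoodPoly l) (j : ι)
    (hd : Metric.diam (edge l j) ≠ 0) :
    ∃ R : SL(2, ℝ), R • edge l j = edge l j ∧ pull R⁻¹ (l j) = - l j := by
  have hne : (edge l j).Nonempty := by
    by_contra hn
    rw [Set.not_nonempty_iff_eq_empty] at hn
    rw [hn] at hd; simp at hd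
  obtain ⟨p, q, e⟩ := eq_seg_of_line (isCompact_edge h.cpt j) (cconv_edge l j) hne (h.ne0 j)
    (fun z hz => hz.2)
  rw [e, diam_seg] at hd
  obtain ⟨a, a1, a2⟩ := exists_std p q
  have hp : ev (l j) p = 0 := (e ▸ left_mem_seg p q : p ∈ edge l j).2
  have hq : ev (l j) q = 0 := (e ▸ right_mem_seg p q : q ∈ edge l j).2
  obtain ⟨e1, e2⟩ := pull_axis (l := l j) (h := a) hd.symm (by rw [a1]; exact hp) (by rw [a2]; exact hq)
  refine ⟨a * jj (dist p q) * a⁻¹, ?_, ?_⟩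
  · have : edge l j = a • seg (yi 0) (yi (dist p q)) := by
      rw [smul_seg, a1, a2, e]
    rw [this, mul_smul, mul_smul, inv_smul_smul]
    congr 1
    rw [seg_yi dist_nonneg]
    ext z
    constructor
    · rintro ⟨_, ⟨t, ⟨t0, t1⟩, rfl⟩, rfl⟩
      exact ⟨dist p q - t, ⟨by linarith, by linarith⟩, (jj_yi _ _).symm⟩
    · rintro ⟨t, ⟨t0, t1⟩, rfl⟩
      refine ⟨yi (dist p q - t), ⟨_, ⟨by linarith, by linarith⟩, rfl⟩, ?_⟩
      change jj (dist p q) • _ = _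
      rw [jj_yi]; congr 1; ring
  · have k := pull_jj (dist p q) e1 e2
    have k2 : pull (jj (dist p q))⁻¹ (pull a (l j)) = - pull a (l j) := by
      apply pull_inj (jj (dist p q))
      rw [← pull_mul, inv_mul_cancel, pull_one, pull_neg, k, neg_neg]
    rw [mul_inv_rev, mul_inv_rev, inv_inv, pull_mul, pull_mul, k2, pull_neg, ← pull_mul,
      mul_inv_cancel, pull_one]

lemma CC_half {ι ι' : Type} [Finite ι] [Finite ι'] {l : ι → Lin} {l' : ι' → Lin} (h : GoodPoly l)
    (h' : GoodPoly l') (hv : ∀ i, (l i).1 ≠ 0) (i : ι) (j : ι') :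
    (hm (CC 1 l l' i j)).toReal + (hm (CC (-1) l l' i j)).toReal =
      (TT (edge l i) (edge l' j)).toReal / 2 := by
  have hT := TT_lt_top (isCompact_edge h.cpt i) (isCompact_edge h'.cpt j)
  have hsub : ∀ σ, hm (CC σ l l' i j) ≤ TT (edge l i) (edge l' j) :=
    fun σ => measure_mono fun g hg => hg.1
  by_cases hd : Metric.diam (edge l' j) = 0
  · have h0 : TT (edge l i) (edge l' j) = 0 := by
      have := TT_edge h h' i j
      rw [hd, mul_zero, ENNReal.toReal_eq_zero_iff] at this
      exact this.resolve_right hT.ne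
    have h1 := hsub 1
    have h2 := hsub (-1)
    rw [h0] at h1 h2 ⊢
    rw [nonpos_iff_eq_zero.1 h1, nonpos_iff_eq_zero.1 h2]; simp
  obtain ⟨R, hR1, hR2⟩ := exists_half_turn h' j hd
  set H : Set SL(2, ℝ) := {g | (edge l i ∩ g • edge l' j).Nonempty} with hH
  set Hm : Set SL(2, ℝ) := {g | (edge l i ∩ g • edge l' j).Nonempty ∧ (l i).1 * (pull g⁻¹ (l' j)).1 < 0} with hHm
  set Hp : Set SL(2, ℝ) := {g | (edge l i ∩ g • edge l' j).Nonempty ∧ 0 < (l i).1 * (pull g⁻¹ (l' j)).1} with hHp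
  have hc : Continuous fun g : SL(2, ℝ) => pull g⁻¹ (l' j) := (continuous_pull _).comp continuous_inv
  have mH : MeasurableSet H := measurableSet_hit (isCompact_edge h.cpt i) (isCompact_edge h'.cpt j)
  have mHp : MeasurableSet Hp := mH.inter (s₂ := {g | 0 < (l i).1 * (pull g⁻¹ (l' j)).1})
    (isOpen_lt continuous_const (by fun_prop)).measurableSet
  have gen := gen_ae h h'
  have e1 : hm H = hm Hm + hm Hp := by
    rw [← measure_union _ mHp]
    · refine measure_congr ?_
      filter_upwards [gen] with g hg
      refine propext ?_
      change g ∈ H ↔ g ∈ Hm ∪ Hp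
      have hne : (l i).1 * (pull g⁻¹ (l' j)).1 ≠ 0 := mul_ne_zero (hv i) (hg.g4 j)
      constructor
      · intro hh
        rcases hne.lt_or_gt with h0 | h0
        · exact Or.inl ⟨hh, h0⟩
        · exact Or.inr ⟨hh, h0⟩
      · rintro (h0 | h0) <;> exact h0.1
    · rw [Set.disjoint_left]
      rintro g ⟨_, h1⟩ ⟨_, h2⟩
      linarith
  have e2 : hm Hm = hm Hp := by
    rw [← measure_preimage_mul_right hm R Hm]
    congr 1; ext g
    change (edge l i ∩ (g * R) • edge l' j).Nonempty ∧ (l i).1 * (pull (g * R)⁻¹ (l' j)).1 < 0 ↔ _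
    rw [mul_smul, hR1, mul_inv_rev, pull_mul, hR2, pull_neg]
    simp only [Prod.fst_neg, mul_neg, Left.neg_neg_iff]
    rfl
  have e3 : hm Hm = hm (CC 1 l l' i j) + hm (CC (-1) l l' i j) := by
    rw [← measure_union _ (measurableSet_CC _ h h' i j)]
    · refine measure_congr ?_
      filter_upwards [gen] with g hg
      refine propext ?_
      change g ∈ Hm ↔ g ∈ CC 1 l l' i j ∪ CC (-1) l l' i j
      constructor
      · rintro ⟨⟨p, hp1, hp2⟩, h1⟩
        have hj := mem_smul_edge.1 hp2
        have hne : (edge l' j).Nonempty := ⟨_, Set.mem_smul_set_iff_inv_smul_mem.1 hp2⟩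
        have hD := dd_ne (hg.g3 i j hne) hp1.2 hj.2
        have : (l i).1 * dd (l i) (pull g⁻¹ (l' j)) ≠ 0 := mul_ne_zero (hv i) hD
        rcases this.lt_or_gt with h0 | h0
        · exact Or.inr ⟨⟨p, hp1, hp2⟩, h1, by linarith⟩
        · exact Or.inl ⟨⟨p, hp1, hp2⟩, h1, by linarith⟩
      · rintro (h0 | h0) <;> exact ⟨h0.1, h0.2.1⟩
    · rw [Set.disjoint_left]
      rintro g ⟨_, _, h1⟩ ⟨_, _, h2⟩
      linarith
  have e4 : TT (edge l i) (edge l' j) = 2 * (hm (CC 1 l l' i j) + hm (CC (-1) l l' i j)) := by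
    change hm H = _
    rw [e1, ← e2, e3, two_mul]
  rw [e4, ENNReal.toReal_mul, ENNReal.toReal_add ((hsub _).trans_lt hT).ne ((hsub _).trans_lt hT).ne]
  simp

lemma kin1 {ι' : Type} [Fintype ι'] {l' : ι' → Lin} (h' : GoodPoly l') :
    ∃ β : ℝ, 0 ≤ β ∧ ∀ (ι : Type) [Fintype ι] (l : ι → Lin), GoodPoly l →
      (TT (poly l) (poly l')).toReal = kap * hypArea (poly l') + β * hypArea (poly l)
        + cc / 4 * per l * per l' := by
  choose b1 hb1 hb1' using EV_area 1 (poly l')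
  choose b2 hb2 hb2' using EV_area (-1) (poly l')
  refine ⟨(∑ v ∈ (verts_finite h').toFinset, b1 v + ∑ v ∈ (verts_finite h').toFinset, b2 v) / 2,
    ?_, ?_⟩
  · have := Finset.sum_nonneg (s := (verts_finite h').toFinset) (fun v _ => hb1 v)
    have := Finset.sum_nonneg (s := (verts_finite h').toFinset) (fun v _ => hb2 v)
    linarith
  intro ι _ l h
  have main : ∀ l : ι → Lin, GoodPoly l → (∀ i, (l i).1 ≠ 0) → (TT (poly l) (poly l')).toReal = kap * hypArea (poly l') +
     (∑ v ∈ (verts_finite h').toFinset, b1 v + ∑ v ∈ (verts_finite h').toFinset, b2 v) / 2 * hypArea (poly l)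
        + cc / 4 * per l * per l' := by
    intro l h hv
    have k1 := kin_half h h' hv one_ne_zero b1 hb1 hb1'
    have k2 := kin_half h h' hv (neg_ne_zero.2 one_ne_zero) b2 hb2 hb2'
    have k3 : ∑ i, ∑ j, (hm (CC 1 l l' i j)).toReal + ∑ i, ∑ j, (hm (CC (-1) l l' i j)).toReal =
        cc / 2 * per l * per l' := by
      rw [← Finset.sum_add_distrib]
      simp_rw [← Finset.sum_add_distrib, CC_half h h' hv, TT_edge h h']
      unfold per
      rw [mul_assoc, Finset.sum_mul_sum, Finset.mul_sum]
      refine Finset.sum_congr rfl fun i _ => ?_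
      rw [Finset.mul_sum]
      refine Finset.sum_congr rfl fun j _ => ?_
      ring
    linarith
  have : ∀ᵐ g ∂hm, ∀ i, (pull g⁻¹ (l i)).1 ≠ 0 := by
    rw [MeasureTheory.ae_all_iff]
    intro j
    rw [ae_iff]
    simp only [not_not, ne_eq]
    exact null_pull_inv (h.ne0 j)
  obtain ⟨g, hg⟩ := this.exists
  have := main _ (h.smul g) hg
  rw [per_smul, ← smul_poly, TT_smul_left] at this
  rw [this]
  unfold hypArea
  rw [area_smul g (measurableSet_poly l)]

end partl

section partm

open MeasureTheory Metric Real UpperHalfPlane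
open scoped UpperHalfPlane MatrixGroups ENNReal NNReal Topology Pointwise

/-! ### Distance to a geodesic -/

noncomputable def hF (z : ℍ) : ℝ := Real.arsinh ((nq z - 1) / (2 * z.im))

lemma sinh_hF (z : ℍ) : Real.sinh (hF z) = (nq z - 1) / (2 * z.im) := Real.sinh_arsinh _

lemma hF_lip (z w : ℍ) : |hF z - hF w| ≤ dist z w := by
  rw [← abs_of_nonneg (dist_nonneg (x := z) (y := w)), ← Real.cosh_le_cosh, Real.cosh_sub]
  have a := z.im_pos
  have b := w.im_pos
  set u := hF z
  set v := hF w
  have hu : Real.sinh u = (nq z - 1) / (2 * z.im) := sinh_hF z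
  have hv : Real.sinh v = (nq w - 1) / (2 * w.im) := sinh_hF w
  set T := (nq z + 1) / (2 * z.im) with hT
  set T' := (nq w + 1) / (2 * w.im) with hT'
  set X := z.re / z.im with hX
  set X' := w.re / w.im with hX'
  have e1 : T ^ 2 = Real.cosh u ^ 2 + X ^ 2 := by
    rw [Real.cosh_sq, hu, hT, hX]; field_simp; unfold nq; ring
  have e2 : T' ^ 2 = Real.cosh v ^ 2 + X' ^ 2 := by
    rw [Real.cosh_sq, hv, hT', hX']; field_simp; unfold nq; ring
  have hTp : 0 < T := by have := nq_pos z; positivity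
  have hTp' : 0 < T' := by have := nq_pos w; positivity
  have e3 : Real.cosh (dist z w) = T * T' - Real.sinh u * Real.sinh v - X * X' := by
    rw [cosh_dist_nq, hu, hv, hT, hT', hX, hX']; field_simp; ring
  have e4 : Real.cosh u * Real.cosh v + X * X' ≤ T * T' := by
    apply le_of_sq_le_sq _ (by positivity) |> fun h => h
    have : (T * T') ^ 2 = (Real.cosh u ^ 2 + X ^ 2) * (Real.cosh v ^ 2 + X' ^ 2) := by
      rw [mul_pow, e1, e2]
    rw [this]
    nlinarith [sq_nonneg (Real.cosh u * X' - Real.cosh v * X)]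
  rw [e3]; linarith

lemma hF_yi (t : ℝ) : hF (yi t) = t := by
  apply Real.sinh_injective
  rw [sinh_hF, yi_nq, yi_im, Real.sinh_eq, div_eq_div_iff (by positivity) (by norm_num), Real.exp_neg,
    two_mul t, Real.exp_add]
  have := Real.exp_pos t
  field_simp

lemma hF_nonpos {z : ℍ} : hF z ≤ 0 ↔ nq z ≤ 1 := by
  unfold hF
  rw [Real.arsinh_nonpos_iff, div_nonpos_iff]
  have := z.im_pos
  constructor
  · rintro (h | h)
    · linarith [h.2]
    · linarith [h.1]
  · intro h; right; constructor <;> linarith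

lemma im_concave (p q : ℍ) {t : ℝ} (h0 : 0 ≤ t) (h1 : t ≤ 1) :
    (1 - t) * p.im + t * q.im ≤ (cmb p q t).im := by
  have a := (cmb p q t).im_pos
  refine abs_le_of_sq_le_sq' ?_ a.le |>.2
  rw [im_sq, cmb_re _ _ h0 h1, cmb_nq _ _ h0 h1]
  unfold nq
  have : 0 ≤ t * (1 - t) := mul_nonneg h0 (by linarith)
  nlinarith [mul_nonneg this (sq_nonneg (p.re - q.re)), mul_nonneg this (sq_nonneg (p.im - q.im))]

lemma hF_le_iff {z : ℍ} {s : ℝ} : hF z ≤ s ↔ nq z - 1 ≤ 2 * Real.sinh s * z.im := by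
  have := z.im_pos
  rw [← Real.sinh_le_sinh, sinh_hF, div_le_iff₀ (by positivity)]
  constructor <;> intro h <;> linarith

lemma cconv_hF {s : ℝ} (hs : 0 ≤ s) : CConv {z | hF z ≤ s} := by
  intro p hp q hq t h0 h1
  have hp : hF p ≤ s := hp
  have hq : hF q ≤ s := hq
  change hF _ ≤ s
  rw [hF_le_iff] at *
  rw [cmb_nq _ _ h0 h1]
  have h2 := im_concave p q h0 h1
  have h3 : 0 ≤ Real.sinh s := Real.sinh_nonneg_iff.2 hs
  have h4 : 0 ≤ 1 - t := by linarith
  have := mul_le_mul_of_nonneg_left h2 (by positivity : 0 ≤ 2 * Real.sinh s)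
  nlinarith [mul_le_mul_of_nonneg_left hp h4, mul_le_mul_of_nonneg_left hq h0]

/-! ### Nearest points -/

lemma nearest_std {K : Set ℍ} (hK : CConv K) (h0 : yi 0 ∈ K) {ρ : ℝ} (hρ : 0 < ρ)
    (hmin : ∀ w ∈ K, ρ ≤ dist w (yi ρ)) : ∀ w ∈ K, hF w ≤ 0 := by
  intro w hw
  rw [hF_nonpos]
  set E := Real.exp (2 * ρ) with hE
  have hE1 : 1 < E := by rw [hE]; exact Real.one_lt_exp_iff.2 (by linarith)
  set m := nq w - 1 with hm'
  set x := w.re with hx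
  have key : ∀ t : ℝ, 0 < t → t ≤ 1 → 0 ≤ (2 * (E + 1) - (E + 1) ^ 2) * m + t * (m ^ 2 + (E + 1) ^ 2 * x ^ 2) := by
    intro t t0 t1
    have hz := hK _ h0 _ hw t t0.le t1
    have h2 := hmin _ hz
    set z := cmb (yi 0) w t with hzdef
    have hn : nq z = 1 + t * m := by
      rw [hzdef, cmb_nq _ _ t0.le t1, yi_nq]; simp [hm']; ring
    have hr : z.re = t * x := by
      rw [hzdef, cmb_re _ _ t0.le t1, yi_re]; ring
    have hi : z.im ^ 2 = 1 + t * m - (t * x) ^ 2 := by rw [im_sq, hn, hr]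
    have h3 : Real.cosh ρ ≤ Real.cosh (dist z (yi ρ)) := (cosh_le_nonneg hρ.le dist_nonneg).2 h2
    have h4 := cosh_dist_mul z (yi ρ)
    rw [hn, yi_nq, yi_re, yi_im, ← hE] at h4
    have hzp := z.im_pos
    have hep := Real.exp_pos ρ
    have h5 : Real.cosh ρ * (2 * z.im * Real.exp ρ) ≤ 1 + t * m + E := by
      have := mul_le_mul_of_nonneg_right h3 (by positivity : 0 ≤ 2 * z.im * Real.exp ρ)
      linarith
    have h6 : Real.cosh ρ * (2 * z.im * Real.exp ρ) = (E + 1) * z.im := by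
      rw [Real.cosh_eq, hE, two_mul ρ, Real.exp_add, Real.exp_neg]; field_simp
    rw [h6] at h5
    have h7 : ((E + 1) * z.im) ^ 2 ≤ (1 + t * m + E) ^ 2 := pow_le_pow_left₀ (by positivity) h5 2
    rw [mul_pow, hi] at h7
    have h8 : 0 ≤ t * ((2 * (E + 1) - (E + 1) ^ 2) * m + t * (m ^ 2 + (E + 1) ^ 2 * x ^ 2)) := by
      nlinarith
    exact nonneg_of_mul_nonneg_right h8 t0
  by_contra hcon
  have hmp : 0 < m := by linarith
  set B := m ^ 2 + (E + 1) ^ 2 * x ^ 2 with hB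
  have hBp : 0 < B := by positivity
  set A := ((E + 1) * (E - 1)) * m with hA
  have hAp : 0 < A := by
    have : 0 < E - 1 := by linarith
    positivity
  have hAe : (2 * (E + 1) - (E + 1) ^ 2) * m = -A := by rw [hA]; ring
  rw [hAe] at key
  have h1 := key (min 1 (A / (2 * B))) (by positivity) (min_le_left _ _)
  have h2 : min 1 (A / (2 * B)) * B ≤ A / 2 := by
    calc min 1 (A / (2 * B)) * B ≤ (A / (2 * B)) * B := mul_le_mul_of_nonneg_right (min_le_right _ _) hBp.le
      _ = A / 2 := by field_simp
  linarith

lemma sep {K : Set ℍ} (hc : IsCompact K) (hK : CConv K) (hne : K.Nonempty) {z : ℍ} (hz : z ∉ K) :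
    ∃ (g : SL(2, ℝ)) (ρ : ℝ), 0 < ρ ∧ g • yi 0 ∈ K ∧ g • yi ρ = z ∧ (∀ w ∈ K, ρ ≤ dist w z) ∧
      ∀ w ∈ K, hF (g⁻¹ • w) ≤ 0 := by
  obtain ⟨f, hf, hmin⟩ := hc.exists_isMinOn hne (f := fun w => dist w z) (by fun_prop)
  obtain ⟨g, g1, g2⟩ := exists_std f z
  have hρ : 0 < dist f z := dist_pos.2 (fun h => hz (h ▸ hf))
  have hmin' : ∀ w ∈ K, dist f z ≤ dist w z := fun w hw => hmin hw
  refine ⟨g, dist f z, hρ, by rw [g1]; exact hf, g2, hmin', ?_⟩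
  have := nearest_std (K := g⁻¹ • K) (hK.smul _) (by
    rw [Set.mem_smul_set_iff_inv_smul_mem, inv_inv, g1]; exact hf) hρ (by
    intro w hw
    rw [Set.mem_smul_set_iff_inv_smul_mem, inv_inv] at hw
    have := hmin' _ hw
    rwa [← dist_smul g w (yi _), g2])
  intro w hw
  exact this _ (Set.smul_mem_smul_set hw)

/-! ### Parallel bodies -/

def nb (ε : ℝ) (K : Set ℍ) : Set ℍ := {z | ∃ w ∈ K, dist w z ≤ ε}

lemma subset_nb {ε : ℝ} (hε : 0 ≤ ε) (K : Set ℍ) : K ⊆ nb ε K := fun z hz => ⟨z, hz, by simpa using hε⟩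

lemma nb_mono {ε δ : ℝ} (h : ε ≤ δ) {K L : Set ℍ} (hKL : K ⊆ L) : nb ε K ⊆ nb δ L :=
  fun _ ⟨w, hw, hd⟩ => ⟨w, hKL hw, hd.trans h⟩

lemma nb_eq {ε : ℝ} (hε : 0 ≤ ε) {K : Set ℍ} (hc : IsCompact K) : nb ε K = cthickening ε K := by
  rw [hc.cthickening_eq_biUnion_closedBall hε]
  ext z
  simp only [nb, Set.mem_ofPred_eq, Set.mem_iUnion, mem_closedBall, dist_comm z, exists_prop]

lemma isCompact_nb {ε : ℝ} (hε : 0 ≤ ε) {K : Set ℍ} (hc : IsCompact K) : IsCompact (nb ε K) := by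
  rw [nb_eq hε hc]; exact hc.cthickening

lemma nb_nb {ε δ : ℝ} (hε : 0 ≤ ε) (hδ : 0 ≤ δ) (K : Set ℍ) : nb δ (nb ε K) = nb (ε + δ) K := by
  ext z
  constructor
  · rintro ⟨w, ⟨v, hv, h1⟩, h2⟩
    exact ⟨v, hv, (dist_triangle v w z).trans (add_le_add h1 h2)⟩
  · rintro ⟨v, hv, h1⟩
    obtain ⟨w, h2, h3⟩ := exists_btw v z hε hδ h1
    exact ⟨w, ⟨v, hv, h2⟩, h3⟩

lemma smul_nb (g : SL(2, ℝ)) (ε : ℝ) (K : Set ℍ) : g • nb ε K = nb ε (g • K) := by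
  ext z
  rw [Set.mem_smul_set_iff_inv_smul_mem]
  constructor
  · rintro ⟨w, hw, h⟩
    exact ⟨g • w, Set.smul_mem_smul_set hw, by rw [← dist_smul g⁻¹, inv_smul_smul]; exact h⟩
  · rintro ⟨_, ⟨w, hw, rfl⟩, h⟩
    exact ⟨w, hw, by rw [← dist_smul g, smul_inv_smul]; exact h⟩

lemma nb_singleton (p : ℍ) (ε : ℝ) : nb ε {p} = closedBall p ε := by
  ext z; simp [nb, dist_comm]

lemma CConv.nb {K : Set ℍ} (hK : CConv K) (hc : IsCompact K) {ε : ℝ} (hε : 0 ≤ ε) : CConv (nb ε K) := by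
  intro p hp q hq t t0 t1
  by_contra hcon
  have hne : K.Nonempty := by obtain ⟨w, hw, -⟩ := hp; exact ⟨w, hw⟩
  have hz : cmb p q t ∉ K := fun h => hcon (subset_nb hε K h)
  obtain ⟨g, ρ, hρ, h1, h2, h3, h4⟩ := sep hc hK hne hz
  have h5 : ε < ρ := by
    by_contra h
    refine hcon ⟨_, h1, ?_⟩
    rw [← h2, dist_smul, dist_yi, zero_sub, abs_neg, abs_of_pos hρ]
    linarith
  have h6 : ∀ w ∈ _root_.nb ε K, hF (g⁻¹ • w) ≤ ε := by
    rintro w ⟨v, hv, hd⟩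
    have a := h4 v hv
    have b := hF_lip (g⁻¹ • v) (g⁻¹ • w)
    rw [dist_smul] at b
    have := (abs_le.1 b).1
    linarith
  obtain ⟨s, s0, s1, e⟩ := smul_cmb g⁻¹ p q t0 t1
  have h7 := cconv_hF hε _ (h6 p hp) _ (h6 q hq) s s0 s1
  rw [← e] at h7
  have h8 : hF (g⁻¹ • cmb p q t) ≤ ε := h7
  rw [← h2, inv_smul_smul, hF_yi] at h8
  linarith

end partm

section partn

open MeasureTheory Metric Real UpperHalfPlane
open scoped UpperHalfPlane MatrixGroups ENNReal NNReal Topology Pointwise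

/-! ### Outer polygons -/

lemma ev_smul (r : ℝ) (l : Lin) (z : ℍ) : ev (r • l) z = r * ev l z := by
  unfold ev; simp; ring

lemma ev_zero (z : ℍ) : ev 0 z = 0 := by unfold ev; simp

lemma sep_line {K : Set ℍ} (hc : IsCompact K) (hK : CConv K) (hne : K.Nonempty) {z : ℍ} (hz : z ∉ K) :
    ∃ l : Lin, ‖l‖ = 1 ∧ (∀ w ∈ K, 0 < ev l w) ∧ ev l z < 0 := by
  obtain ⟨g, ρ, hρ, h1, h2, h3, h4⟩ := sep hc hK hne hz
  have hE : 1 < Real.exp ρ := Real.one_lt_exp_iff.2 hρ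
  set m : Lin := (-1, 0, Real.exp ρ) with hm'
  have hev : ∀ w, ev m w = Real.exp ρ - nq w := by intro w; unfold ev; simp [hm']; ring
  set l := pull g⁻¹ m with hl
  have k1 : ∀ w ∈ K, 0 < ev l w := by
    intro w hw
    rw [hl, ev_pull, hev]
    have := hF_nonpos.1 (h4 w hw)
    exact mul_pos (den_pos _ _) (by linarith)
  have k2 : ev l z < 0 := by
    rw [hl, ev_pull, hev, ← h2, inv_smul_smul, yi_nq]
    have : Real.exp ρ < Real.exp (2 * ρ) := Real.exp_lt_exp.2 (by linarith)
    exact mul_neg_of_pos_of_neg (den_pos _ _) (by linarith)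
  have hl0 : l ≠ 0 := by
    intro h; rw [h, ev_zero] at k2; exact lt_irrefl _ k2
  have hn : 0 < ‖l‖ := norm_pos_iff.2 hl0
  refine ⟨‖l‖⁻¹ • l, by rw [norm_smul, norm_inv, norm_norm, inv_mul_cancel₀ hn.ne'], ?_, ?_⟩
  · intro w hw; rw [ev_smul]; have := k1 w hw; positivity
  · rw [ev_smul]; exact mul_neg_of_pos_of_neg (by positivity) k2

lemma isPreconnected_seg (p q : ℍ) : IsPreconnected (seg p q) := by
  obtain ⟨h, hh⟩ := seg_std p q
  rw [← hh, seg_yi dist_nonneg]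
  exact (isPreconnected_Icc.image _ continuous_yi.continuousOn).image _ (continuous_smul_const h).continuousOn

lemma outer {K : Set ℍ} (hc : IsCompact K) (hK : CConv K) (hne : K.Nonempty) {ε : ℝ} (hε : 0 < ε) :
    ∃ s : Finset Lin, GoodPoly (fun x : s => x.1) ∧ (∀ x ∈ s, ∀ z ∈ K, 0 < ev x z) ∧
      poly (fun x : s => x.1) ⊆ nb ε K := by
  classical
  set Sh : Set ℍ := {z | infDist z K = ε} with hSh
  have hnb : ∀ z, z ∈ nb ε K ↔ infDist z K ≤ ε := by
    intro z
    constructor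
    · rintro ⟨w, hw, hd⟩
      exact (infDist_le_dist_of_mem hw).trans (by rwa [dist_comm])
    · intro h
      obtain ⟨w, hw, e⟩ := hc.exists_infDist_eq_dist hne z
      exact ⟨w, hw, by rw [dist_comm, ← e]; exact h⟩
  have hShc : IsCompact Sh := by
    refine (isCompact_nb hε.le hc).of_isClosed_subset
      (isClosed_eq (continuous_infDist_pt K) continuous_const) ?_
    intro z hz
    exact (hnb z).2 (le_of_eq hz)
  have hShK : ∀ z ∈ Sh, z ∉ K := by
    intro z hz h
    have : infDist z K = ε := hz
    rw [infDist_zero_of_mem h] at this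
    linarith
  have hsep : ∀ z : ℍ, ∃ l : Lin, z ∈ Sh → (‖l‖ = 1 ∧ (∀ w ∈ K, 0 < ev l w) ∧ ev l z < 0) := by
    intro z
    by_cases hz : z ∈ Sh
    · obtain ⟨l, hl⟩ := sep_line hc hK hne (hShK z hz)
      exact ⟨l, fun _ => hl⟩
    · exact ⟨0, fun h => absurd h hz⟩
  choose L hL using hsep
  obtain ⟨t, ht, hcov⟩ := hShc.elim_nhds_subcover (fun z => {w | ev (L z) w < 0}) (fun z hz =>
    (isOpen_lt (continuous_ev _) continuous_const).mem_nhds (hL z hz).2.2)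
  set s : Finset Lin := t.image L with hs
  have hs1 : ∀ x ∈ s, ‖x‖ = 1 ∧ ∀ w ∈ K, 0 < ev x w := by
    intro x hx
    obtain ⟨z, hz, rfl⟩ := Finset.mem_image.1 hx
    exact ⟨(hL z (ht z hz)).1, (hL z (ht z hz)).2.1⟩
  have hKQ : K ⊆ poly (fun x : s => x.1) := fun w hw x => ((hs1 x.1 x.2).2 w hw).le
  have hdis : ∀ z ∈ Sh, z ∉ poly (fun x : s => x.1) := by
    intro z hz hzq
    obtain ⟨y, hy, hyz⟩ := Set.mem_iUnion₂.1 (hcov hz)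
    have := hzq ⟨L y, Finset.mem_image_of_mem _ hy⟩
    have h2 : ev (L y) z < 0 := hyz
    linarith
  have hQ : poly (fun x : s => x.1) ⊆ nb ε K := by
    intro w hw
    rw [hnb]
    by_contra hcon
    push Not at hcon
    obtain ⟨k, hk⟩ := hne
    have hseg : seg k w ⊆ poly (fun x : s => x.1) := seg_subset (cconv_poly _) (hKQ hk) hw
    have := (isPreconnected_seg k w).intermediate_value (left_mem_seg k w) (right_mem_seg k w)
      (f := fun z => infDist z K) (continuous_infDist_pt K).continuousOn
    have h3 : ε ∈ Set.Icc (infDist k K) (infDist w K) := by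
      rw [infDist_zero_of_mem hk]; exact ⟨hε.le, hcon.le⟩
    obtain ⟨z, hz, e⟩ := this h3
    exact hdis z e (hseg hz)
  refine ⟨s, ⟨?_, ?_, ?_, ?_⟩, fun x hx => (hs1 x hx).2, hQ⟩
  · rintro ⟨x, hx⟩ h0
    have := (hs1 x hx).1
    simp only at h0
    rw [h0] at this; simp at this
  · rintro ⟨x, hx⟩ ⟨y, hy⟩ hxy
    by_contra hn
    have hx1 := (hs1 x hx).1
    have hy1 := (hs1 y hy).1
    have hx0 : x ≠ 0 := by rintro rfl; simp at hx1
    obtain ⟨r, hr⟩ := (not_indep_iff hx0).1 hn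
    have hr : y = r • x := hr
    obtain ⟨k, hk⟩ := hne
    have p1 := (hs1 x hx).2 k hk
    have p2 := (hs1 y hy).2 k hk
    rw [hr, ev_smul] at p2
    have hrp : 0 < r := pos_of_mul_pos_left p2 p1.le
    rw [hr, norm_smul, hx1, mul_one, Real.norm_eq_abs, abs_of_pos hrp] at hy1
    rw [hy1, one_smul] at hr
    exact hxy (Subtype.ext hr.symm)
  · exact (isCompact_nb hε.le hc).of_isClosed_subset (isClosed_poly _) hQ
  · exact hne.mono hKQ

/-! ### Continuity from above -/

lemma hit_iInter {K L : Set ℍ} (hK : IsCompact K) (hL : IsCompact L) {e : ℕ → ℝ} (he : ∀ n, 0 < e n)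
    (h0 : Filter.Tendsto e Filter.atTop (𝓝 0)) {g : SL(2, ℝ)}
    (h : ∀ n, (nb (e n) K ∩ g • nb (e n) L).Nonempty) : (K ∩ g • L).Nonempty := by
  have hd : ∀ n, ∃ k ∈ K, ∃ w ∈ g • L, dist k w ≤ 2 * e n := by
    intro n
    obtain ⟨z, ⟨k, hk, h1⟩, h2⟩ := h n
    rw [smul_nb] at h2
    obtain ⟨w, hw, h3⟩ := h2
    refine ⟨k, hk, w, hw, ?_⟩
    have := dist_triangle_right k w z
    linarith
  have hne : (K ×ˢ (g • L)).Nonempty := by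
    obtain ⟨k, hk, w, hw, -⟩ := hd 0
    exact ⟨(k, w), hk, hw⟩
  obtain ⟨⟨k, w⟩, ⟨hk, hw⟩, hmin⟩ := (hK.prod (hL.smul g)).exists_isMinOn hne
    (f := fun x : ℍ × ℍ => dist x.1 x.2) (by fun_prop)
  have h1 : ∀ n, dist k w ≤ 2 * e n := by
    intro n
    obtain ⟨k', hk', w', hw', h2⟩ := hd n
    exact (hmin (Set.mk_mem_prod hk' hw')).trans h2
  have h2 : dist k w ≤ 0 := by
    have := h0.const_mul 2
    rw [mul_zero] at this
    exact ge_of_tendsto this (Filter.Eventually.of_forall h1)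
  have h3 : k = w := dist_le_zero.1 h2
  exact ⟨k, hk, h3 ▸ hw⟩

noncomputable def en (n : ℕ) : ℝ := 1 / ((n : ℝ) + 1)
lemma en_pos (n : ℕ) : 0 < en n := by unfold en; positivity
lemma en_tendsto : Filter.Tendsto en Filter.atTop (𝓝 0) := tendsto_one_div_add_atTop_nhds_zero_nat
lemma en_anti : Antitone en := by
  intro m n h
  unfold en
  have : (m : ℝ) ≤ n := by exact_mod_cast h
  gcongr

lemma TT_nb_tendsto {K L : Set ℍ} (hK : IsCompact K) (hL : IsCompact L) :
    Filter.Tendsto (fun n => (TT (nb (en n) K) (nb (en n) L)).toReal) Filter.atTop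
      (𝓝 (TT K L).toReal) := by
  refine (ENNReal.tendsto_toReal (TT_lt_top hK hL).ne).comp ?_
  have : {g : SL(2, ℝ) | (K ∩ g • L).Nonempty} =
      ⋂ n, {g : SL(2, ℝ) | (nb (en n) K ∩ g • nb (en n) L).Nonempty} := by
    ext g
    rw [Set.mem_iInter]
    constructor
    · intro h n
      exact h.mono (Set.inter_subset_inter (subset_nb (en_pos n).le K)
        (Set.smul_set_mono (subset_nb (en_pos n).le L)))
    · intro h
      exact hit_iInter hK hL en_pos en_tendsto h
  unfold TT
  rw [this]
  refine tendsto_measure_iInter_atTop (fun n => (measurableSet_hit (isCompact_nb (en_pos n).le hK)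
    (isCompact_nb (en_pos n).le hL)).nullMeasurableSet) ?_ ⟨0, (TT_lt_top (isCompact_nb (en_pos 0).le hK)
    (isCompact_nb (en_pos 0).le hL)).ne⟩
  intro m n h g hg
  exact hg.mono (Set.inter_subset_inter (nb_mono (en_anti h) le_rfl)
        (Set.smul_set_mono (nb_mono (en_anti h) le_rfl)))

lemma area_nb_tendsto {K : Set ℍ} (hK : IsCompact K) :
    Filter.Tendsto (fun n => hypArea (nb (en n) K)) Filter.atTop (𝓝 (hypArea K)) := by
  refine (ENNReal.tendsto_toReal (area_lt_top hK).ne).comp ?_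
  have : K = ⋂ n, nb (en n) K := by
    refine Set.Subset.antisymm (Set.subset_iInter fun n => subset_nb (en_pos n).le K) ?_
    intro z hz
    rw [Set.mem_iInter] at hz
    have h : (K ∩ (1 : SL(2, ℝ)) • ({z} : Set ℍ)).Nonempty := by
      refine hit_iInter hK isCompact_singleton en_pos en_tendsto fun n => ?_
      rw [one_smul]
      exact ⟨z, hz n, subset_nb (en_pos n).le _ rfl⟩
    rw [one_smul] at h
    obtain ⟨w, hw, rfl⟩ := h
    exact hw
  conv => enter [3]; rw [this]
  refine tendsto_measure_iInter_atTop (fun n => (isCompact_nb (en_pos n).le hK).measurableSet.nullMeasurableSet)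
    ?_ ⟨0, (area_lt_top (isCompact_nb (en_pos 0).le hK)).ne⟩
  intro m n h
  exact nb_mono (en_anti h) le_rfl

lemma hypArea_mono {K L : Set ℍ} (hL : IsCompact L) (h : K ⊆ L) : hypArea K ≤ hypArea L :=
  ENNReal.toReal_mono (area_lt_top hL).ne (measure_mono h)

lemma TTr_mono {K K' L L' : Set ℍ} (hK' : IsCompact K') (hL' : IsCompact L') (h : K ⊆ K') (h' : L ⊆ L') :
    (TT K L).toReal ≤ (TT K' L').toReal := ENNReal.toReal_mono (TT_lt_top hK' hL').ne (TT_mono h h')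

end partn

section parto

open MeasureTheory Metric Real UpperHalfPlane Filter
open scoped UpperHalfPlane MatrixGroups ENNReal NNReal Topology Pointwise

/-! ### The kinematic formula -/

structure CB (K : Set ℍ) : Prop where
  cpt : IsCompact K
  cv : CConv K
  ne : K.Nonempty

lemma GoodPoly.cb {ι : Type} {l : ι → Lin} (h : GoodPoly l) : CB (poly l) := ⟨h.cpt, cconv_poly l, h.ne⟩

lemma CB.nb {K : Set ℍ} (h : CB K) {ε : ℝ} (hε : 0 ≤ ε) : CB (nb ε K) :=
  ⟨isCompact_nb hε h.cpt, h.cv.nb h.cpt hε, h.ne.mono (subset_nb hε K)⟩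

lemma cb_seg (p q : ℍ) : CB (seg p q) := ⟨isCompact_seg p q, cconv_seg p q, ⟨p, left_mem_seg p q⟩⟩

lemma cb_singleton (p : ℍ) : CB {p} := by rw [← seg_self]; exact cb_seg p p

lemma cb_ball (p : ℍ) {r : ℝ} (hr : 0 ≤ r) : CB (closedBall p r) := by
  rw [← nb_singleton]; exact (cb_singleton p).nb hr

lemma CB.smul {K : Set ℍ} (h : CB K) (g : SL(2, ℝ)) : CB (g • K) :=
  ⟨h.cpt.smul g, h.cv.smul g, h.ne.smul_set⟩

lemma area_pos {U : Set ℍ} (hU : (interior U).Nonempty) : 0 < hypAreaMeasure U := by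
  have h1 : 0 < hm {g | g • I ∈ interior U} := by
    refine IsOpen.measure_pos hm (isOpen_interior.preimage (continuous_id.smul continuous_const)) ?_
    obtain ⟨p, hp⟩ := hU
    obtain ⟨a, ha⟩ := MulAction.exists_smul_eq SL(2, ℝ) I p
    exact ⟨a, by change a • I ∈ interior U; rw [ha]; exact hp⟩
  rw [hm_smul_mem I isOpen_interior.measurableSet] at h1
  have h2 : 0 < hypAreaMeasure (interior U) := by
    by_contra h
    rw [not_lt, nonpos_iff_eq_zero] at h
    rw [h] at h1; simp at h1
  exact h2.trans_le (measure_mono interior_subset)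

lemma hypArea_pos {U : Set ℍ} (hc : IsCompact U) (hU : (interior U).Nonempty) : 0 < hypArea U :=
  ENNReal.toReal_pos (area_pos hU).ne' (area_lt_top hc).ne

lemma hypArea_nonneg (U : Set ℍ) : 0 ≤ hypArea U := ENNReal.toReal_nonneg

noncomputable def outerS {K : Set ℍ} (h : CB K) (n : ℕ) : Finset Lin :=
  (outer h.cpt h.cv h.ne (en_pos n)).choose

def opoly {K : Set ℍ} (h : CB K) (n : ℕ) : Set ℍ := poly (fun x : outerS h n => x.1)
noncomputable def operi {K : Set ℍ} (h : CB K) (n : ℕ) : ℝ := per (fun x : outerS h n => x.1)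

lemma good_outer {K : Set ℍ} (h : CB K) (n : ℕ) : GoodPoly (fun x : outerS h n => x.1) :=
  (outer h.cpt h.cv h.ne (en_pos n)).choose_spec.1

lemma outer_pos {K : Set ℍ} (h : CB K) (n : ℕ) : ∀ x ∈ outerS h n, ∀ z ∈ K, 0 < ev x z :=
  (outer h.cpt h.cv h.ne (en_pos n)).choose_spec.2.1

lemma opoly_sub {K : Set ℍ} (h : CB K) (n : ℕ) : opoly h n ⊆ nb (en n) K :=
  (outer h.cpt h.cv h.ne (en_pos n)).choose_spec.2.2

lemma sub_opoly {K : Set ℍ} (h : CB K) (n : ℕ) : K ⊆ opoly h n :=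
  fun z hz x => (outer_pos h n x.1 x.2 z hz).le

lemma cpt_opoly {K : Set ℍ} (h : CB K) (n : ℕ) : IsCompact (opoly h n) := (good_outer h n).cpt

lemma area_opoly {K : Set ℍ} (h : CB K) : Tendsto (fun n => hypArea (opoly h n)) atTop (𝓝 (hypArea K)) := by
  refine tendsto_of_tendsto_of_tendsto_of_le_of_le tendsto_const_nhds (area_nb_tendsto h.cpt) ?_ ?_
  · exact fun n => hypArea_mono (cpt_opoly h n) (sub_opoly h n)
  · exact fun n => hypArea_mono (isCompact_nb (en_pos n).le h.cpt) (opoly_sub h n)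

lemma TT_sandwich {K L : Set ℍ} (hK : IsCompact K) (hL : IsCompact L) {Q R : ℕ → Set ℍ}
    (h1 : ∀ n, K ⊆ Q n) (h2 : ∀ n, Q n ⊆ nb (en n) K) (h3 : ∀ n, L ⊆ R n) (h4 : ∀ n, R n ⊆ nb (en n) L)
    (hQ : ∀ n, IsCompact (Q n)) (hR : ∀ n, IsCompact (R n)) :
    Tendsto (fun n => (TT (Q n) (R n)).toReal) atTop (𝓝 (TT K L).toReal) := by
  refine tendsto_of_tendsto_of_tendsto_of_le_of_le tendsto_const_nhds (TT_nb_tendsto hK hL) ?_ ?_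
  · exact fun n => TTr_mono (hQ n) (hR n) (h1 n) (h3 n)
  · exact fun n => TTr_mono (isCompact_nb (en_pos n).le hK) (isCompact_nb (en_pos n).le hL) (h2 n) (h4 n)

lemma TT_opoly {K L : Set ℍ} (h : CB K) (h' : CB L) :
    Tendsto (fun n => (TT (opoly h n) (opoly h' n)).toReal) atTop (𝓝 (TT K L).toReal) :=
  TT_sandwich h.cpt h'.cpt (sub_opoly h) (opoly_sub h) (sub_opoly h') (opoly_sub h') (cpt_opoly h)
    (cpt_opoly h')

lemma per_nonneg {ι : Type} [Fintype ι] (l : ι → Lin) : 0 ≤ per l :=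
  Finset.sum_nonneg fun _ _ => Metric.diam_nonneg

lemma exists_kin2 : ∃ γ : ℝ, ∀ (ι ι' : Type) [Fintype ι] [Fintype ι'] (l : ι → Lin) (l' : ι' → Lin),
    GoodPoly l → GoodPoly l' → (TT (poly l) (poly l')).toReal =
      kap * (hypArea (poly l) + hypArea (poly l')) + γ * hypArea (poly l) * hypArea (poly l')
        + cc / 4 * per l * per l' := by
  set h0 := cb_ball I zero_le_one
  have g0 := good_outer h0 0
  set l0 := (fun x : outerS h0 0 => x.1)
  have hA : 0 < hypArea (poly l0) := by
    refine hypArea_pos g0.cpt ⟨I, ?_⟩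
    refine interior_mono (sub_opoly h0 0) ?_
    exact ball_subset_interior_closedBall (mem_ball_self one_pos)
  obtain ⟨β0, -, hβ0⟩ := kin1 g0
  refine ⟨(β0 - kap) / hypArea (poly l0), ?_⟩
  intro ι ι' _ _ l l' h h'
  obtain ⟨β, -, hβ⟩ := kin1 h'
  have k1 := hβ _ l0 g0
  have k2 := hβ0 _ l' h'
  rw [TT_comm] at k2
  have e : β * hypArea (poly l0) = kap * hypArea (poly l0) + (β0 - kap) * hypArea (poly l') := by
    linarith
  have e2 : β = kap + (β0 - kap) / hypArea (poly l0) * hypArea (poly l') := by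
    field_simp; linarith
  rw [hβ _ l h, e2]; ring

noncomputable def gam : ℝ := exists_kin2.choose

lemma kin2 {ι ι' : Type} [Fintype ι] [Fintype ι'] {l : ι → Lin} {l' : ι' → Lin}
    (h : GoodPoly l) (h' : GoodPoly l') : (TT (poly l) (poly l')).toReal =
      kap * (hypArea (poly l) + hypArea (poly l')) + gam * hypArea (poly l) * hypArea (poly l')
        + cc / 4 * per l * per l' := exists_kin2.choose_spec _ _ l l' h h'

lemma kin_opoly {K L : Set ℍ} (h : CB K) (h' : CB L) (n : ℕ) : (TT (opoly h n) (opoly h' n)).toReal =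
      kap * (hypArea (opoly h n) + hypArea (opoly h' n)) + gam * hypArea (opoly h n) * hypArea (opoly h' n)
        + cc / 4 * operi h n * operi h' n := kin2 (good_outer h n) (good_outer h' n)

lemma TT_ball (K : Set ℍ) (hK : IsCompact K) {r : ℝ} (hr : 0 ≤ r) :
    (TT K (closedBall I r)).toReal = kap * hypArea (nb r K) := by
  have : TT K (closedBall I r) = TT (nb r K) {I} := by
    unfold TT
    congr 1; ext g
    change (K ∩ g • closedBall I r).Nonempty ↔ (nb r K ∩ g • ({I} : Set ℍ)).Nonempty
    rw [← nb_singleton, smul_nb, Set.smul_set_singleton, nb_singleton]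
    constructor
    · rintro ⟨z, hz, h⟩
      exact ⟨g • I, ⟨z, hz, h⟩, rfl⟩
    · rintro ⟨z, ⟨w, hw, h⟩, rfl⟩
      exact ⟨w, hw, h⟩
  rw [this, TT_comm, TT_pt _ (isCompact_nb hr hK).measurableSet, ENNReal.toReal_mul,
    ENNReal.toReal_ofReal kap_pos.le]
  rfl

lemma hypArea_seg (p q : ℍ) : hypArea (seg p q) = 0 := by
  unfold hypArea; rw [area_seg]; rfl

lemma cc_pos : 0 < cc := by
  refine lt_of_le_of_ne cc_nonneg fun hc => ?_
  have key : ∀ K L : Set ℍ, CB K → CB L → (TT K L).toReal =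
      kap * (hypArea K + hypArea L) + gam * hypArea K * hypArea L := by
    intro K L h h'
    have h1 := TT_opoly h h'
    simp only [kin_opoly h h', ← hc, zero_div, zero_mul, add_zero] at h1
    exact tendsto_nhds_unique h1 (((((area_opoly h).add (area_opoly h')).const_mul kap)).add
      (((area_opoly h).const_mul gam).mul (area_opoly h')))
  have h1 := key (seg (yi 0) (yi 3)) (closedBall I 1) (cb_seg _ _) (cb_ball I zero_le_one)
  rw [TT_ball _ (isCompact_seg _ _) zero_le_one, hypArea_seg] at h1
  have hA : 0 < hypArea (closedBall I 1) := hypArea_pos (isCompact_closedBall _ _)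
    ⟨I, ball_subset_interior_closedBall (mem_ball_self one_pos)⟩
  have h2 : hypArea (closedBall (yi 0) 1) + hypArea (closedBall (yi 3) 1) ≤
      hypArea (nb 1 (seg (yi 0) (yi 3))) := by
    unfold hypArea
    rw [← ENNReal.toReal_add (area_lt_top (isCompact_closedBall _ _)).ne (area_lt_top (isCompact_closedBall _ _)).ne,
      ← measure_union _ (isCompact_closedBall _ _).measurableSet]
    · refine ENNReal.toReal_mono (area_lt_top (isCompact_nb zero_le_one (isCompact_seg _ _))).ne
        (measure_mono (Set.union_subset ?_ ?_))
      · rw [← nb_singleton]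
        exact nb_mono le_rfl (Set.singleton_subset_iff.2 (left_mem_seg _ _))
      · rw [← nb_singleton]
        exact nb_mono le_rfl (Set.singleton_subset_iff.2 (right_mem_seg _ _))
    · refine closedBall_disjoint_closedBall ?_
      rw [dist_yi]; norm_num
  have h3 : hypArea (closedBall (yi 3) 1) = hypArea (closedBall I 1) := by
    obtain ⟨a, ha⟩ := MulAction.exists_smul_eq SL(2, ℝ) I (yi 3)
    have : closedBall (yi 3) 1 = a • closedBall I 1 := by
      rw [← nb_singleton, ← nb_singleton, smul_nb, Set.smul_set_singleton, ha]
    unfold hypArea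
    rw [this, area_smul a (isCompact_closedBall _ _).measurableSet]
  rw [h3, yi_zero] at h2
  have h4 : kap * hypArea (nb 1 (seg (yi 0) (yi 3))) = kap * hypArea (closedBall I 1) := by
    rw [h1]; ring
  have := mul_left_cancel₀ kap_pos.ne' h4
  rw [yi_zero] at this
  linarith

def s1 : Set ℍ := seg (yi 0) (yi 1)
lemma cb_s1 : CB s1 := cb_seg _ _
lemma area_s1 : hypArea s1 = 0 := hypArea_seg _ _

lemma operi_s1 : Tendsto (operi cb_s1) atTop (𝓝 2) := by
  have h1 := TT_opoly cb_s1 cb_s1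
  have e : (TT s1 s1).toReal = cc := by
    unfold s1; rw [TT_seg, dist_yi]; simp
  rw [e] at h1
  have hA := area_opoly cb_s1
  rw [area_s1] at hA
  have h2 : Tendsto (fun n => operi cb_s1 n ^ 2) atTop (𝓝 4) := by
    have h3 := ((h1.sub ((hA.add hA).const_mul kap)).sub ((hA.const_mul gam).mul hA)).const_mul (4 / cc)
    have hcc := cc_pos
    convert h3 using 2
    · rw [kin_opoly]; field_simp; ring
    · field_simp; ring
  have h4 := h2.sqrt
  have : √(4:ℝ) = 2 := by rw [show (4:ℝ) = 2 ^ 2 by norm_num]; exact Real.sqrt_sq (by norm_num)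
  rw [this] at h4
  refine h4.congr fun n => ?_
  exact Real.sqrt_sq (per_nonneg _)

/-- the kinematic perimeter -/
noncomputable def PT (K : Set ℍ) : ℝ := 2 / cc * ((TT s1 K).toReal - kap * hypArea K)

lemma operi_tendsto {K : Set ℍ} (h : CB K) : Tendsto (operi h) atTop (𝓝 (PT K)) := by
  have h1 := TT_opoly cb_s1 h
  have hA := area_opoly cb_s1
  rw [area_s1] at hA
  have hA' := area_opoly h
  have hP := operi_s1
  have hcc := cc_pos
  have h3 := (((h1.sub ((hA.add hA').const_mul kap)).sub ((hA.const_mul gam).mul hA')).const_mul (4 / cc)).div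
    hP two_ne_zero
  have e : 4 / cc * ((TT s1 K).toReal - kap * (0 + hypArea K) - gam * 0 * hypArea K) / 2 = PT K := by
    unfold PT; field_simp; ring
  rw [e] at h3
  refine h3.congr' ?_
  have h4 : ∀ᶠ n in atTop, 0 < operi cb_s1 n := hP.eventually (lt_mem_nhds two_pos)
  filter_upwards [h4] with n hn
  simp only [Pi.div_apply]
  rw [kin_opoly]; field_simp; ring

theorem kin {K L : Set ℍ} (h : CB K) (h' : CB L) : (TT K L).toReal =
    kap * (hypArea K + hypArea L) + gam * hypArea K * hypArea L + cc / 4 * PT K * PT L := by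
  have h1 := TT_opoly h h'
  simp only [kin_opoly h h'] at h1
  exact tendsto_nhds_unique h1 ((((area_opoly h).add (area_opoly h')).const_mul kap).add
      (((area_opoly h).const_mul gam).mul (area_opoly h')) |>.add
      (((operi_tendsto h).const_mul (cc / 4)).mul (operi_tendsto h')))

lemma PT_poly {ι : Type} [Fintype ι] {l : ι → Lin} (h : GoodPoly l) : PT (poly l) = per l := by
  have h1 := TT_sandwich cb_s1.cpt h.cpt (sub_opoly cb_s1) (opoly_sub cb_s1) (R := fun _ => poly l)
    (fun _ => le_rfl) (fun n => subset_nb (en_pos n).le _) (cpt_opoly cb_s1) (fun _ => h.cpt)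
  have hA := area_opoly cb_s1
  rw [area_s1] at hA
  have h2 : Tendsto (fun n => (TT (opoly cb_s1 n) (poly l)).toReal) atTop
      (𝓝 (kap * (0 + hypArea (poly l)) + gam * 0 * hypArea (poly l) + cc / 4 * 2 * per l)) := by
    have := (((hA.add_const (hypArea (poly l))).const_mul kap).add
      ((hA.const_mul gam).mul_const (hypArea (poly l)))).add
      ((operi_s1.const_mul (cc / 4)).mul_const (per l))
    refine this.congr fun n => ?_
    exact (kin2 (good_outer cb_s1 n) h).symm
  have := tendsto_nhds_unique h1 h2
  unfold PT
  rw [this]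
  have hcc := cc_pos
  field_simp; ring

lemma PT_seg (p q : ℍ) : PT (seg p q) = 2 * dist p q := by
  unfold PT s1
  rw [TT_seg, hypArea_seg, dist_yi]
  have hcc := cc_pos
  field_simp; simp

lemma PT_smul (g : SL(2, ℝ)) {K : Set ℍ} (h : IsCompact K) : PT (g • K) = PT K := by
  unfold PT hypArea
  rw [TT_smul_right, area_smul g h.measurableSet]

lemma PT_nonneg {K : Set ℍ} (h : CB K) : 0 ≤ PT K :=
  ge_of_tendsto (operi_tendsto h) (Eventually.of_forall fun _ => per_nonneg _)

end parto

section partp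

open MeasureTheory Metric Real UpperHalfPlane Filter
open scoped UpperHalfPlane MatrixGroups ENNReal NNReal Topology Pointwise

/-! ### The constants -/

def cone (S a b : ℝ) : Set ℍ := {z | z.re ∈ Set.Icc (-(S * z.im)) (S * z.im) ∧ z.im ∈ Set.Icc a b}

lemma le_of_sq_le_sq' {a b : ℝ} (h : a ^ 2 ≤ b ^ 2) (hb : 0 ≤ b) : a ≤ b :=
  (abs_le.1 (abs_le_of_sq_le_sq h hb)).2

lemma area_cone {S a b : ℝ} (hS : 0 ≤ S) (ha : 0 < a) (hab : a ≤ b) :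
    hypAreaMeasure (cone S a b) = ENNReal.ofReal (2 * S * Real.log (b / a)) := by
  have hSm : MeasurableSet {p : ℝ × ℝ | p.1 ∈ Set.Icc (-(S * p.2)) (S * p.2) ∧ p.2 ∈ Set.Icc a b} := by
    have c1 : IsClosed {p : ℝ × ℝ | -(S * p.2) ≤ p.1} := isClosed_le (by fun_prop) (by fun_prop)
    have c2 : IsClosed {p : ℝ × ℝ | p.1 ≤ S * p.2} := isClosed_le (by fun_prop) (by fun_prop)
    have c3 : IsClosed {p : ℝ × ℝ | a ≤ p.2} := isClosed_le (by fun_prop) (by fun_prop)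
    have c4 : IsClosed {p : ℝ × ℝ | p.2 ≤ b} := isClosed_le (by fun_prop) (by fun_prop)
    exact ((c1.inter c2).inter (c3.inter c4)).measurableSet
  have h := area_formula hSm
  have e : cone S a b = {z : ℍ | (z.re, z.im) ∈
    {p : ℝ × ℝ | p.1 ∈ Set.Icc (-(S * p.2)) (S * p.2) ∧ p.2 ∈ Set.Icc a b}} := rfl
  rw [e, h]
  have h2 : ∀ y ∈ Set.Ioi (0:ℝ), ENNReal.ofReal ((y ^ 2)⁻¹) *
      volume {x : ℝ | (x, y) ∈ {p : ℝ × ℝ | p.1 ∈ Set.Icc (-(S * p.2)) (S * p.2) ∧ p.2 ∈ Set.Icc a b}} =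
      (Set.Icc a b).indicator (fun y => ENNReal.ofReal (2 * S * y⁻¹)) y := by
    intro y hy
    have hy : 0 < y := hy
    by_cases hyab : y ∈ Set.Icc a b
    · rw [Set.indicator_of_mem hyab]
      have : {x : ℝ | (x, y) ∈ {p : ℝ × ℝ | p.1 ∈ Set.Icc (-(S * p.2)) (S * p.2) ∧ p.2 ∈ Set.Icc a b}} =
          Set.Icc (-(S * y)) (S * y) := by
        ext x; exact ⟨fun h => h.1, fun h => ⟨h, hyab⟩⟩
      rw [this, Real.volume_Icc, ← ENNReal.ofReal_mul (by positivity)]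
      congr 1
      field_simp; ring
    · rw [Set.indicator_of_notMem hyab]
      have : {x : ℝ | (x, y) ∈ {p : ℝ × ℝ | p.1 ∈ Set.Icc (-(S * p.2)) (S * p.2) ∧ p.2 ∈ Set.Icc a b}} = ∅ := by
        ext x; exact ⟨fun h => hyab h.2, fun h => h.elim⟩
      rw [this]; simp
  rw [setLIntegral_congr_fun measurableSet_Ioi h2, lintegral_indicator measurableSet_Icc,
    Measure.restrict_restrict measurableSet_Icc]
  have h3 : Set.Icc a b ∩ Set.Ioi 0 = Set.Icc a b :=
    Set.inter_eq_left.2 fun y hy => lt_of_lt_of_le ha hy.1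
  rw [h3]
  have hc : ContinuousOn (fun y : ℝ => 2 * S * y⁻¹) (Set.Icc a b) :=
    continuousOn_const.mul (continuousOn_inv₀.mono fun y hy => (lt_of_lt_of_le ha hy.1).ne')
  rw [← ofReal_integral_eq_lintegral_ofReal (hc.integrableOn_Icc)]
  · congr 1
    rw [integral_Icc_eq_integral_Ioc, ← intervalIntegral.integral_of_le hab,
      intervalIntegral.integral_const_mul, integral_inv_of_pos ha (ha.trans_le hab)]
  · refine (ae_restrict_iff' measurableSet_Icc).2 (Eventually.of_forall fun y hy => ?_)
    have : 0 < y := lt_of_lt_of_le ha hy.1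
    simp only [Pi.zero_apply]; positivity

lemma hypArea_cone {S a b : ℝ} (hS : 0 ≤ S) (ha : 0 < a) (hab : a ≤ b) :
    hypArea (cone S a b) = 2 * S * Real.log (b / a) := by
  unfold hypArea
  rw [area_cone hS ha hab, ENNReal.toReal_ofReal]
  have := Real.log_nonneg ((one_le_div ha).2 hab)
  positivity

lemma nb_sub_cone {r ℓ : ℝ} (hr : 0 ≤ r) (hl : 0 ≤ ℓ) :
    nb r (seg (yi 0) (yi ℓ)) ⊆ cone (sinh r) (exp (-r)) (exp (ℓ + r)) := by
  rintro z ⟨w, hw, hd⟩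
  rw [seg_yi hl] at hw
  obtain ⟨t, ht, rfl⟩ := hw
  have hi := z.im_pos
  refine ⟨?_, ?_, ?_⟩
  · have h1 := cosh_dist_mul (yi t) z
    rw [yi_nq, yi_re, yi_im] at h1
    have h2 : cosh (dist (yi t) z) ≤ cosh r := by
      rw [Real.cosh_le_cosh, abs_of_nonneg dist_nonneg, abs_of_nonneg hr]; exact hd
    have he := exp_pos t
    have e2 : exp (2 * t) = exp t ^ 2 := by rw [← Real.exp_nat_mul]; push_cast; ring_nf
    have h3 : nq z = z.re ^ 2 + z.im ^ 2 := rfl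
    have h4 : exp t ^ 2 + nq z ≤ cosh r * (2 * exp t * z.im) := by
      rw [e2] at h1
      have := mul_le_mul_of_nonneg_right h2 (show 0 ≤ 2 * exp t * z.im by positivity)
      linarith
    have hcs := Real.cosh_sq r
    have h5 : z.re ^ 2 ≤ (sinh r * z.im) ^ 2 := by
      have : (exp t - cosh r * z.im) ^ 2 + z.re ^ 2 ≤ (sinh r * z.im) ^ 2 := by
        have : (cosh r * z.im) ^ 2 = (sinh r ^ 2 + 1) * z.im ^ 2 := by rw [mul_pow, hcs]
        nlinarith
      nlinarith [sq_nonneg (exp t - cosh r * z.im)]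
    exact abs_le.1 (abs_le_of_sq_le_sq h5 (mul_nonneg (Real.sinh_nonneg_iff.2 hr) hi.le))
  · have h1 := im_le_im_mul_exp_dist (yi t) z
    rw [yi_im] at h1
    have h2 : exp t ≤ z.im * exp r := h1.trans (by gcongr)
    have h3 : 1 ≤ exp t := Real.one_le_exp ht.1
    rw [Real.exp_neg, inv_le_iff_one_le_mul₀ (exp_pos r)]
    linarith
  · have h1 := im_le_im_mul_exp_dist z (yi t)
    rw [yi_im, dist_comm] at h1
    refine h1.trans ?_
    rw [← Real.exp_add]
    exact exp_le_exp.2 (by linarith [ht.2])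

lemma cone_sub_nb {r ℓ : ℝ} (hr : 0 ≤ r) (hl : 0 ≤ ℓ) :
    cone (sinh r) 1 (exp ℓ / cosh r) ⊆ nb r (seg (yi 0) (yi ℓ)) := by
  rintro z ⟨hx, hy1, hy2⟩
  have hi := z.im_pos
  have hC := Real.cosh_pos r
  have hcs := Real.cosh_sq r
  have hxs : z.re ^ 2 ≤ (sinh r * z.im) ^ 2 := sq_le_sq' (by linarith [hx.1]) hx.2
  have h3 : nq z = z.re ^ 2 + z.im ^ 2 := rfl
  have hn := nq_pos z
  rw [le_div_iff₀ hC] at hy2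
  have h4 : nq z ≤ (z.im * cosh r) ^ 2 := by rw [h3, mul_pow, hcs]; nlinarith
  have h5 : nq z ≤ exp ℓ ^ 2 := h4.trans (by gcongr)
  have h6 : 1 ≤ nq z := by nlinarith [sq_nonneg z.re]
  set t := Real.log (nq z) / 2 with ht
  have ht0 : 0 ≤ t := by have := Real.log_nonneg h6; positivity
  have he : exp t ^ 2 = nq z := by
    rw [← Real.exp_nat_mul, ht]; push_cast
    rw [show 2 * (Real.log (nq z) / 2) = Real.log (nq z) by ring, Real.exp_log hn]
  have htl : t ≤ ℓ := by
    rw [← exp_le_exp]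
    exact le_of_sq_le_sq' (by rw [he]; exact h5) (exp_pos _).le
  refine ⟨yi t, by rw [seg_yi hl]; exact ⟨t, ⟨ht0, htl⟩, rfl⟩, ?_⟩
  have h1 := cosh_dist_mul (yi t) z
  have e2 : exp (2 * t) = exp t ^ 2 := by rw [← Real.exp_nat_mul]; push_cast; ring_nf
  rw [yi_nq, yi_re, yi_im, e2, he] at h1
  have hp := exp_pos t
  have h7 : exp t ≤ z.im * cosh r :=
    le_of_sq_le_sq' (by rw [he]; exact h4) (by positivity)
  have h8 : cosh (dist (yi t) z) ≤ cosh r := by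
    have : cosh (dist (yi t) z) * (2 * exp t * z.im) ≤ cosh r * (2 * exp t * z.im) := by
      rw [h1, ← he]; nlinarith
    exact le_of_mul_le_mul_right this (by positivity)
  rwa [Real.cosh_le_cosh, abs_of_nonneg dist_nonneg, abs_of_nonneg hr] at h8

lemma eq_of_lin {x y M N L₀ : ℝ} (h1 : ∀ ℓ ≥ L₀, x * ℓ ≤ y * ℓ + M) (h2 : ∀ ℓ ≥ L₀, y * ℓ ≤ x * ℓ + N) : x = y := by
  have key : ∀ {x y M L₀ : ℝ}, (∀ ℓ ≥ L₀, x * ℓ ≤ y * ℓ + M) → x ≤ y := by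
    intro x y M L₀ h
    by_contra hc
    push Not at hc
    have hd : 0 < x - y := by linarith
    have := h (max L₀ ((M + 1) / (x - y))) (le_max_left _ _)
    have h3 := le_max_right L₀ ((M + 1) / (x - y))
    rw [div_le_iff₀ hd] at h3
    nlinarith
  exact le_antisymm (key h1) (key h2)

/-- area of the disc -/
noncomputable def da (r : ℝ) : ℝ := hypArea (closedBall I r)

lemma steiner0 {K : Set ℍ} (h : CB K) {r : ℝ} (hr : 0 ≤ r) :
    kap * hypArea (nb r K) = kap * (hypArea K + da r) + gam * hypArea K * da r +
      cc / 4 * PT K * PT (closedBall I r) := by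
  rw [← TT_ball K h.cpt hr, kin h (cb_ball I hr)]; rfl

lemma PT_ball0 {r : ℝ} (hr : 0 ≤ r) : cc / 4 * PT (closedBall I r) = kap * sinh r := by
  have hk := kap_pos
  have key : ∀ ℓ, 0 ≤ ℓ → hypArea (nb r (seg (yi 0) (yi ℓ))) =
      da r + cc / (2 * kap) * PT (closedBall I r) * ℓ := by
    intro ℓ hl
    have := steiner0 (cb_seg (yi 0) (yi ℓ)) hr
    rw [hypArea_seg, PT_seg, dist_yi, zero_sub, abs_neg, abs_of_nonneg hl] at this
    field_simp
    linear_combination 2 * this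
  have hS : 0 ≤ sinh r := Real.sinh_nonneg_iff.2 hr
  have hC := Real.one_le_cosh r
  have hlC := Real.log_nonneg hC
  have : cc / (2 * kap) * PT (closedBall I r) = 2 * sinh r := by
    refine eq_of_lin (L₀ := Real.log (cosh r)) (M := 2 * sinh r * (2 * r) - da r)
      (N := da r + 2 * sinh r * Real.log (cosh r)) ?_ ?_
    · intro ℓ hl
      have hl0 : 0 ≤ ℓ := hlC.trans hl
      have hcp : IsCompact (closure (cone (sinh r) (exp (-r)) (exp (ℓ + r)))) ∨ True := Or.inr trivial
      have h1 : hypArea (nb r (seg (yi 0) (yi ℓ))) ≤ hypArea (cone (sinh r) (exp (-r)) (exp (ℓ + r))) := by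
        refine ENNReal.toReal_mono ?_ (measure_mono (nb_sub_cone hr hl0))
        rw [area_cone hS (exp_pos _) (exp_le_exp.2 (by linarith))]
        exact ENNReal.ofReal_ne_top
      rw [key ℓ hl0, hypArea_cone hS (exp_pos _) (exp_le_exp.2 (by linarith)), ← Real.exp_sub, Real.log_exp] at h1
      linarith
    · intro ℓ hl
      have hl0 : 0 ≤ ℓ := hlC.trans hl
      have h1 := hypArea_mono ((cb_seg (yi 0) (yi ℓ)).nb hr).cpt (cone_sub_nb hr hl0)
      have h0 : 1 ≤ exp ℓ / cosh r := by
        rw [one_le_div (by linarith), ← Real.exp_log (show 0 < cosh r by linarith)]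
        exact exp_le_exp.2 hl
      rw [key ℓ hl0, hypArea_cone hS one_pos h0, div_one, Real.log_div (exp_pos _).ne' (by linarith), Real.log_exp] at h1
      linarith
  field_simp at this
  linear_combination this / 4

lemma steiner1 {K : Set ℍ} (h : CB K) {r : ℝ} (hr : 0 ≤ r) :
    hypArea (nb r K) = hypArea K + da r + gam / kap * hypArea K * da r + PT K * sinh r := by
  have h1 := steiner0 h hr
  have h2 := PT_ball0 hr
  have hk := kap_pos
  have : kap * hypArea (nb r K) = kap * (hypArea K + da r + gam / kap * hypArea K * da r + PT K * sinh r) := by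
    rw [h1]; field_simp; linear_combination 4 * PT K * h2
  exact mul_left_cancel₀ hk.ne' this

lemma nb_ball {r s : ℝ} (hr : 0 ≤ r) (hs : 0 ≤ s) : nb s (closedBall I r) = closedBall I (r + s) := by
  rw [← nb_singleton, ← nb_singleton, nb_nb hr hs]

lemma da_add {r s : ℝ} (hr : 0 ≤ r) (hs : 0 ≤ s) : da (r + s) = da r + da s + gam / kap * da r * da s +
    4 * kap / cc * sinh r * sinh s := by
  have h1 := steiner1 (cb_ball I hr) hs
  rw [nb_ball hr hs] at h1
  have h2 := PT_ball0 hr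
  have hcc := cc_pos
  have : PT (closedBall I r) = 4 * kap / cc * sinh r := by field_simp; linear_combination 4 * h2
  rw [this] at h1
  exact h1

lemma da_bounds {r : ℝ} (hr : 0 ≤ r) : π * sinh r ^ 2 * exp (-(2 * r)) ≤ da r ∧ da r ≤ π * sinh r ^ 2 * exp (2 * r) := by
  have hS : 0 ≤ sinh r := Real.sinh_nonneg_iff.2 hr
  have e1 := area_complex (isCompact_closedBall (I : ℍ) r).measurableSet
  rw [image_coe_closedBall] at e1
  have hms : MeasurableSet (closedBall ((I : ℍ).center r : ℂ) (I.im * sinh r)) := measurableSet_closedBall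
  have hv : volume (closedBall ((I : ℍ).center r : ℂ) (I.im * sinh r)) = ENNReal.ofReal (π * sinh r ^ 2) := by
    rw [Complex.volume_closedBall, UpperHalfPlane.I_im, one_mul, mul_comm, ← ENNReal.ofReal_pow hS,
      ← ENNReal.ofReal_coe_nnreal, ← ENNReal.ofReal_mul NNReal.zero_le_coe]
    rfl
  have him : ∀ w ∈ closedBall ((I : ℍ).center r : ℂ) (I.im * sinh r), 0 < w.im ∧ w.im ≤ exp r ∧ exp (-r) ≤ w.im := by
    intro w hw
    rw [← image_coe_closedBall] at hw
    obtain ⟨z, hz, rfl⟩ := hw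
    rw [mem_closedBall] at hz
    have h1 := im_le_im_mul_exp_dist z I
    have h2 := im_le_im_mul_exp_dist I z
    rw [UpperHalfPlane.I_im] at h1 h2
    rw [dist_comm] at h2
    have h3 : exp (dist z I) ≤ exp r := exp_le_exp.2 hz
    have hi := z.im_pos
    refine ⟨hi, by simpa using h1.trans (by linarith), ?_⟩
    rw [Real.exp_neg, inv_le_iff_one_le_mul₀ (exp_pos r)]
    exact h2.trans (by simpa using mul_le_mul_of_nonneg_left h3 hi.le)
  have ep : exp (2 * r) = exp r ^ 2 := by rw [← Real.exp_nat_mul]; push_cast; ring_nf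
  have en' : exp (-(2 * r)) = (exp r ^ 2)⁻¹ := by rw [← ep, Real.exp_neg]
  have fin := area_lt_top (isCompact_closedBall (I : ℍ) r)
  constructor
  · have : ENNReal.ofReal (π * sinh r ^ 2 * exp (-(2 * r))) ≤ hypAreaMeasure (closedBall I r) := by
      rw [e1, mul_comm, ENNReal.ofReal_mul (by positivity), ← hv, ← setLIntegral_const]
      refine setLIntegral_mono' hms fun w hw => ENNReal.ofReal_le_ofReal ?_
      obtain ⟨h1, h2, h3⟩ := him w hw
      rw [en']; gcongr
    exact (ENNReal.ofReal_le_iff_le_toReal fin.ne).1 this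
  · have : hypAreaMeasure (closedBall I r) ≤ ENNReal.ofReal (π * sinh r ^ 2 * exp (2 * r)) := by
      rw [e1, mul_comm (π * sinh r ^ 2), ENNReal.ofReal_mul (by positivity), ← hv, ← setLIntegral_const]
      refine setLIntegral_mono' hms fun w hw => ENNReal.ofReal_le_ofReal ?_
      obtain ⟨h1, h2, h3⟩ := him w hw
      have : exp (2 * r) = (exp (-r) ^ 2)⁻¹ := by rw [ep, Real.exp_neg, inv_pow, inv_inv]
      rw [this]
      have := exp_pos (-r)
      gcongr
    exact ENNReal.toReal_le_of_le_ofReal (by positivity) this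

lemma da_form : ∃ k, ∀ r, 0 ≤ r → gam / kap * da r = cosh r - 1 + k * sinh r := by
  have hs1 : 0 < sinh 1 := Real.sinh_pos_iff.2 one_pos
  have hk := kap_pos
  have hcc := cc_pos
  refine ⟨(gam / kap * da 1 - cosh 1 + 1) / sinh 1, fun r hr => ?_⟩
  have a1 := da_add (add_nonneg hr zero_le_one) zero_le_one (r := r + 1) (s := 1)
  have a2 := da_add hr (by norm_num : (0:ℝ) ≤ 1 + 1)
  rw [← add_assoc] at a2
  rw [a2] at a1
  rw [da_add zero_le_one zero_le_one, da_add hr zero_le_one, Real.sinh_add, Real.sinh_add] at a1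
  set G := gam / kap
  set c := 4 * kap / cc with hc
  have hc0 : c ≠ 0 := by positivity
  have : c * sinh 1 * (sinh r * (G * da 1 - cosh 1 + 1)) = c * sinh 1 * (sinh 1 * (G * da r - cosh r + 1)) := by
    linear_combination -a1
  have h2 := mul_left_cancel₀ (by positivity) this
  field_simp
  linear_combination -h2

lemma consts : gam / kap = 1 / (2 * π) ∧ (∀ r, 0 ≤ r → da r = 2 * π * (cosh r - 1)) ∧ 4 * kap / cc = 2 * π := by
  obtain ⟨k, hk⟩ := da_form
  set G := gam / kap
  have hpi := Real.pi_pos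
  -- da r / sinh r ^ 2 tends to π
  have t1 : Tendsto (fun r => da r / sinh r ^ 2) (𝓝[>] 0) (𝓝 π) := by
    have l1 : Tendsto (fun r : ℝ => π * exp (-(2 * r))) (𝓝[>] 0) (𝓝 π) := by
      have : Continuous (fun r : ℝ => π * exp (-(2 * r))) := by fun_prop
      simpa using (this.tendsto 0).mono_left nhdsWithin_le_nhds
    have l2 : Tendsto (fun r : ℝ => π * exp (2 * r)) (𝓝[>] 0) (𝓝 π) := by
      have : Continuous (fun r : ℝ => π * exp (2 * r)) := by fun_prop
      simpa using (this.tendsto 0).mono_left nhdsWithin_le_nhds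
    refine tendsto_of_tendsto_of_tendsto_of_le_of_le' l1 l2 ?_ ?_
    · filter_upwards [self_mem_nhdsWithin] with r hr
      have hr : 0 < r := hr
      have hs := Real.sinh_pos_iff.2 hr
      rw [le_div_iff₀ (by positivity)]
      linarith [(da_bounds hr.le).1]
    · filter_upwards [self_mem_nhdsWithin] with r hr
      have hr : 0 < r := hr
      have hs := Real.sinh_pos_iff.2 hr
      rw [div_le_iff₀ (by positivity)]
      linarith [(da_bounds hr.le).2]
  have ts : Tendsto (fun r : ℝ => sinh r) (𝓝[>] 0) (𝓝 0) := by
    simpa using (Real.continuous_sinh.tendsto 0).mono_left nhdsWithin_le_nhds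
  have tc : Tendsto (fun r : ℝ => (cosh r + 1)⁻¹) (𝓝[>] 0) (𝓝 (1 / 2)) := by
    have : Continuous (fun r : ℝ => (cosh r + 1)⁻¹) :=
      (Real.continuous_cosh.add continuous_const).inv₀ fun r => (by linarith [Real.cosh_pos r] : cosh r + 1 ≠ 0) |> fun h => h
    have h := (this.tendsto 0).mono_left (nhdsWithin_le_nhds (s := Set.Ioi 0))
    convert h using 2; norm_num
  have e : ∀ᶠ r in 𝓝[>] (0:ℝ), k = G * (da r / sinh r ^ 2) * sinh r - (cosh r + 1)⁻¹ * sinh r := by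
    filter_upwards [self_mem_nhdsWithin] with r hr
    have hr : 0 < r := hr
    have hs := Real.sinh_pos_iff.2 hr
    have h1 := hk r hr.le
    have h2 : (cosh r + 1)⁻¹ * sinh r = (cosh r - 1) / sinh r := by
      have := Real.cosh_pos r
      rw [inv_mul_eq_div, div_eq_div_iff (by positivity) hs.ne']
      linear_combination -(Real.cosh_sq r)
    rw [h2]
    field_simp
    linear_combination -h1
  have hk0 : k = 0 := by
    have := ((t1.const_mul G).mul ts).sub (tc.mul ts)
    have h3 := tendsto_nhds_unique (tendsto_const_nhds.congr' e) this
    simpa using h3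
  subst hk0
  have hG : G * π = 1 / 2 := by
    refine tendsto_nhds_unique (t1.const_mul G) (tc.congr' ?_)
    filter_upwards [self_mem_nhdsWithin] with r hr
    have hr : 0 < r := hr
    have hs := Real.sinh_pos_iff.2 hr
    have h1 := hk r hr.le
    have := Real.cosh_pos r
    rw [← mul_div_assoc, h1, inv_eq_one_div, div_eq_div_iff (by positivity) (by positivity)]
    linear_combination -(Real.cosh_sq r)
  have hG' : G = 1 / (2 * π) := by field_simp; linear_combination 2 * hG
  have hda : ∀ r, 0 ≤ r → da r = 2 * π * (cosh r - 1) := by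
    intro r hr
    have h1 := hk r hr
    rw [hG'] at h1
    field_simp at h1
    linear_combination h1
  refine ⟨hG', hda, ?_⟩
  have a := da_add zero_le_one zero_le_one
  have e1 : cosh (1 + 1) = 1 + 2 * sinh 1 ^ 2 := by
    rw [Real.cosh_add]; linear_combination Real.cosh_sq 1
  rw [hda _ (by norm_num), hda _ (by norm_num), e1] at a
  change _ = _ + _ + G * _ * _ + _ at a
  have hs1 : 0 < sinh 1 := Real.sinh_pos_iff.2 one_pos
  have hcc := cc_pos
  rw [hG'] at a
  field_simp at a
  field_simp
  have h0 : sinh 1 ^ 2 * (4 * kap - cc * (2 * π)) = 0 := by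
    linear_combination (Real.cosh_sq 1) * (-(2 * π * cc)) - a
  have := (mul_eq_zero.1 h0).resolve_left (by positivity)
  linear_combination this

lemma cc_eq : cc = 2 * kap / π := by
  have := consts.2.2
  have hcc := cc_pos
  have := Real.pi_pos
  field_simp at *
  linarith

lemma gam_eq : gam = kap / (2 * π) := by
  have := consts.1
  have := kap_pos
  have := Real.pi_pos
  field_simp at *
  linarith

theorem kin_final {K L : Set ℍ} (h : CB K) (h' : CB L) : 2 * π * (TT K L).toReal =
    kap * (2 * π * (hypArea K + hypArea L) + hypArea K * hypArea L + PT K * PT L) := by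
  rw [kin h h', cc_eq, gam_eq]
  have := Real.pi_pos
  field_simp
  ring

theorem steiner {K : Set ℍ} (h : CB K) {r : ℝ} (hr : 0 ≤ r) :
    hypArea (nb r K) = hypArea K * cosh r + PT K * sinh r + 2 * π * (cosh r - 1) := by
  rw [steiner1 h hr, consts.1, consts.2.1 r hr]
  have := Real.pi_pos
  field_simp
  ring

theorem PT_nb {K : Set ℍ} (h : CB K) {r : ℝ} (hr : 0 ≤ r) :
    PT (nb r K) = PT K * cosh r + (2 * π + hypArea K) * sinh r := by
  have h1 := steiner (h.nb hr) zero_le_one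
  rw [nb_nb hr zero_le_one, steiner h (by positivity), steiner h hr, Real.cosh_add, Real.sinh_add] at h1
  have hs1 : 0 < sinh 1 := Real.sinh_pos_iff.2 one_pos
  have : PT (nb r K) * sinh 1 = (PT K * cosh r + (2 * π + hypArea K) * sinh r) * sinh 1 := by
    linear_combination -h1
  exact mul_right_cancel₀ hs1.ne' this

lemma PT_mono {K L : Set ℍ} (h : CB K) (h' : CB L) (hKL : K ⊆ L) : PT K ≤ PT L := by
  have key : ∀ {K : Set ℍ}, CB K → ∀ ℓ, 0 ≤ ℓ → 2 * π * (TT (seg (yi 0) (yi ℓ)) K).toReal =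
      kap * (2 * π * hypArea K + 2 * ℓ * PT K) := by
    intro K h ℓ hl
    rw [kin_final (cb_seg _ _) h, hypArea_seg, PT_seg, dist_yi, zero_sub, abs_neg, abs_of_nonneg hl]; ring
  by_contra hc
  push Not at hc
  have hk := kap_pos
  have hpi := Real.pi_pos
  have hA := hypArea_nonneg L
  set d := PT K - PT L with hd
  have hd0 : 0 < d := by linarith
  set ℓ := (π * hypArea L + 1) / d with hl
  have hl0 : 0 < ℓ := by positivity
  have h1 := TTr_mono (isCompact_seg (yi 0) (yi ℓ)) h'.cpt le_rfl hKL
  have h2 := mul_le_mul_of_nonneg_left h1 (show 0 ≤ 2 * π by positivity)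
  rw [key h ℓ hl0.le, key h' ℓ hl0.le] at h2
  have h3 := le_of_mul_le_mul_left h2 hk
  have h4 : ℓ * d = π * hypArea L + 1 := by rw [hl]; field_simp
  have hA' := hypArea_nonneg K
  nlinarith [mul_nonneg hpi.le hA']

end partp

section partq

open MeasureTheory Metric Real UpperHalfPlane Filter
open scoped UpperHalfPlane MatrixGroups ENNReal NNReal Topology Pointwise

/-! ### Projection onto the edges of an inscribed polygon -/

noncomputable def lq (z : ℍ) : ℝ := Real.log (nq z) / 2

lemma exp_lq (z : ℍ) : exp (lq z) ^ 2 = nq z := by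
  rw [← Real.exp_nat_mul, lq]; push_cast
  rw [show 2 * (Real.log (nq z) / 2) = Real.log (nq z) by ring, Real.exp_log (nq_pos z)]

lemma exp_two (t : ℝ) : exp (2 * t) = exp t ^ 2 := by rw [← Real.exp_nat_mul]; push_cast; ring_nf

lemma foot_near {z w : ℍ} (h : z.re * w.re ≤ 0) (hd : dist z w ≤ dist z (yi (lq z))) : w = yi (lq z) := by
  have h1 := cosh_dist_mul z (yi (lq z))
  have h2 := cosh_dist_mul z w
  rw [yi_nq, yi_re, yi_im, exp_two, exp_lq] at h1
  have h3 : cosh (dist z w) ≤ cosh (dist z (yi (lq z))) := (cosh_le_nonneg dist_nonneg dist_nonneg).2 hd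
  have hz := z.im_pos
  have hw := w.im_pos
  have hr := exp_pos (lq z)
  have he := exp_lq z
  set ρ := exp (lq z)
  have h4 : cosh (dist z (yi (lq z))) * z.im = ρ := by
    have : (cosh (dist z (yi (lq z))) * z.im) * (2 * ρ) = ρ * (2 * ρ) := by rw [← he] at h1; linarith
    exact mul_right_cancel₀ (by positivity) this
  have h5 : cosh (dist z w) * z.im ≤ ρ := by rw [← h4]; gcongr
  have h6 : nq z + nq w - 2 * z.re * w.re ≤ 2 * ρ * w.im := by
    rw [← h2]; nlinarith
  have h7 : nq w = w.re ^ 2 + w.im ^ 2 := rfl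
  have h8 : (ρ - w.im) ^ 2 + w.re ^ 2 ≤ 0 := by nlinarith
  have h9 : w.re = 0 := by nlinarith [sq_nonneg (ρ - w.im), sq_nonneg w.re]
  have h10 : ρ - w.im = 0 := by nlinarith [sq_nonneg (ρ - w.im), sq_nonneg w.re]
  refine UpperHalfPlane.ext_re_im ?_ ?_
  · rw [h9, yi_re]
  · rw [yi_im]; linarith

lemma lq_lip (z w : ℍ) : |lq z - lq w| ≤ dist z w := by
  rw [← cosh_le_nonneg (abs_nonneg _) dist_nonneg, Real.cosh_abs]
  have h2 := cosh_dist_mul z w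
  have hz := z.im_pos
  have hw := w.im_pos
  have e1 := exp_lq z
  have e2 := exp_lq w
  have p1 := exp_pos (lq z)
  have p2 := exp_pos (lq w)
  rw [Real.cosh_eq, neg_sub, Real.exp_sub, Real.exp_sub]
  set a := exp (lq z)
  set b := exp (lq w)
  have n1 : nq z = z.re ^ 2 + z.im ^ 2 := rfl
  have n2 : nq w = w.re ^ 2 + w.im ^ 2 := rfl
  have h3 : (a / b + b / a) / 2 = (a ^ 2 + b ^ 2) / (2 * a * b) := by field_simp
  rw [h3, div_le_iff₀ (by positivity)]
  -- key inequality
  have h4 : z.re * w.re + z.im * w.im ≤ a * b := by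
    refine abs_le_of_sq_le_sq' ?_ (by positivity) |>.2
    rw [mul_pow, e1, e2, n1, n2]; nlinarith [sq_nonneg (z.re * w.im - z.im * w.re)]
  have h5 : (a ^ 2 + b ^ 2) * (z.im * w.im) ≤ (a ^ 2 + b ^ 2 - 2 * z.re * w.re) * (a * b) := by
    have h6 : -(z.re * w.re) + z.im * w.im ≤ a * b := by
      refine abs_le_of_sq_le_sq' ?_ (by positivity) |>.2
      rw [mul_pow, e1, e2, n1, n2]; nlinarith [sq_nonneg (z.re * w.im + z.im * w.re)]
    have h7 : 2 * (a * b) ≤ a ^ 2 + b ^ 2 := by nlinarith [sq_nonneg (a - b)]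
    have hab : 0 < a * b := by positivity
    nlinarith [mul_nonneg (sub_nonneg.2 h7) (sub_nonneg.2 h4), mul_nonneg (sub_nonneg.2 h7) (sub_nonneg.2 h6),
      mul_nonneg hab.le (sub_nonneg.2 h4), mul_nonneg hab.le (sub_nonneg.2 h6)]
  rw [← e1, ← e2] at h2
  have : (a ^ 2 + b ^ 2) * (2 * z.im * w.im) ≤ (cosh (dist z w) * (2 * a * b)) * (2 * z.im * w.im) := by
    have : (cosh (dist z w) * (2 * a * b)) * (2 * z.im * w.im) =
      (cosh (dist z w) * (2 * z.im * w.im)) * (2 * a * b) := by ring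
    rw [this, h2]; linarith
  exact le_of_mul_le_mul_right this (by positivity)

lemma meets_frontier {X : Type*} [TopologicalSpace X] {t s : Set X} (ht : IsPreconnected t) (hs : IsClosed s)
    (h1 : (t ∩ s).Nonempty) (h2 : (t ∩ sᶜ).Nonempty) : (t ∩ frontier s).Nonempty := by
  by_contra hc
  rw [Set.not_nonempty_iff_eq_empty] at hc
  have hf : ∀ x ∈ t, x ∉ frontier s := fun x hx hxf => Set.notMem_empty x (hc ▸ ⟨hx, hxf⟩)
  have hin : ∀ x ∈ t, x ∈ s → x ∈ interior s := by
    intro x hx hxs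
    by_contra hxi
    exact hf x hx ⟨subset_closure hxs, hxi⟩
  obtain ⟨x, hx1, hx2, hx3⟩ := ht (interior s) sᶜ isOpen_interior hs.isOpen_compl
    (fun x hx => (em (x ∈ s)).imp (hin x hx) id) (h1.imp fun x hx => ⟨hx.1, hin x hx.1 hx.2⟩) h2
  exact hx3 (interior_subset hx2)

/-- standard position of an edge -/
structure StdEdge {ι : Type} (l : ι → Lin) (i : ι) (h : SL(2, ℝ)) (ℓ c : ℝ) : Prop where
  pos : 0 < ℓ
  c0 : c ≠ 0
  pl : pull h (l i) = (0, c, 0)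
  ed : edge l i = h • seg (yi 0) (yi ℓ)

lemma exists_stdEdge {ι : Type} {l : ι → Lin} (hl : GoodPoly l) (i : ι) (hd : 0 < diam (edge l i)) :
    ∃ h c, StdEdge l i h (diam (edge l i)) c := by
  have hne : (edge l i).Nonempty := by
    rw [Set.nonempty_iff_ne_empty]; intro h; rw [h] at hd; simp at hd
  obtain ⟨p, q, e⟩ := eq_seg_of_line (isCompact_edge hl.cpt i) (cconv_edge l i) hne (hl.ne0 i) (fun z hz => hz.2)
  obtain ⟨h, h1, h2⟩ := exists_std p q
  have hdd : diam (edge l i) = dist p q := by rw [e, diam_seg]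
  have hp : ev (l i) (h • yi 0) = 0 := by rw [h1]; exact (e ▸ left_mem_seg p q : p ∈ edge l i).2
  have hq : ev (l i) (h • yi (dist p q)) = 0 := by rw [h2]; exact (e ▸ right_mem_seg p q : q ∈ edge l i).2
  rw [hdd] at hd
  obtain ⟨a1, a2⟩ := pull_axis hd.ne hp hq
  refine ⟨h, (pull h (l i)).2.1, ?_⟩
  rw [hdd]
  refine ⟨hd, ?_, ?_, by rw [smul_seg, h1, h2, e]⟩
  · intro h0
    exact pull_ne0 h (hl.ne0 i) (Prod.ext a1 (Prod.ext h0 a2))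
  · exact Prod.ext a1 (Prod.ext rfl a2)

lemma StdEdge.mem {ι : Type} {l : ι → Lin} {i : ι} {h : SL(2, ℝ)} {ℓ c : ℝ} (S : StdEdge l i h ℓ c) {t : ℝ}
    (h0 : 0 ≤ t) (h1 : t ≤ ℓ) : h • yi t ∈ edge l i := by
  rw [S.ed, seg_yi S.pos.le]
  exact Set.smul_mem_smul_set ⟨t, ⟨h0, h1⟩, rfl⟩

lemma StdEdge.ev_eq {ι : Type} {l : ι → Lin} {i : ι} {h : SL(2, ℝ)} {ℓ c : ℝ} (S : StdEdge l i h ℓ c) (z : ℍ) :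
    c * (h⁻¹ • z).re = den h (h⁻¹ • z) * ev (l i) z := by
  have := ev_pull h (l i) (h⁻¹ • z)
  rw [S.pl, smul_inv_smul] at this
  rw [← this]; simp [ev]

/-- the part of the frontier which projects on the edge -/
def Spart {ι : Type} (l : ι → Lin) (i : ι) (h : SL(2, ℝ)) (ℓ : ℝ) (K : Set ℍ) : Set ℍ :=
  {z | z ∈ frontier K ∧ ev (l i) z ≤ 0 ∧ 0 < lq (h⁻¹ • z) ∧ lq (h⁻¹ • z) < ℓ}

lemma continuous_lq : Continuous lq := (continuous_nq.log fun z => (nq_pos z).ne').div_const 2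

lemma measurableSet_Spart {ι : Type} (l : ι → Lin) (i : ι) (h : SL(2, ℝ)) (ℓ : ℝ) (K : Set ℍ) :
    MeasurableSet (Spart l i h ℓ K) := by
  have hc : Continuous fun z : ℍ => lq (h⁻¹ • z) := continuous_lq.comp (continuous_smul_const h⁻¹)
  refine isClosed_frontier.measurableSet.inter ((isClosed_le (continuous_ev (l i)) continuous_const).measurableSet.inter
    ((isOpen_lt continuous_const hc).measurableSet.inter (isOpen_lt hc continuous_const).measurableSet))

lemma Spart_ge {ι : Type} {l : ι → Lin} {i : ι} {h : SL(2, ℝ)} {ℓ c : ℝ} (S : StdEdge l i h ℓ c) {K : Set ℍ}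
    (hK : IsCompact K) (hQ : poly l ⊆ K) : ENNReal.ofReal ℓ ≤ μH[1] (Spart l i h ℓ K) := by
  have hsurj : Set.Ioo 0 ℓ ⊆ (fun z : ℍ => lq (h⁻¹ • z)) '' Spart l i h ℓ K := by
    intro t ht
    -- a far point on the perpendicular
    have hx : ∃ w : ℍ, h • w ∉ K ∧ nq w = exp (2 * t) ∧ c * w.re ≤ 0 := by
      by_contra hcon
      push Not at hcon
      have hK' : IsCompact (h⁻¹ • K) := hK.smul h⁻¹
      obtain ⟨m, hm0, hm⟩ : ∃ m > 0, ∀ w ∈ h⁻¹ • K, m ≤ w.im := by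
        have hne : (h⁻¹ • K).Nonempty := ⟨_, Set.smul_mem_smul_set (hQ (S.mem le_rfl S.pos.le).1)⟩
        obtain ⟨w, hw, hmin⟩ := hK'.exists_isMinOn hne UpperHalfPlane.continuous_im.continuousOn
        exact ⟨w.im, w.im_pos, fun z hz => hmin hz⟩
      set y := min (m / 2) (exp t / 2) with hy
      have hy0 : 0 < y := by have := exp_pos t; positivity
      have hyt : y ≤ exp t / 2 := min_le_right _ _
      have hym : y < m := (min_le_left _ _).trans_lt (by linarith)
      have e1 : y ^ 2 ≤ exp (2 * t) := by rw [exp_two]; have := exp_pos t; nlinarith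
      have key : ∀ x : ℝ, x ^ 2 = exp (2 * t) - y ^ 2 → c * x ≤ 0 → False := by
        intro x hx hcx
        let w : ℍ := ⟨⟨x, y⟩, hy0⟩
        have hn : nq w = exp (2 * t) := by change x ^ 2 + y ^ 2 = _; linarith
        by_cases hin : h • w ∈ K
        · have := hm w (by rw [Set.mem_smul_set_iff_inv_smul_mem, inv_inv]; exact hin)
          change m ≤ y at this; linarith
        · exact absurd hcx (not_le.2 (hcon w hin hn))
      have hs : √(exp (2 * t) - y ^ 2) ^ 2 = exp (2 * t) - y ^ 2 := Real.sq_sqrt (by linarith)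
      have hs0 := Real.sqrt_nonneg (exp (2 * t) - y ^ 2)
      rcases le_total c 0 with h0 | h0
      · exact key _ hs (mul_nonpos_of_nonpos_of_nonneg h0 hs0)
      · exact key (-√(exp (2 * t) - y ^ 2)) (by rw [neg_sq]; exact hs) (by nlinarith)
    obtain ⟨w, hw1, hw2, hw3⟩ := hx
    have hin : h • yi t ∈ K := hQ (S.mem ht.1.le ht.2.le).1
    obtain ⟨z, hz1, hz2⟩ := meets_frontier ((isPreconnected_seg (yi t) w).image (fun z => h • z)
      (continuous_smul_const h).continuousOn) hK.isClosed
      ⟨_, ⟨_, left_mem_seg _ _, rfl⟩, hin⟩ ⟨_, ⟨_, right_mem_seg _ _, rfl⟩, hw1⟩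
    obtain ⟨_, ⟨s, hs, rfl⟩, rfl⟩ := hz1
    have hnq : lq (h⁻¹ • h • cmb (yi t) w s) = t := by
      rw [inv_smul_smul, lq, cmb_nq _ _ hs.1 hs.2, yi_nq, hw2,
        show (1 - s) * exp (2 * t) + s * exp (2 * t) = exp (2 * t) by ring, Real.log_exp]; ring
    refine ⟨_, ⟨hz2, ?_, ?_⟩, hnq⟩
    · have := S.ev_eq (h • cmb (yi t) w s)
      rw [inv_smul_smul, cmb_re _ _ hs.1 hs.2, yi_re] at this
      have hd := den_pos h (cmb (yi t) w s)
      have h2 : c * ((1 - s) * 0 + s * w.re) ≤ 0 := by nlinarith [hs.1]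
      rw [this] at h2
      exact nonpos_of_mul_nonpos_right h2 hd
    · rw [hnq]; exact ht
  have hl : LipschitzOnWith 1 (fun z : ℍ => lq (h⁻¹ • z)) (Spart l i h ℓ K) := by
    refine LipschitzWith.lipschitzOnWith (LipschitzWith.of_dist_le_mul fun z w => ?_)
    rw [Real.dist_eq]
    refine (lq_lip _ _).trans ?_
    rw [dist_smul]; simp
  have h3 := hl.hausdorffMeasure_image_le (d := 1) zero_le_one
  simp only [ENNReal.coe_one, ENNReal.one_rpow, one_mul] at h3
  refine le_trans ?_ h3
  refine le_trans ?_ (measure_mono hsurj)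
  rw [hausdorffMeasure_real, Real.volume_Ioo, sub_zero]

lemma foot_edge {ι : Type} {l : ι → Lin} (hl : GoodPoly l) {i j : ι} (hij : i ≠ j) {h : SL(2, ℝ)} {ℓ c : ℝ}
    (S : StdEdge l i h ℓ c) {t : ℝ} (h0 : 0 < t) (h1 : t < ℓ) (he : h • yi t ∈ edge l j) : False := by
  have f0 := (S.mem le_rfl S.pos.le)
  have f1 := (S.mem S.pos.le le_rfl)
  have a0 := (ev_pull_nonneg h (l j) _).2 (f0.1 j)
  have a1 := (ev_pull_nonneg h (l j) _).2 (f1.1 j)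
  have a2 := (ev_pull_zero h (l j) _).2 he.2
  unfold ev at a0 a1 a2
  rw [yi_re, yi_nq] at a0 a1 a2
  have e0 : exp (2 * 0) < exp (2 * t) := exp_lt_exp.2 (by linarith)
  have e1 : exp (2 * t) < exp (2 * ℓ) := exp_lt_exp.2 (by linarith)
  have hA : (pull h (l j)).1 = 0 := by
    rcases lt_trichotomy (pull h (l j)).1 0 with hA | hA | hA
    · nlinarith
    · exact hA
    · nlinarith
  have hC : (pull h (l j)).2.2 = 0 := by rw [hA] at a2; linarith
  have z0 : ev (l j) (h • yi 0) = 0 := by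
    rw [← ev_pull_zero]; unfold ev; rw [hA, hC, yi_re]; ring
  have z1 : ev (l j) (h • yi ℓ) = 0 := by
    rw [← ev_pull_zero]; unfold ev; rw [hA, hC, yi_re]; ring
  have := line_inter_unique (hl.ind i j hij) f0.2 z0 f1.2 z1
  have h3 := smul_left_cancel h this
  have h4 := dist_yi 0 ℓ
  rw [h3, dist_self, zero_sub, abs_neg, abs_of_pos S.pos] at h4
  exact S.pos.ne h4

lemma Spart_disj {ι : Type} {l : ι → Lin} (hl : GoodPoly l) {i j : ι} (hij : i ≠ j) {h h' : SL(2, ℝ)} {ℓ c ℓ' c' : ℝ}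
    (S : StdEdge l i h ℓ c) (S' : StdEdge l j h' ℓ' c') (K : Set ℍ) :
    Disjoint (Spart l i h ℓ K) (Spart l j h' ℓ' K) := by
  rw [Set.disjoint_left]
  rintro z ⟨_, h2, h3, h4⟩ ⟨_, h2', h3', h4'⟩
  have key : ∀ {i j : ι} {h h' : SL(2, ℝ)} {ℓ c ℓ' c' : ℝ} (S : StdEdge l i h ℓ c) (S' : StdEdge l j h' ℓ' c'),
      ev (l i) z ≤ 0 → ev (l j) z ≤ 0 → 0 < lq (h'⁻¹ • z) → lq (h'⁻¹ • z) < ℓ' →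
      dist z (h' • yi (lq (h'⁻¹ • z))) ≤ dist z (h • yi (lq (h⁻¹ • z))) →
      h' • yi (lq (h'⁻¹ • z)) = h • yi (lq (h⁻¹ • z)) := by
    intro i j h h' ℓ c ℓ' c' S S' h2 h2' h3' h4' hd
    set w := h' • yi (lq (h'⁻¹ • z)) with hw
    have hwp : 0 ≤ ev (l i) w := (S'.mem h3'.le h4'.le).1 i
    have e1 := S.ev_eq z
    have e2 := S.ev_eq w
    have d1 := den_pos h (h⁻¹ • z)
    have d2 := den_pos h (h⁻¹ • w)
    have b1 : c * (h⁻¹ • z).re ≤ 0 := by rw [e1]; nlinarith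
    have b2 : 0 ≤ c * (h⁻¹ • w).re := by rw [e2]; positivity
    have hc2 : 0 < c ^ 2 := by have := S.c0; positivity
    have b3 : (h⁻¹ • z).re * (h⁻¹ • w).re ≤ 0 := by
      have : c ^ 2 * ((h⁻¹ • z).re * (h⁻¹ • w).re) ≤ 0 := by
        nlinarith [mul_nonneg (neg_nonneg.2 b1) b2]
      exact nonpos_of_mul_nonpos_right this hc2
    have := foot_near b3 (by
      rw [dist_smul]
      have : dist (h⁻¹ • z) (yi (lq (h⁻¹ • z))) = dist z (h • yi (lq (h⁻¹ • z))) := by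
        conv_lhs => rw [← dist_smul h, smul_inv_smul]
      rw [this]; exact hd)
    rw [← this, smul_inv_smul]
  have he : h • yi (lq (h⁻¹ • z)) ∈ edge l j := by
    rcases le_total (dist z (h' • yi (lq (h'⁻¹ • z)))) (dist z (h • yi (lq (h⁻¹ • z)))) with hd | hd
    · rw [← key S S' h2 h2' h3' h4' hd]; exact S'.mem h3'.le h4'.le
    · rw [key S' S h2' h2 h3 h4 hd]; exact S'.mem h3'.le h4'.le
  exact foot_edge hl hij S h3 h4 he

theorem per_le {ι : Type} [Fintype ι] {l : ι → Lin} (hl : GoodPoly l) {K : Set ℍ} (hK : IsCompact K)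
    (hQ : poly l ⊆ K) : ENNReal.ofReal (per l) ≤ μH[1] (frontier K) := by
  classical
  set s : Finset ι := Finset.univ.filter fun i => 0 < diam (edge l i) with hs
  have hsum : per l = ∑ i ∈ s, diam (edge l i) := by
    unfold per
    symm
    refine Finset.sum_subset (Finset.subset_univ _) fun i _ hi => ?_
    rw [hs, Finset.mem_filter] at hi
    push Not at hi
    exact le_antisymm (hi (Finset.mem_univ _)) diam_nonneg
  have hex : ∀ i, ∃ h c, i ∈ s → StdEdge l i h (diam (edge l i)) c := by
    intro i
    by_cases hi : i ∈ s
    · obtain ⟨h, c, H⟩ := exists_stdEdge hl i (Finset.mem_filter.1 hi).2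
      exact ⟨h, c, fun _ => H⟩
    · exact ⟨1, 0, fun h => absurd h hi⟩
  choose h c H using hex
  rw [hsum, ENNReal.ofReal_sum_of_nonneg fun _ _ => diam_nonneg]
  calc ∑ i ∈ s, ENNReal.ofReal (diam (edge l i))
      ≤ ∑ i ∈ s, μH[1] (Spart l i (h i) (diam (edge l i)) K) :=
        Finset.sum_le_sum fun i hi => Spart_ge (H i hi) hK hQ
    _ = μH[1] (⋃ i ∈ s, Spart l i (h i) (diam (edge l i)) K) := by
        rw [measure_biUnion_finset]
        · intro i hi j hj hij
          exact Spart_disj hl hij (H i hi) (H j hj) K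
        · exact fun i _ => measurableSet_Spart _ _ _ _ _
    _ ≤ μH[1] (frontier K) := measure_mono (Set.iUnion₂_subset fun i _ z hz => hz.1)

end partq

section partr

open MeasureTheory Metric Real UpperHalfPlane Filter
open scoped UpperHalfPlane MatrixGroups ENNReal NNReal Topology Pointwise

/-! ### The chart as an open embedding, gauges -/

noncomputable def chm (o z : ℍ) : ℝ × ℝ := (z.re - o.re, nq z - nq o)

open Classical in
noncomputable def ichm (o : ℍ) (p : ℝ × ℝ) : ℍ :=
  if h : (p.1 + o.re) ^ 2 < p.2 + nq o then mkz _ _ h else o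

lemma ichm_chm (o z : ℍ) : ichm o (chm o z) = z := by
  unfold ichm chm
  have : (z.re - o.re + o.re) ^ 2 < nq z - nq o + nq o := by simpa using nq_gt z
  rw [dif_pos this]
  refine ch_ext ?_ ?_
  · rw [mkz_re]; ring
  · rw [mkz_nq]; ring

lemma chm_inj (o : ℍ) : Function.Injective (chm o) := fun z w h => by
  rw [← ichm_chm o z, h, ichm_chm]

lemma continuous_chm (o : ℍ) : Continuous (chm o) :=
  (UpperHalfPlane.continuous_re.sub continuous_const).prodMk (continuous_nq.sub continuous_const)

def chR (o : ℍ) : Set (ℝ × ℝ) := {p | (p.1 + o.re) ^ 2 < p.2 + nq o}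

lemma isOpen_chR (o : ℍ) : IsOpen (chR o) := isOpen_lt (by fun_prop) (by fun_prop)

lemma chm_mem (o z : ℍ) : chm o z ∈ chR o := by
  change (z.re - o.re + o.re) ^ 2 < nq z - nq o + nq o
  simpa using nq_gt z

lemma chm_ichm {o : ℍ} {p : ℝ × ℝ} (h : p ∈ chR o) : chm o (ichm o p) = p := by
  have h' : (p.1 + o.re) ^ 2 < p.2 + nq o := h
  unfold ichm chm
  rw [dif_pos h', mkz_re, mkz_nq]
  refine Prod.ext ?_ ?_ <;> simp

lemma continuousOn_ichm (o : ℍ) : ContinuousOn (ichm o) (chR o) := by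
  rw [UpperHalfPlane.isEmbedding_coe.continuousOn_iff]
  have h1 : ContinuousOn (fun p : ℝ × ℝ => ((p.1 + o.re : ℝ) : ℂ) + (√(p.2 + nq o - (p.1 + o.re) ^ 2) : ℝ) * Complex.I)
      (chR o) := by
    refine Continuous.continuousOn ?_
    fun_prop
  refine h1.congr fun p hp => ?_
  simp only [Function.comp]
  have hp' : (p.1 + o.re) ^ 2 < p.2 + nq o := hp
  unfold ichm
  rw [dif_pos hp']
  apply Complex.ext
  · simp; rfl
  · simp; rfl

lemma isOpenMap_chm (o : ℍ) : IsOpenMap (chm o) := by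
  intro U hU
  have : chm o '' U = chR o ∩ ichm o ⁻¹' U := by
    ext p
    constructor
    · rintro ⟨z, hz, rfl⟩
      exact ⟨chm_mem o z, by rw [Set.mem_preimage, ichm_chm]; exact hz⟩
    · rintro ⟨h1, h2⟩
      exact ⟨_, h2, chm_ichm h1⟩
  rw [this]
  exact (continuousOn_ichm o).isOpen_inter_preimage (isOpen_chR o) hU

lemma chm_self (o : ℍ) : chm o o = 0 := by simp [chm]

lemma chm_cmb (o p q : ℍ) {t : ℝ} (h0 : 0 ≤ t) (h1 : t ≤ 1) :
    chm o (cmb p q t) = (1 - t) • chm o p + t • chm o q := by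
  unfold chm
  rw [cmb_re _ _ h0 h1, cmb_nq _ _ h0 h1]
  refine Prod.ext ?_ ?_ <;> simp <;> ring

lemma convex_chm {K : Set ℍ} (h : CConv K) (o : ℍ) : Convex ℝ (chm o '' K) := by
  rintro _ ⟨p, hp, rfl⟩ _ ⟨q, hq, rfl⟩ a b ha hb hab
  have e : a = 1 - b := by linarith
  subst e
  exact ⟨cmb p q b, h p hp q hq b hb (by linarith), chm_cmb o p q hb (by linarith)⟩

lemma chm_interior {K : Set ℍ} (o z : ℍ) : chm o z ∈ interior (chm o '' K) ↔ z ∈ interior K := by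
  constructor
  · intro h
    refine mem_interior.2 ⟨chm o ⁻¹' interior (chm o '' K), ?_, isOpen_interior.preimage (continuous_chm o), h⟩
    intro w hw
    obtain ⟨w', hw', e⟩ := interior_subset hw
    rwa [← chm_inj o e]
  · intro h
    exact (isOpenMap_chm o).image_interior_subset K ⟨z, h, rfl⟩

noncomputable def G (o : ℍ) (K : Set ℍ) (v : ℝ × ℝ) : ℝ := gauge (chm o '' K) v


lemma cpt_chm {K : Set ℍ} (h : CB K) (o : ℍ) : IsCompact (chm o '' K) := h.cpt.image (continuous_chm o)

lemma nhd_chm {K : Set ℍ} {o : ℍ} (ho : o ∈ interior K) : chm o '' K ∈ 𝓝 (0 : ℝ × ℝ) := by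
  rw [← chm_self o, ← mem_interior_iff_mem_nhds, chm_interior]; exact ho

lemma G_le {K : Set ℍ} (h : CB K) {o : ℍ} (ho : o ∈ interior K) (v : ℝ × ℝ) : G o K v ≤ 1 ↔ v ∈ chm o '' K := by
  unfold G
  rw [gauge_le_one_iff_mem_closure (convex_chm h.cv o) (nhd_chm ho), (cpt_chm h o).isClosed.closure_eq]

lemma G_mem {K : Set ℍ} (h : CB K) {o : ℍ} (ho : o ∈ interior K) (z : ℍ) : G o K (chm o z) ≤ 1 ↔ z ∈ K := by
  rw [G_le h ho]; exact (chm_inj o).mem_set_image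

lemma G_front {K : Set ℍ} (h : CB K) {o : ℍ} (ho : o ∈ interior K) (z : ℍ) :
    G o K (chm o z) = 1 ↔ z ∈ frontier K := by
  unfold G
  rw [gauge_eq_one_iff_mem_frontier (convex_chm h.cv o) (nhd_chm ho), (cpt_chm h o).isClosed.frontier_eq,
    h.cpt.isClosed.frontier_eq]
  simp only [Set.mem_sdiff]
  rw [chm_interior, (chm_inj o).mem_set_image]

lemma G_cont {K : Set ℍ} (h : CB K) {o : ℍ} (ho : o ∈ interior K) : Continuous (G o K) :=
  continuous_gauge (convex_chm h.cv o) (nhd_chm ho)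

lemma G_pos {K : Set ℍ} (h : CB K) {o : ℍ} (ho : o ∈ interior K) {v : ℝ × ℝ} (hv : v ≠ 0) : 0 < G o K v := by
  refine (gauge_pos (absorbent_nhds_zero (nhd_chm ho)) ?_).2 hv
  exact (NormedSpace.isVonNBounded_of_isBounded ℝ (cpt_chm h o).isBounded)

lemma G_smul (o : ℍ) (K : Set ℍ) {a : ℝ} (ha : 0 ≤ a) (v : ℝ × ℝ) : G o K (a • v) = a * G o K v :=
  gauge_smul_of_nonneg ha v


noncomputable def ud (θ : ℝ) : ℝ × ℝ := (Real.cos θ, Real.sin θ)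

lemma ud_ne (θ : ℝ) : ud θ ≠ 0 := by
  intro h
  have h1 : Real.cos θ = 0 := congrArg Prod.fst h
  have h2 : Real.sin θ = 0 := congrArg Prod.snd h
  have := Real.sin_sq_add_cos_sq θ
  rw [h1, h2] at this; norm_num at this

lemma continuous_ud : Continuous ud := Real.continuous_cos.prodMk Real.continuous_sin

lemma polar {v : ℝ × ℝ} (hv : v ≠ 0) : ∃ r : ℝ, 0 < r ∧ ∃ θ ∈ Set.Icc (-π) π, v = r • ud θ := by
  set w : ℂ := ⟨v.1, v.2⟩ with hw
  have hw0 : w ≠ 0 := by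
    intro h
    apply hv
    exact Prod.ext (congrArg Complex.re h) (congrArg Complex.im h)
  refine ⟨‖w‖, norm_pos_iff.2 hw0, w.arg, ⟨(Complex.neg_pi_lt_arg w).le, Complex.arg_le_pi w⟩, ?_⟩
  refine Prod.ext ?_ ?_
  · change v.1 = ‖w‖ * Real.cos w.arg
    rw [Complex.norm_mul_cos_arg]
  · change v.2 = ‖w‖ * Real.sin w.arg
    rw [Complex.norm_mul_sin_arg]

/-- boundary point in direction θ -/
noncomputable def bp (o : ℍ) (K : Set ℍ) (θ : ℝ) : ℝ × ℝ := (G o K (ud θ))⁻¹ • ud θ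

lemma G_bp {K : Set ℍ} (h : CB K) {o : ℍ} (ho : o ∈ interior K) (θ : ℝ) : G o K (bp o K θ) = 1 := by
  have := G_pos h ho (ud_ne θ)
  rw [bp, G_smul _ _ (by positivity)]; field_simp

lemma bp_mem {K : Set ℍ} (h : CB K) {o : ℍ} (ho : o ∈ interior K) (θ : ℝ) : bp o K θ ∈ chm o '' K :=
  (G_le h ho _).1 (G_bp h ho θ).le

lemma frontier_bp {K : Set ℍ} (h : CB K) {o : ℍ} (ho : o ∈ interior K) {z : ℍ} (hz : z ∈ frontier K) :
    ∃ θ ∈ Set.Icc (-π) π, chm o z = bp o K θ := by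
  have h1 := (G_front h ho z).2 hz
  have hv : chm o z ≠ 0 := by
    intro h0; rw [h0] at h1
    have : G o K 0 = 0 := gauge_zero
    rw [this] at h1; norm_num at h1
  obtain ⟨r, hr, θ, hθ, e⟩ := polar hv
  refine ⟨θ, hθ, ?_⟩
  rw [e, G_smul _ _ hr.le] at h1
  rw [e, bp, eq_inv_of_mul_eq_one_left h1]

lemma bp_lip {K : Set ℍ} (h : CB K) {o : ℍ} (ho : o ∈ interior K) :
    ∃ C : ℝ, 0 ≤ C ∧ ∀ θ ∈ Set.Icc (-π) π, ∀ φ ∈ Set.Icc (-π) π, dist (bp o K θ) (bp o K φ) ≤ C * |θ - φ| := by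
  obtain ⟨L, hL⟩ := (convex_chm h.cv o).lipschitz_gauge (nhd_chm ho)
  obtain ⟨m, hm0, hm⟩ : ∃ m > 0, ∀ θ ∈ Set.Icc (-π) π, m ≤ G o K (ud θ) := by
    obtain ⟨θ, hθ, hmin⟩ := isCompact_Icc.exists_isMinOn (s := Set.Icc (-π) π)
      ⟨0, by constructor <;> linarith [Real.pi_pos]⟩ ((G_cont h ho).comp continuous_ud).continuousOn
    exact ⟨_, G_pos h ho (ud_ne θ), fun φ hφ => hmin hφ⟩
  have hud : ∀ θ φ, ‖ud θ - ud φ‖ ≤ |θ - φ| := by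
    intro θ φ
    rw [Prod.norm_def]
    exact max_le (Real.abs_cos_sub_cos_le θ φ) (Real.abs_sin_sub_sin_le θ φ)
  have hud1 : ∀ θ, ‖ud θ‖ ≤ 1 := by
    intro θ
    rw [Prod.norm_def]
    exact max_le (Real.abs_cos_le_one θ) (Real.abs_sin_le_one θ)
  refine ⟨L / m ^ 2 + 1 / m, by positivity, fun θ hθ φ hφ => ?_⟩
  have a1 := hm θ hθ
  have a2 := hm φ hφ
  have hG : |G o K (ud φ) - G o K (ud θ)| ≤ L * |θ - φ| := by
    have := hL.dist_le_mul (ud φ) (ud θ)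
    rw [Real.dist_eq, dist_eq_norm, norm_sub_rev] at this
    exact this.trans (mul_le_mul_of_nonneg_left (hud θ φ) L.2)
  set a := G o K (ud θ) with ha
  set b := G o K (ud φ) with hb
  have e : bp o K θ - bp o K φ = (a⁻¹ - b⁻¹) • ud θ + b⁻¹ • (ud θ - ud φ) := by
    unfold bp; rw [← ha, ← hb]; module
  have ap : 0 < a := hm0.trans_le a1
  have bpp : 0 < b := hm0.trans_le a2
  rw [dist_eq_norm, e]
  refine (norm_add_le _ _).trans ?_
  rw [norm_smul, norm_smul, add_mul]
  refine add_le_add ?_ ?_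
  · have e1 : ‖a⁻¹ - b⁻¹‖ ≤ L * |θ - φ| / m ^ 2 := by
      rw [Real.norm_eq_abs, inv_sub_inv ap.ne' bpp.ne', abs_div, abs_of_pos (mul_pos ap bpp)]
      refine div_le_div₀ (by positivity) hG (by positivity) ?_
      nlinarith
    calc _ ≤ L * |θ - φ| / m ^ 2 * 1 := mul_le_mul e1 (hud1 θ) (norm_nonneg _) (by positivity)
      _ = _ := by ring
  · have e1 : ‖b⁻¹‖ ≤ 1 / m := by
      rw [Real.norm_eq_abs, abs_of_pos (by positivity), one_div]; gcongr
    exact mul_le_mul e1 (hud θ φ) (norm_nonneg _) (by positivity)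

lemma ichm_lip {K : Set ℍ} (hK : IsCompact K) (o : ℍ) :
    ∃ C : ℝ, 0 ≤ C ∧ ∀ z ∈ K, ∀ w ∈ K, dist z w ≤ C * dist (chm o z) (chm o w) := by
  rcases K.eq_empty_or_nonempty with rfl | hne
  · exact ⟨0, le_rfl, by simp⟩
  obtain ⟨m, hm0, hm⟩ : ∃ m > 0, ∀ w ∈ K, m ≤ w.im := by
    obtain ⟨w, hw, hmin⟩ := hK.exists_isMinOn hne UpperHalfPlane.continuous_im.continuousOn
    exact ⟨w.im, w.im_pos, fun z hz => hmin hz⟩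
  obtain ⟨R, hR⟩ : ∃ R, ∀ w ∈ K, |w.re| ≤ R := by
    obtain ⟨w, hw, hmax⟩ := hK.exists_isMaxOn hne UpperHalfPlane.continuous_re.abs.continuousOn
    exact ⟨|w.re|, fun z hz => hmax hz⟩
  have hR0 : 0 ≤ R := by obtain ⟨w, hw⟩ := hne; exact (abs_nonneg _).trans (hR w hw)
  refine ⟨(1 + (1 + 2 * R) / (2 * m)) / m, by positivity, fun z hz w hw => ?_⟩
  set D := dist (chm o z) (chm o w) with hD
  have d1 : |z.re - w.re| ≤ D := by
    have := le_max_left (dist (chm o z).1 (chm o w).1) (dist (chm o z).2 (chm o w).2)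
    rw [← Prod.dist_eq, Real.dist_eq] at this
    have e : (chm o z).1 - (chm o w).1 = z.re - w.re := by simp [chm]
    rw [e] at this; exact this
  have d2 : |nq z - nq w| ≤ D := by
    have := le_max_right (dist (chm o z).1 (chm o w).1) (dist (chm o z).2 (chm o w).2)
    rw [← Prod.dist_eq, Real.dist_eq] at this
    have e : (chm o z).2 - (chm o w).2 = nq z - nq w := by simp [chm]
    rw [e] at this; exact this
  have hD0 : 0 ≤ D := dist_nonneg
  have mz := hm z hz
  have mw := hm w hw
  have e1 : |z.im - w.im| * (2 * m) ≤ D * (1 + 2 * R) := by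
    have e2 : (z.im - w.im) * (z.im + w.im) = (nq z - nq w) - (z.re - w.re) * (z.re + w.re) := by unfold nq; ring
    have e3 : |z.im - w.im| * (z.im + w.im) ≤ D + D * (2 * R) := by
      rw [← abs_of_pos (show 0 < z.im + w.im by linarith), ← abs_mul, e2]
      refine (abs_sub _ _).trans (add_le_add d2 ?_)
      rw [abs_mul]
      refine mul_le_mul d1 ?_ (abs_nonneg _) hD0
      exact (abs_add_le _ _).trans (by linarith [hR z hz, hR w hw])
    nlinarith [abs_nonneg (z.im - w.im)]
  have e2 : dist (z : ℂ) w ≤ D + D * (1 + 2 * R) / (2 * m) := by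
    rw [Complex.dist_eq]
    refine (Complex.norm_le_abs_re_add_abs_im _).trans (add_le_add ?_ ?_)
    · simpa using d1
    · rw [le_div_iff₀ (by positivity)]; simpa using e1
  have e3 : m ≤ √(z.im * w.im) := Real.le_sqrt_of_sq_le (by nlinarith)
  refine (UpperHalfPlane.dist_le_dist_coe_div_sqrt z w).trans ?_
  calc _ ≤ (D + D * (1 + 2 * R) / (2 * m)) / m := div_le_div₀ (by positivity) e2 hm0 e3
    _ = _ := by ring

theorem perim_lt_top {K : Set ℍ} (h : CB K) (hi : (interior K).Nonempty) : μH[1] (frontier K) < ∞ := by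
  obtain ⟨o, ho⟩ := hi
  obtain ⟨C1, c1, H1⟩ := bp_lip h ho
  obtain ⟨C2, c2, H2⟩ := ichm_lip h.cpt o
  have hin : ∀ θ, ichm o (bp o K θ) ∈ K ∧ chm o (ichm o (bp o K θ)) = bp o K θ := by
    intro θ
    obtain ⟨z, hz, e⟩ := bp_mem h ho θ
    rw [← e, ichm_chm]; exact ⟨hz, rfl⟩
  have hl : LipschitzOnWith (C2 * C1).toNNReal (fun θ => ichm o (bp o K θ)) (Set.Icc (-π) π) := by
    refine LipschitzOnWith.of_dist_le_mul fun θ hθ φ hφ => ?_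
    rw [Real.coe_toNNReal _ (by positivity), Real.dist_eq, mul_assoc]
    refine (H2 _ (hin θ).1 _ (hin φ).1).trans ?_
    rw [(hin θ).2, (hin φ).2]
    exact mul_le_mul_of_nonneg_left (H1 θ hθ φ hφ) c2
  have hsub : frontier K ⊆ (fun θ => ichm o (bp o K θ)) '' Set.Icc (-π) π := by
    intro z hz
    obtain ⟨θ, hθ, e⟩ := frontier_bp h ho hz
    exact ⟨θ, hθ, by simp only; rw [← e, ichm_chm]⟩
  refine (measure_mono hsub).trans_lt ((hl.hausdorffMeasure_image_le zero_le_one).trans_lt ?_)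
  rw [hausdorffMeasure_real, Real.volume_Icc, ENNReal.rpow_one]
  exact ENNReal.mul_lt_top ENNReal.coe_lt_top ENNReal.ofReal_lt_top

/-! ### shrinking -/

lemma shrink_int {K : Set ℍ} (h : CB K) {o w : ℍ} (ho : o ∈ interior K) (hw : w ∈ K) {t : ℝ} (h0 : 0 ≤ t) (h1 : t < 1) :
    cmb o w t ∈ interior K := by
  rw [← chm_interior o, chm_cmb _ _ _ h0 h1.le]
  exact (convex_chm h.cv o).combo_interior_self_mem_interior ((chm_interior o o).2 ho) ⟨w, hw, rfl⟩
    (by linarith) h0 (by ring)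

lemma cmb_eq_ichm (o w : ℍ) {t : ℝ} (h0 : 0 ≤ t) (h1 : t ≤ 1) : cmb o w t = ichm o (t • chm o w) := by
  rw [← ichm_chm o (cmb o w t), chm_cmb _ _ _ h0 h1, chm_self, smul_zero, zero_add]

lemma shrink_cb {K : Set ℍ} (h : CB K) {o : ℍ} (ho : o ∈ K) {t : ℝ} (h0 : 0 ≤ t) (h1 : t ≤ 1) :
    CB ((fun w => cmb o w t) '' K) := by
  refine ⟨h.cpt.image ?_, ?_, h.ne.image _⟩
  · have : (fun w => cmb o w t) = fun w => ichm o (t • chm o w) := funext fun w => cmb_eq_ichm o w h0 h1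
    rw [this, ← continuousOn_univ]
    refine (continuousOn_ichm o).comp ((continuous_chm o).const_smul t).continuousOn ?_
    intro w _
    have := chm_mem o (cmb o w t)
    rwa [chm_cmb _ _ _ h0 h1, chm_self, smul_zero, zero_add] at this
  · rintro _ ⟨p, hp, rfl⟩ _ ⟨q, hq, rfl⟩ s s0 s1
    refine ⟨cmb p q s, h.cv p hp q hq s s0 s1, chm_inj o ?_⟩
    simp only
    rw [chm_cmb _ _ _ h0 h1, chm_cmb _ _ _ s0 s1, chm_cmb _ _ _ s0 s1, chm_cmb _ _ _ h0 h1, chm_cmb _ _ _ h0 h1]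
    module

lemma shrink_close {K : Set ℍ} (h : CB K) {o : ℍ} {δ : ℝ} (hδ : 0 < δ) :
    ∃ t, 0 ≤ t ∧ t < 1 ∧ ∀ w ∈ K, dist (cmb o w t) w < δ := by
  have key : ∀ᶠ t in 𝓝 (1:ℝ), ∀ w ∈ K, dist (ichm o (t • chm o w)) w < δ := by
    refine h.cpt.eventually_forall_of_forall_eventually fun w _ => ?_
    have hc : ContinuousAt (fun z : ℝ × ℍ => dist (ichm o (z.1 • chm o z.2)) z.2) (1, w) := by
      refine Filter.Tendsto.dist (f := fun z : ℝ × ℍ => ichm o (z.1 • chm o z.2)) ?_ continuousAt_snd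
      refine ContinuousAt.comp (f := fun z : ℝ × ℍ => z.1 • chm o z.2) (g := ichm o) ?_ ?_
      · refine (continuousOn_ichm o).continuousAt ((isOpen_chR o).mem_nhds ?_)
        simpa using chm_mem o w
      · exact (continuous_fst.smul ((continuous_chm o).comp continuous_snd)).continuousAt
    refine hc.eventually (gt_mem_nhds ?_)
    simpa [ichm_chm] using hδ
  have h2 : ∀ᶠ t in 𝓝[<] (1:ℝ), (∀ w ∈ K, dist (ichm o (t • chm o w)) w < δ) ∧ 0 < t ∧ t < 1 :=
    (key.filter_mono nhdsWithin_le_nhds).and (((lt_mem_nhds one_pos).filter_mono nhdsWithin_le_nhds).and self_mem_nhdsWithin)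
  obtain ⟨t, h3, h4, h5⟩ := h2.exists
  exact ⟨t, h4.le, h5, fun w hw => by rw [cmb_eq_ichm o w h4.le h5.le]; exact h3 w hw⟩

theorem PT_le {K : Set ℍ} (h : CB K) (hi : (interior K).Nonempty) : PT K ≤ hypPerim K := by
  have hfin := perim_lt_top h hi
  obtain ⟨o, ho⟩ := hi
  have key : ∀ δ > 0, PT K ≤ hypPerim K * cosh δ + (2 * π + hypArea K) * sinh δ := by
    intro δ hδ
    obtain ⟨t, t0, t1, ht⟩ := shrink_close h (o := o) hδ
    have hcb := shrink_cb h (interior_subset ho) t0 t1.le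
    set K' := (fun w => cmb o w t) '' K with hK'
    obtain ⟨ε, hε, hsub⟩ := hcb.cpt.exists_cthickening_subset_open isOpen_interior
      (show K' ⊆ interior K by rintro _ ⟨w, hw, rfl⟩; exact shrink_int h ho hw t0 t1)
    obtain ⟨n, hn⟩ := (en_tendsto.eventually (gt_mem_nhds hε)).exists
    have s1 : opoly hcb n ⊆ K := by
      refine (opoly_sub hcb n).trans ((nb_mono hn.le le_rfl).trans ?_)
      rw [nb_eq hε.le hcb.cpt]
      exact hsub.trans interior_subset
    have s2 : K ⊆ nb δ (opoly hcb n) := by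
      intro w hw
      exact ⟨_, sub_opoly hcb n ⟨w, hw, rfl⟩, (ht w hw).le⟩
    have g := good_outer hcb n
    have hQ : CB (opoly hcb n) := g.cb
    have p1 := PT_mono h (hQ.nb hδ.le) s2
    rw [PT_nb hQ hδ.le] at p1
    have p2 : PT (opoly hcb n) ≤ hypPerim K := by
      unfold opoly
      rw [PT_poly g]
      exact (ENNReal.ofReal_le_iff_le_toReal hfin.ne).1 (per_le g h.cpt s1)
    have p3 := hypArea_mono h.cpt s1
    have c := Real.cosh_pos δ
    have s := Real.sinh_pos_iff.2 hδ
    refine p1.trans (add_le_add ?_ ?_) <;> gcongr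
  have hc : Continuous fun δ => hypPerim K * cosh δ + (2 * π + hypArea K) * sinh δ := by fun_prop
  have hlim := (hc.tendsto 0).mono_left (nhdsWithin_le_nhds (s := Set.Ioi 0))
  simp only [Real.cosh_zero, Real.sinh_zero, mul_one, mul_zero, add_zero] at hlim
  refine ge_of_tendsto hlim ?_
  filter_upwards [self_mem_nhdsWithin] with δ hδ using key δ hδ

end partr

section parts

open MeasureTheory Metric Real UpperHalfPlane Filter
open scoped UpperHalfPlane MatrixGroups ENNReal NNReal Topology Pointwise

/-! ### Two boundary points in common -/

lemma ud_per (θ : ℝ) : ud (θ + 2 * π) = ud θ := by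
  unfold ud; rw [Real.cos_add_two_pi, Real.sin_add_two_pi]

lemma exists_dir {K M : Set ℍ} (hK : CB K) (hM : CB M) {o : ℍ} (ho : o ∈ interior K) (ho' : o ∈ interior M)
    (hn : ¬ K ⊆ M) : ∃ θ, G o K (ud θ) < G o M (ud θ) := by
  obtain ⟨x, hx, hx'⟩ := Set.not_subset.1 hn
  have hv : chm o x ≠ 0 := by
    rw [← chm_self o]
    intro h
    rw [chm_inj o h] at hx'
    exact hx' (interior_subset ho')
  obtain ⟨r, hr, θ, -, e⟩ := polar hv
  have h1 := (G_mem hK ho x).2 hx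
  have h2 := (G_mem hM ho' x).not.2 hx'
  rw [e, G_smul _ _ hr.le] at h1 h2
  exact ⟨θ, lt_of_mul_lt_mul_left (lt_of_le_of_lt h1 (not_le.1 h2)) hr.le⟩

lemma ud_inj {θ φ r s : ℝ} (h1 : θ < φ) (h2 : φ < θ + 2 * π) (hr : 0 < r) (hs : 0 < s) :
    r • ud θ ≠ s • ud φ := by
  intro e
  have e1 : r * Real.cos θ = s * Real.cos φ := congrArg Prod.fst e
  have e2 : r * Real.sin θ = s * Real.sin φ := congrArg Prod.snd e
  have a1 := Real.sin_sq_add_cos_sq θ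
  have a2 := Real.sin_sq_add_cos_sq φ
  have hrs : r = s := by
    have : r ^ 2 = s ^ 2 := by
      calc r ^ 2 = (r * Real.cos θ) ^ 2 + (r * Real.sin θ) ^ 2 := by linear_combination -r ^ 2 * a1
        _ = s ^ 2 := by rw [e1, e2]; linear_combination s ^ 2 * a2
    exact (sq_eq_sq₀ hr.le hs.le).1 this
  subst hrs
  have c1 := mul_left_cancel₀ hr.ne' e1
  have c2 := mul_left_cancel₀ hr.ne' e2
  have c3 : Real.cos (φ - θ) = 1 := by
    rw [Real.cos_sub, c1, c2]; linarith
  have := (Real.cos_eq_one_iff_of_lt_of_lt (by linarith [Real.pi_pos]) (by linarith)).1 c3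
  linarith

lemma two_pts {K M : Set ℍ} (hK : CB K) (hM : CB M) {o : ℍ} (ho : o ∈ interior K) (ho' : o ∈ interior M)
    (hn : ¬ K ⊆ M) (hn' : ¬ M ⊆ K) : ∃ p q, p ≠ q ∧ p ∈ frontier K ∧ p ∈ frontier M ∧
      q ∈ frontier K ∧ q ∈ frontier M := by
  obtain ⟨α, hα⟩ := exists_dir hK hM ho ho' hn
  obtain ⟨β', hβ'⟩ := exists_dir hM hK ho' ho hn'
  set D : ℝ → ℝ := fun θ => G o K (ud θ) - G o M (ud θ) with hD
  have hc : Continuous D := ((G_cont hK ho).comp continuous_ud).sub ((G_cont hM ho').comp continuous_ud)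
  have hper : Function.Periodic D (2 * π) := fun θ => by simp only [hD]; rw [ud_per]
  have hpi := Real.two_pi_pos
  obtain ⟨β, hβm, hβe⟩ := hper.exists_mem_Ico hpi β' α
  have hDα : D α < 0 := by simp only [hD]; linarith
  have hDβ : 0 < D β := by rw [← hβe]; simp only [hD]; linarith
  have hDα' : D (α + 2 * π) < 0 := by rw [hper]; exact hDα
  obtain ⟨θ₁, ⟨m1, m1'⟩, z1⟩ := intermediate_value_Ioo hβm.1 hc.continuousOn (show (0:ℝ) ∈ Set.Ioo _ _ from ⟨hDα, hDβ⟩)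
  obtain ⟨θ₂, ⟨m2, m2'⟩, z2⟩ := intermediate_value_Ioo' hβm.2.le hc.continuousOn (show (0:ℝ) ∈ Set.Ioo _ _ from ⟨hDα', hDβ⟩)
  have key : ∀ θ, D θ = 0 → ∃ p, chm o p = (G o K (ud θ))⁻¹ • ud θ ∧ p ∈ frontier K ∧ p ∈ frontier M := by
    intro θ h0
    obtain ⟨p, hp, e⟩ := bp_mem hK ho θ
    have e' : bp o K θ = bp o M θ := by
      unfold bp; rw [show G o K (ud θ) = G o M (ud θ) from sub_eq_zero.1 h0]
    refine ⟨p, e, (G_front hK ho p).1 (by rw [e, G_bp hK ho]), (G_front hM ho' p).1 (by rw [e, e', G_bp hM ho'])⟩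
  obtain ⟨p, ep, p1, p2⟩ := key θ₁ z1
  obtain ⟨q, eq, q1, q2⟩ := key θ₂ z2
  refine ⟨p, q, ?_, p1, p2, q1, q2⟩
  rintro rfl
  rw [ep] at eq
  exact ud_inj (by linarith) (by linarith) (inv_pos.2 (G_pos hK ho (ud_ne _))) (inv_pos.2 (G_pos hK ho (ud_ne _))) eq

/-! ### Generic intersections of polygons -/

lemma pos_interior {ι : Type} [Finite ι] {l : ι → Lin} {w : ℍ} (h : ∀ i, 0 < ev (l i) w) :
    w ∈ interior (poly l) := by
  refine mem_interior.2 ⟨{z | ∀ i, 0 < ev (l i) z}, fun z hz i => (hz i).le, ?_, h⟩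
  have : {z | ∀ i, 0 < ev (l i) z} = ⋂ i, {z | 0 < ev (l i) z} := by ext z; simp
  rw [this]
  exact isOpen_iInter_of_finite fun i => isOpen_lt continuous_const (continuous_ev _)

lemma frontier_edge {ι : Type} [Finite ι] {l : ι → Lin} {z : ℍ} (hz : z ∈ frontier (poly l)) :
    ∃ i, z ∈ edge l i := by
  rw [(isClosed_poly l).frontier_eq] at hz
  by_contra hcon
  push Not at hcon
  refine hz.2 (pos_interior fun i => lt_of_le_of_ne (hz.1 i) fun e => hcon i ⟨hz.1, e.symm⟩)

lemma strict_pt {ι : Type} [Finite ι] {m : ι → Lin} {p : ℍ} (hp : p ∈ poly m) {du dv : ℝ}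
    (hd : ∀ k, ev (m k) p = 0 → 0 < (m k).1 * dv + (m k).2.1 * du) : ∃ w, ∀ k, 0 < ev (m k) w := by
  have h1 : ∀ᶠ t in 𝓝[>] (0:ℝ), ∀ k, 0 < ev (m k) p + t * ((m k).1 * dv + (m k).2.1 * du) := by
    rw [Filter.eventually_all]
    intro k
    rcases (hp k).eq_or_lt with h0 | h0
    · filter_upwards [self_mem_nhdsWithin] with t ht
      rw [← h0, zero_add]
      exact mul_pos ht (hd k h0.symm)
    · have hc : Continuous fun t : ℝ => ev (m k) p + t * ((m k).1 * dv + (m k).2.1 * du) := by fun_prop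
      refine Filter.Eventually.filter_mono nhdsWithin_le_nhds (hc.continuousAt.eventually (lt_mem_nhds ?_))
      simpa using h0
  obtain ⟨ε, hε, hP, w, w1, w2⟩ := perturb p du dv _ h1
  refine ⟨w, fun k => ?_⟩
  have := hP k
  convert this using 1
  unfold ev; rw [w1, w2]; ring

lemma gen_interior {ι ι' : Type} [Finite ι] [Finite ι'] {l : ι → Lin} {l' : ι' → Lin}
    (hs : ∃ w, ∀ i, 0 < ev (l i) w) (hs' : ∃ w, ∀ i, 0 < ev (l' i) w)
    {g : SL(2, ℝ)} (hg : Gen l l' g) (hne : (poly l ∩ g • poly l').Nonempty) :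
    ∃ o, o ∈ interior (poly l) ∧ o ∈ interior (g • poly l') := by
  obtain ⟨p, hp, hp'⟩ := hne
  have hmem : p ∈ poly (Sum.elim l (fun j => pull g⁻¹ (l' j))) := by rw [← poly_elim]; exact ⟨hp, hp'⟩
  have hdir : ∀ (a : Lin) (w : ℍ), ev a p = 0 → 0 < ev a w → 0 < a.1 * (nq w - nq p) + a.2.1 * (w.re - p.re) := by
    intro a w h0 h1
    unfold ev at h0 h1
    linarith
  suffices hdd : ∃ du dv, ∀ k, ev (Sum.elim l (fun j => pull g⁻¹ (l' j)) k) p = 0 →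
      0 < (Sum.elim l (fun j => pull g⁻¹ (l' j)) k).1 * dv + (Sum.elim l (fun j => pull g⁻¹ (l' j)) k).2.1 * du by
    obtain ⟨du, dv, hd⟩ := hdd
    obtain ⟨w, hw⟩ := strict_pt hmem hd
    refine ⟨w, pos_interior fun i => hw (Sum.inl i), ?_⟩
    rw [smul_poly]
    exact pos_interior fun j => hw (Sum.inr j)
  by_cases c1 : ∃ i, ev (l i) p = 0
  · by_cases c2 : ∃ j, ev (pull g⁻¹ (l' j)) p = 0
    · obtain ⟨i, hi⟩ := c1
      obtain ⟨j, hj⟩ := c2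
      have hej : p ∈ g • edge l' j := mem_smul_edge.2 ⟨hp', hj⟩
      have hne : (edge l' j).Nonempty := ⟨_, Set.mem_smul_set_iff_inv_smul_mem.1 hej⟩
      have hD := dd_ne (hg.g3 i j hne) hi hj
      set a := l i with ha
      set b := pull g⁻¹ (l' j) with hb
      refine ⟨(a.1 - b.1) / dd a b, (b.2.1 - a.2.1) / dd a b, ?_⟩
      have ea : a.1 * ((b.2.1 - a.2.1) / dd a b) + a.2.1 * ((a.1 - b.1) / dd a b) = 1 := by
        field_simp; unfold dd; ring
      have eb : b.1 * ((b.2.1 - a.2.1) / dd a b) + b.2.1 * ((a.1 - b.1) / dd a b) = 1 := by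
        field_simp; unfold dd; ring
      rintro (i' | j') hk
      · by_cases e : i' = i
        · subst e; simp only [Sum.elim_inl]; rw [← ha, ea]; exact one_pos
        · exact absurd hj (hg.g1 p ⟨hp, i', i, e, hk, hi⟩ j)
      · by_cases e : j' = j
        · subst e; simp only [Sum.elim_inr]; rw [← hb, eb]; exact one_pos
        · have := hg.g2 _ (mem_verts_smul hp' e hk hj) i
          rw [smul_inv_smul] at this
          exact absurd hi this
    · obtain ⟨w, hw⟩ := hs
      refine ⟨w.re - p.re, nq w - nq p, ?_⟩
      rintro (i' | j') hk
      · exact hdir _ w hk (hw i')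
      · exact absurd ⟨j', hk⟩ c2
  · obtain ⟨w, hw⟩ := hs'
    refine ⟨(g • w).re - p.re, nq (g • w) - nq p, ?_⟩
    rintro (i' | j') hk
    · exact absurd ⟨i', hk⟩ c1
    · refine hdir _ (g • w) hk ?_
      simp only [Sum.elim_inr]
      rw [ev_pull, inv_smul_smul]
      exact mul_pos (den_pos _ _) (hw j')

lemma gen_two {ι ι' : Type} [Finite ι] [Finite ι'] {l : ι → Lin} {l' : ι' → Lin} (h : GoodPoly l)
    (h' : GoodPoly l') (hs : ∃ w, ∀ i, 0 < ev (l i) w) (hs' : ∃ w, ∀ i, 0 < ev (l' i) w)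
    {g : SL(2, ℝ)} (hg : Gen l l' g) (hne : (poly l ∩ g • poly l').Nonempty)
    (hn : ¬ poly l ⊆ g • poly l') (hn' : ¬ g • poly l' ⊆ poly l) :
    ∃ x y : ι × ι', x ≠ y ∧ (edge l x.1 ∩ g • edge l' x.2).Nonempty ∧ (edge l y.1 ∩ g • edge l' y.2).Nonempty := by
  obtain ⟨o, o1, o2⟩ := gen_interior hs hs' hg hne
  obtain ⟨p, q, hpq, p1, p2, q1, q2⟩ := two_pts h.cb (h'.cb.smul g) o1 o2 hn hn'
  rw [smul_poly] at p2 q2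
  obtain ⟨i, hi⟩ := frontier_edge p1
  obtain ⟨j, hj⟩ := frontier_edge p2
  obtain ⟨i', hi'⟩ := frontier_edge q1
  obtain ⟨j', hj'⟩ := frontier_edge q2
  have ej : p ∈ g • edge l' j := by rw [smul_edge]; exact hj
  have ej' : q ∈ g • edge l' j' := by rw [smul_edge]; exact hj'
  refine ⟨(i, j), (i', j'), ?_, ⟨p, hi, ej⟩, ⟨q, hi', ej'⟩⟩
  intro e
  obtain ⟨rfl, rfl⟩ := Prod.mk.inj e
  have hne : (edge l' j).Nonempty := ⟨_, Set.mem_smul_set_iff_inv_smul_mem.1 ej⟩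
  exact hpq (line_inter_unique (hg.g3 i j hne) hi.2 hj.2 hi'.2 hj'.2)

theorem two_TT {ι ι' : Type} [Fintype ι] [Fintype ι'] {l : ι → Lin} {l' : ι' → Lin} (h : GoodPoly l)
    (h' : GoodPoly l') (hs : ∃ w, ∀ i, 0 < ev (l i) w) (hs' : ∃ w, ∀ i, 0 < ev (l' i) w)
    (hn : ∀ g : SL(2, ℝ), ¬ poly l ⊆ g • poly l' ∧ ¬ g • poly l' ⊆ poly l) :
    2 * TT (poly l) (poly l') ≤ ∑ x : ι × ι', TT (edge l x.1) (edge l' x.2) := by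
  set S : ι × ι' → Set SL(2, ℝ) := fun x => {g | (edge l x.1 ∩ g • edge l' x.2).Nonempty} with hS
  set H : Set SL(2, ℝ) := {g | (poly l ∩ g • poly l').Nonempty} with hH
  have mS : ∀ x, MeasurableSet (S x) := fun x =>
    measurableSet_hit (isCompact_edge h.cpt _) (isCompact_edge h'.cpt _)
  have mH : MeasurableSet H := measurableSet_hit h.cpt h'.cpt
  have e1 : ∑ x : ι × ι', TT (edge l x.1) (edge l' x.2) = ∫⁻ g, ∑ x, (S x).indicator 1 g ∂hm := by
    rw [lintegral_finsetSum _ fun x _ => measurable_one.indicator (mS x)]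
    refine Finset.sum_congr rfl fun x _ => ?_
    rw [lintegral_indicator_one (mS x)]; rfl
  have e2 : 2 * TT (poly l) (poly l') = ∫⁻ g, H.indicator (fun _ => 2) g ∂hm := by
    rw [lintegral_indicator_const mH]; rfl
  rw [e1, e2]
  refine lintegral_mono_ae ?_
  filter_upwards [gen_ae h h'] with g hg
  by_cases hgH : g ∈ H
  · rw [Set.indicator_of_mem hgH]
    obtain ⟨x, y, hxy, hx, hy⟩ := gen_two h h' hs hs' hg hgH (hn g).1 (hn g).2
    classical
    calc (2 : ℝ≥0∞) = ∑ z ∈ ({x, y} : Finset (ι × ι')), (S z).indicator 1 g := by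
          rw [Finset.sum_pair hxy, Set.indicator_of_mem (show g ∈ S x from hx),
            Set.indicator_of_mem (show g ∈ S y from hy)]
          simp only [Pi.one_apply]; norm_num
      _ ≤ _ := Finset.sum_le_univ_sum_of_nonneg fun _ => zero_le
  · rw [Set.indicator_of_notMem hgH]; exact zero_le

theorem poly_ineq {ι ι' : Type} [Fintype ι] [Fintype ι'] {l : ι → Lin} {l' : ι' → Lin} (h : GoodPoly l)
    (h' : GoodPoly l') (hs : ∃ w, ∀ i, 0 < ev (l i) w) (hs' : ∃ w, ∀ i, 0 < ev (l' i) w)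
    (hn : ∀ g : SL(2, ℝ), ¬ poly l ⊆ g • poly l' ∧ ¬ g • poly l' ⊆ poly l) :
    2 * π * (hypArea (poly l) + hypArea (poly l')) + hypArea (poly l) * hypArea (poly l') ≤ per l * per l' := by
  have h1 := two_TT h h' hs hs' hn
  have hfin : ∀ x : ι × ι', TT (edge l x.1) (edge l' x.2) ≠ ∞ := fun x =>
    (TT_lt_top (isCompact_edge h.cpt _) (isCompact_edge h'.cpt _)).ne
  have h2 := ENNReal.toReal_mono (ENNReal.sum_ne_top.2 fun x _ => hfin x) h1
  rw [ENNReal.toReal_sum fun x _ => hfin x, ENNReal.toReal_mul] at h2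
  have h3 : ∑ x : ι × ι', (TT (edge l x.1) (edge l' x.2)).toReal = cc * (per l * per l') := by
    unfold per
    rw [Finset.sum_mul_sum, Finset.mul_sum, Fintype.sum_prod_type]
    refine Finset.sum_congr rfl fun i _ => ?_
    rw [Finset.mul_sum]
    refine Finset.sum_congr rfl fun j _ => ?_
    rw [TT_edge h h']; ring
  rw [h3, cc_eq] at h2
  have h4 := kin_final h.cb h'.cb
  rw [PT_poly h, PT_poly h'] at h4
  have hk := kap_pos
  have hpi := Real.pi_pos
  have h5 : 2 * π * (TT (poly l) (poly l')).toReal ≤ kap * (2 * (per l * per l')) := by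
    calc _ = π * ((2 : ℝ≥0∞).toReal * (TT (poly l) (poly l')).toReal) := by
          rw [ENNReal.toReal_ofNat]; ring
      _ ≤ π * (2 * kap / π * (per l * per l')) := by gcongr
      _ = _ := by field_simp
  rw [h4] at h5
  have := le_of_mul_le_mul_left h5 hk
  linarith

/-! ### Limits of containments -/

lemma lim_contain {K L : Set ℍ} (hK : IsCompact K) (hne : K.Nonempty) (hL : IsCompact L)
    (hf : ∃ᶠ n in atTop, ∃ g : SL(2, ℝ), K ⊆ g • nb (en n) L) : ∃ g : SL(2, ℝ), K ⊆ g • L := by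
  set C : ℕ → Set SL(2, ℝ) := fun n => {g | K ⊆ g • nb (en n) L} with hC
  have hanti : ∀ m n, m ≤ n → C n ⊆ C m := by
    intro m n hmn g hg
    exact hg.trans (Set.smul_set_mono (nb_mono (en_anti hmn) le_rfl))
  have hnon : ∀ n, (C n).Nonempty := by
    intro n
    obtain ⟨m, hm, g, hg⟩ := Filter.frequently_atTop.1 hf n
    exact ⟨g, hanti n m hm hg⟩
  have hcl : ∀ n, IsClosed (C n) := by
    intro n
    have e : C n = ⋂ k ∈ K, (fun g : SL(2, ℝ) => g⁻¹ • k) ⁻¹' (nb (en n) L) := by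
      ext g
      simp only [hC, Set.mem_iInter, Set.mem_preimage]
      constructor
      · intro h k hk; exact Set.mem_smul_set_iff_inv_smul_mem.1 (h hk)
      · intro h k hk; exact Set.mem_smul_set_iff_inv_smul_mem.2 (h k hk)
    rw [e]
    refine isClosed_biInter fun k _ => (isCompact_nb (en_pos n).le hL).isClosed.preimage ?_
    exact continuous_inv.smul continuous_const
  have hcpt : IsCompact (C 0) := by
    refine (isCompact_hit hK (isCompact_nb (en_pos 0).le hL)).of_isClosed_subset (hcl 0) ?_
    intro g hg
    obtain ⟨k, hk⟩ := hne
    exact ⟨k, hk, hg hk⟩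
  obtain ⟨g, hg⟩ := IsCompact.nonempty_iInter_of_sequence_nonempty_isCompact_isClosed C
    (fun n => hanti n (n + 1) (Nat.le_succ n)) hnon hcpt hcl
  refine ⟨g, fun k hk => ?_⟩
  rw [Set.mem_iInter] at hg
  rw [Set.mem_smul_set_iff_inv_smul_mem, ← hL.isClosed.closure_eq, Metric.mem_closure_iff]
  intro ε hε
  obtain ⟨n, hn⟩ := (en_tendsto.eventually (gt_mem_nhds hε)).exists
  obtain ⟨w, hw, hd⟩ := Set.mem_smul_set_iff_inv_smul_mem.1 (hg n hk)
  exact ⟨w, hw, by rw [dist_comm]; exact lt_of_le_of_lt hd hn⟩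

theorem contain_pos {K L : Set ℍ} (hK : CB K) (hL : CB L)
    (h : PT K * PT L < 2 * π * (hypArea K + hypArea L) + hypArea K * hypArea L) :
    (∃ g : SL(2, ℝ), K ⊆ g • L) ∨ ∃ g : SL(2, ℝ), L ⊆ g • K := by
  have t1 : Tendsto (fun n => operi hK n * operi hL n) atTop (𝓝 (PT K * PT L)) :=
    (operi_tendsto hK).mul (operi_tendsto hL)
  have t2 : Tendsto (fun n => 2 * π * (hypArea (opoly hK n) + hypArea (opoly hL n)) +
      hypArea (opoly hK n) * hypArea (opoly hL n)) atTop
      (𝓝 (2 * π * (hypArea K + hypArea L) + hypArea K * hypArea L)) :=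
    (((area_opoly hK).add (area_opoly hL)).const_mul _).add ((area_opoly hK).mul (area_opoly hL))
  have t3 := t1.eventually_lt t2 h
  have t4 : ∀ᶠ n in atTop, (∃ g : SL(2, ℝ), K ⊆ g • nb (en n) L) ∨ ∃ g : SL(2, ℝ), L ⊆ g • nb (en n) K := by
    filter_upwards [t3] with n hn
    by_contra hcon
    push Not at hcon
    refine absurd hn (not_lt.2 (poly_ineq (good_outer hK n) (good_outer hL n) ?_ ?_ ?_))
    · obtain ⟨z, hz⟩ := hK.ne
      exact ⟨z, fun i => outer_pos hK n i.1 i.2 z hz⟩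
    · obtain ⟨z, hz⟩ := hL.ne
      exact ⟨z, fun i => outer_pos hL n i.1 i.2 z hz⟩
    · intro g
      refine ⟨fun hs => hcon.1 g ?_, fun hs => hcon.2 g⁻¹ ?_⟩
      · exact (sub_opoly hK n).trans (hs.trans (Set.smul_set_mono (opoly_sub hL n)))
      · have hs' : g • opoly hL n ⊆ opoly hK n := hs
        rw [Set.subset_smul_set_iff, inv_inv]
        exact (Set.smul_set_mono (sub_opoly hL n)).trans (hs'.trans (opoly_sub hK n))
  rcases (Filter.frequently_or_distrib.1 t4.frequently) with hf | hf
  · exact Or.inl (lim_contain hK.cpt hK.ne hL.cpt hf)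
  · exact Or.inr (lim_contain hL.cpt hL.ne hK.cpt hf)

/-- Expanding `K` slightly. -/
theorem contain_aux {K L : Set ℍ} (hK : CB K) (hL : CB L)
    (h : PT K * PT L ≤ 2 * π * (hypArea K + hypArea L) + hypArea K * hypArea L)
    (hs : (2 * π + hypArea K) * PT L ≤ PT K * (2 * π + hypArea L)) :
    (∃ g : SL(2, ℝ), K ⊆ g • L) ∨ ∃ g : SL(2, ℝ), L ⊆ g • K := by
  have key : ∀ ε > 0, (∃ g : SL(2, ℝ), nb ε K ⊆ g • L) ∨ ∃ g : SL(2, ℝ), L ⊆ g • nb ε K := by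
    intro ε hε
    refine contain_pos (hK.nb hε.le) hL ?_
    rw [PT_nb hK hε.le, steiner hK hε.le]
    have s := Real.sinh_pos_iff.2 hε
    have c : 1 < Real.cosh ε := Real.one_lt_cosh.2 hε.ne'
    have hpi := Real.pi_pos
    nlinarith [mul_nonneg s.le (sub_nonneg.2 hs), mul_nonneg (Real.cosh_pos ε).le (sub_nonneg.2 h),
      mul_pos (mul_pos hpi hpi) (sub_pos.2 c)]
  by_cases hc : ∃ ε > 0, ∃ g : SL(2, ℝ), nb ε K ⊆ g • L
  · obtain ⟨ε, hε, g, hg⟩ := hc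
    exact Or.inl ⟨g, (subset_nb hε.le K).trans hg⟩
  · refine Or.inr (lim_contain hL.cpt hL.ne hK.cpt (Filter.Eventually.frequently (Filter.Eventually.of_forall fun n => ?_)))
    exact (key _ (en_pos n)).resolve_left fun hh => hc ⟨_, en_pos n, hh⟩

theorem contain_final {K L : Set ℍ} (hK : CB K) (hL : CB L)
    (h : PT K * PT L ≤ 2 * π * (hypArea K + hypArea L) + hypArea K * hypArea L) :
    (∃ g : SL(2, ℝ), K ⊆ g • L) ∨ ∃ g : SL(2, ℝ), L ⊆ g • K := by
  rcases le_total ((2 * π + hypArea K) * PT L) (PT K * (2 * π + hypArea L)) with hs | hs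
  · exact contain_aux hK hL h hs
  · exact (contain_aux hL hK (by linarith) (by linarith)).symm

end parts

/-- Hadwiger's containment theorem in the hyperbolic plane: if
`P_K·P_L ≤ 2π(A_K + A_L) + A_K·A_L`, then some isometry `g` of `H²` takes
`K` into `L` or `L` into `K`. -/
theorem hadwiger_containment_hyperbolic (K L : Set ℍ)
    (hKcomp : IsCompact K) (hKconv : HypConvex K) (hKint : (interior K).Nonempty)
    (hLcomp : IsCompact L) (hLconv : HypConvex L) (hLint : (interior L).Nonempty)
    (h : hypPerim K * hypPerim L ≤
      2 * π * (hypArea K + hypArea L) + hypArea K * hypArea L) :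
    ∃ g : ℍ ≃ᵢ ℍ, (g '' K ⊆ L) ∨ (g '' L ⊆ K) := by
  have cK : CB K := ⟨hKcomp, hKconv.cconv, hKint.mono interior_subset⟩
  have cL : CB L := ⟨hLcomp, hLconv.cconv, hLint.mono interior_subset⟩
  have hP : PT K * PT L ≤ hypPerim K * hypPerim L :=
    mul_le_mul (PT_le cK hKint) (PT_le cL hLint) (PT_nonneg cL) ((PT_nonneg cK).trans (PT_le cK hKint))
  rcases contain_final cK cL (hP.trans h) with ⟨g, hg⟩ | ⟨g, hg⟩
  · refine ⟨IsometryEquiv.constSMul g⁻¹, Or.inl ?_⟩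
    rintro _ ⟨k, hk, rfl⟩
    exact Set.mem_smul_set_iff_inv_smul_mem.1 (hg hk)
  · refine ⟨IsometryEquiv.constSMul g⁻¹, Or.inr ?_⟩
    rintro _ ⟨k, hk, rfl⟩
    exact Set.mem_smul_set_iff_inv_smul_mem.1 (hg hk)
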